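/- There exist constants γ ∈ (0,1] and N, depending only on δ, K, and d, such that if L ∈ 𝔏_{δ,K} and u ∈ W^{1,2}_{d+1,loc}(C_{2,1}) ∩ C(C̄_{2,1}), then ∫_{C_{1,1}(1,0)} |Du|^γ dx dt ≤ N (∫_{C_{2,1}} |Lu|^{d+1} dx dt)^{γ/(d+1)} + N sup_{∂'C_{2,1}} |u|^γ. -/

import Mathlib

open MeasureTheory ENNReal Set

noncomputable section

/-- The Frobenius norm of a matrix, used as `|D²u|`. -/
def frobNorm {d : ℕ} (m : Matrix (Fin d) (Fin d) ℝ) : ℝ :=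
  Real.sqrt (∑ i, ∑ j, (m i j) ^ 2)

namespace PGE

open scoped MatrixOrder in
theorem psd_factor {d : ℕ} {H : Matrix (Fin d) (Fin d) ℝ} (hH : H.PosSemidef) :
    ∃ X : Matrix (Fin d) (Fin d) ℝ, ∀ i j, H i j = ∑ k, X k i * X k j := by
  obtain ⟨X, hX, -, hXX⟩ :=
    CFC.exists_sqrt_of_isSelfAdjoint_of_quasispectrumRestricts hH.isHermitian
          (QuasispectrumRestricts.nnreal_of_nonneg hH.nonneg)
  refine ⟨X, fun i j => ?_⟩
  rw [← hXX]
  simp only [Matrix.mul_apply]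
  refine Finset.sum_congr rfl fun k _ => ?_
  have : X i k = X k i := by
    have := congrFun (congrFun hX.star_eq i) k
    simpa using this.symm
  rw [this]

/-- the pairing `a : H`. -/
def ip {d : ℕ} (a H : Matrix (Fin d) (Fin d) ℝ) : ℝ := ∑ i, ∑ j, a i j * H i j

theorem ip_add {d : ℕ} (a H G : Matrix (Fin d) (Fin d) ℝ) : ip a (H + G) = ip a H + ip a G := by
  simp [ip, mul_add, Finset.sum_add_distrib]

theorem ip_smul {d : ℕ} (a H : Matrix (Fin d) (Fin d) ℝ) (c : ℝ) : ip a (c • H) = c * ip a H := by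
  simp only [ip, Finset.mul_sum, Matrix.smul_apply, smul_eq_mul]
  exact Finset.sum_congr rfl fun i _ => Finset.sum_congr rfl fun j _ => by ring

theorem ip_one {d : ℕ} (a : Matrix (Fin d) (Fin d) ℝ) : ip a 1 = ∑ i, a i i := by
  simp [ip, Matrix.one_apply]

/-- ellipticity -/
def Ell {d : ℕ} (δ : ℝ) (a : Matrix (Fin d) (Fin d) ℝ) : Prop :=
  ∀ ξ : EuclideanSpace ℝ (Fin d), δ * ‖ξ‖ ^ 2 ≤ ∑ i, ∑ j, a i j * ξ i * ξ j ∧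
          ∑ i, ∑ j, a i j * ξ i * ξ j ≤ δ⁻¹ * ‖ξ‖ ^ 2

theorem Ell.diag_le {d : ℕ} {δ : ℝ} {a : Matrix (Fin d) (Fin d) ℝ} (h : Ell δ a) (i : Fin d) :
    a i i ≤ δ⁻¹ := by
  have := (h (EuclideanSpace.single i 1)).2
  simpa [EuclideanSpace.single_apply] using this

theorem Ell.ip_one_le {d : ℕ} {δ : ℝ} {a : Matrix (Fin d) (Fin d) ℝ} (h : Ell δ a) :
    ip a 1 ≤ d * δ⁻¹ := by
  rw [ip_one]
  calc ∑ i, a i i ≤ ∑ _i : Fin d, δ⁻¹ := Finset.sum_le_sum fun i _ => h.diag_le i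
    _ = _ := by simp

theorem Ell.trace_le {d : ℕ} {δ : ℝ} {a H : Matrix (Fin d) (Fin d) ℝ} (h : Ell δ a)
    (hH : H.PosSemidef) : δ * H.trace ≤ ip a H := by
  obtain ⟨X, hX⟩ := psd_factor hH
  have h1 : ∀ k, δ * ∑ i, X k i ^ 2 ≤ ∑ i, ∑ j, a i j * X k i * X k j := by
    intro k
    have := (h (WithLp.toLp 2 (fun i => X k i))).1
    simpa [EuclideanSpace.norm_sq_eq] using this
  have h2 : H.trace = ∑ k, ∑ i, X k i ^ 2 := by
    rw [Finset.sum_comm]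
    simp only [Matrix.trace, Matrix.diag]
    exact Finset.sum_congr rfl fun i _ => by rw [hX]; exact Finset.sum_congr rfl fun j _ => by ring
  have h3 : ip a H = ∑ k, ∑ i, ∑ j, a i j * X k i * X k j := by
    rw [Finset.sum_comm]
    refine Finset.sum_congr rfl fun i _ => ?_
    rw [Finset.sum_comm]
    refine Finset.sum_congr rfl fun j _ => ?_
    rw [hX, Finset.mul_sum]
    exact Finset.sum_congr rfl fun k _ => by ring
  rw [h2, h3, Finset.mul_sum]
  exact Finset.sum_le_sum fun k _ => h1 k

theorem psd_det_le {d : ℕ} {H : Matrix (Fin d) (Fin d) ℝ} (hH : H.PosSemidef) :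
    H.det ≤ H.trace ^ d := by
  have h1 := hH.isHermitian.det_eq_prod_eigenvalues
  have h2 := hH.isHermitian.trace_eq_sum_eigenvalues
  simp only [RCLike.ofReal_real_eq_id, id] at h1 h2
  rw [h1]
  calc ∏ i, hH.isHermitian.eigenvalues i ≤ ∏ _i : Fin d, H.trace := by
        refine Finset.prod_le_prod (fun i _ => hH.eigenvalues_nonneg i) fun i _ => ?_
        rw [h2]
        exact Finset.single_le_sum (f := fun i => hH.isHermitian.eigenvalues i)
          (fun j _ => hH.eigenvalues_nonneg j) (Finset.mem_univ i)
    _ = _ := by simp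

/-- space-time -/
abbrev Sp (d : ℕ) := EuclideanSpace ℝ (Fin d)

/-- second order jets of functions on space-time. -/
structure Jet (d : ℕ) where
  v : ℝ × Sp d → ℝ
  t : ℝ × Sp d → ℝ
  g : ℝ × Sp d → Sp d
  q : ℝ × Sp d → Sp d
  H : ℝ × Sp d → Matrix (Fin d) (Fin d) ℝ

/-- The derivative of the value of a jet. -/
def Jet.dv {d : ℕ} (J : Jet d) (z : ℝ × Sp d) : ℝ × Sp d →L[ℝ] ℝ :=
  J.t z • ContinuousLinearMap.fst ℝ ℝ (Sp d) +
    (innerSL ℝ (J.g z)).comp (ContinuousLinearMap.snd ℝ ℝ (Sp d))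

/-- The derivative of the gradient of a jet. -/
def Jet.dg {d : ℕ} (J : Jet d) (z : ℝ × Sp d) : ℝ × Sp d →L[ℝ] Sp d :=
  (ContinuousLinearMap.fst ℝ ℝ (Sp d)).smulRight (J.q z) +
    (Matrix.toEuclideanCLM (n := Fin d) (𝕜 := ℝ) (J.H z)).comp (ContinuousLinearMap.snd ℝ ℝ (Sp d))

@[simp] theorem Jet.dv_apply {d : ℕ} (J : Jet d) (z w : ℝ × Sp d) :
    J.dv z w = J.t z * w.1 + inner ℝ (J.g z) w.2 := by
  simp [Jet.dv]

@[simp] theorem Jet.dg_apply {d : ℕ} (J : Jet d) (z w : ℝ × Sp d) :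
    J.dg z w = w.1 • J.q z + Matrix.toEuclideanCLM (n := Fin d) (𝕜 := ℝ) (J.H z) w.2 := by
  simp [Jet.dg]

/-- The jet is consistent. -/
structure Jet.Ok {d : ℕ} (J : Jet d) : Prop where
  hv : ∀ z, HasFDerivAt J.v (J.dv z) z
  hg : ∀ z, HasFDerivAt J.g (J.dg z) z
  hs : ∀ z, (J.H z).IsSymm

def Jet.add {d : ℕ} (J L : Jet d) : Jet d :=
  ⟨J.v + L.v, J.t + L.t, J.g + L.g, J.q + L.q, J.H + L.H⟩

def Jet.smul {d : ℕ} (c : ℝ) (J : Jet d) : Jet d :=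
  ⟨c • J.v, c • J.t, c • J.g, c • J.q, c • J.H⟩

theorem Jet.Ok.add {d : ℕ} {J L : Jet d} (hJ : J.Ok) (hL : L.Ok) : (J.add L).Ok where
  hv z := by
    have e : (J.add L).dv z = J.dv z + L.dv z :=
      ContinuousLinearMap.ext fun w => by simp [Jet.add, inner_add_left]; ring
    rw [e]; exact (hJ.hv z).add (hL.hv z)
  hg z := by
    have e : (J.add L).dg z = J.dg z + L.dg z :=
      ContinuousLinearMap.ext fun w => by simp [Jet.add]; abel
    rw [e]; exact (hJ.hg z).add (hL.hg z)
  hs z := (hJ.hs z).add (hL.hs z)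

theorem Jet.Ok.smul {d : ℕ} {J : Jet d} (hJ : J.Ok) (c : ℝ) : (J.smul c).Ok where
  hv z := by
    have e : (J.smul c).dv z = c • J.dv z :=
      ContinuousLinearMap.ext fun w => by simp [Jet.smul, inner_smul_left]; ring
    rw [e]; exact (hJ.hv z).const_smul c
  hg z := by
    have e : (J.smul c).dg z = c • J.dg z :=
      ContinuousLinearMap.ext fun w => by simp [Jet.smul, smul_comm c]
    rw [e]; exact (hJ.hg z).const_smul c
  hs z := (hJ.hs z).smul c

theorem Jet.Ok.cv {d : ℕ} {J : Jet d} (hJ : J.Ok) : Continuous J.v :=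
  continuous_iff_continuousAt.2 fun z => (hJ.hv z).continuousAt

theorem Jet.Ok.cg {d : ℕ} {J : Jet d} (hJ : J.Ok) : Continuous J.g :=
  continuous_iff_continuousAt.2 fun z => (hJ.hg z).continuousAt

/-- the determinant of the derivative of the Tso map. -/
theorem tso_det {d : ℕ} (J : Jet d) (z : ℝ × Sp d) (y : Sp d) :
    (((J.t z • ContinuousLinearMap.fst ℝ ℝ (Sp d)) -
      (innerSL ℝ y).comp (J.dg z)).prod (J.dg z)).det = J.t z * (J.H z).det := by
  set A := ((J.t z • ContinuousLinearMap.fst ℝ ℝ (Sp d)) -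
      (innerSL ℝ y).comp (J.dg z)).prod (J.dg z)
  let S : (ℝ × Sp d) →ₗ[ℝ] (ℝ × Sp d) :=
    LinearMap.transvection (-((innerSL ℝ y).comp (ContinuousLinearMap.snd ℝ ℝ (Sp d))).toLinearMap)
      ((1 : ℝ), (0 : Sp d))
  let T : (ℝ × Sp d) →ₗ[ℝ] (ℝ × Sp d) :=
    LinearMap.transvection (ContinuousLinearMap.fst ℝ ℝ (Sp d)).toLinearMap ((0 : ℝ), J.q z)
  let P : (ℝ × Sp d) →ₗ[ℝ] (ℝ × Sp d) :=
    LinearMap.prodMap (J.t z • LinearMap.id) LinearMap.id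
  let R : (ℝ × Sp d) →ₗ[ℝ] (ℝ × Sp d) :=
    LinearMap.prodMap LinearMap.id (Matrix.toEuclideanLin (J.H z))
  have hA : (A : (ℝ × Sp d) →ₗ[ℝ] (ℝ × Sp d)) = S ∘ₗ P ∘ₗ T ∘ₗ R := by
    refine LinearMap.ext fun w => ?_
    have e : Matrix.toEuclideanCLM (n := Fin d) (𝕜 := ℝ) (J.H z) w.2
      = Matrix.toEuclideanLin (J.H z) w.2 := rfl
    refine Prod.ext ?_ ?_
    · simp [A, S, P, T, R, LinearMap.transvection.apply, inner_add_right, inner_smul_right, e]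
      ring
    · simp [A, S, P, T, R, LinearMap.transvection.apply, e]
      abel
  have hdet : LinearMap.det (Matrix.toEuclideanLin (J.H z)) = (J.H z).det := by
    rw [Matrix.toEuclideanLin_eq_toLin_orthonormal, LinearMap.det_toLin]
  rw [ContinuousLinearMap.det, hA]
  simp only [LinearMap.det_comp]
  simp only [S, P, T, R, LinearMap.transvection.det, LinearMap.det_prodMap, hdet]
  simp

end PGE

namespace PGE

theorem nonneg_of_right {φ : ℝ → ℝ} {a b : ℝ} (hab : a < b) (hc : ContinuousAt φ a)
    (h : ∀ s, a < s → s < b → 0 ≤ φ s) : 0 ≤ φ a := by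
  have h1 : Filter.Tendsto φ (nhdsWithin a (Ioi a)) (nhds (φ a)) :=
    hc.tendsto.mono_left nhdsWithin_le_nhds
  refine ge_of_tendsto h1 ?_
  filter_upwards [Ioo_mem_nhdsGT hab] with s hs
  exact h s hs.1 hs.2

theorem deriv_nonneg_of_right {φ : ℝ → ℝ} {a b φ' : ℝ} (hab : a < b) (hc : HasDerivAt φ φ' a)
    (h : ∀ s, a < s → s < b → φ a ≤ φ s) : 0 ≤ φ' := by
  have h1 := (hasDerivAt_iff_tendsto_slope.1 hc).mono_left
    (nhdsWithin_mono a (fun x (hx : x ∈ Ioi a) => ne_of_gt hx))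
  refine ge_of_tendsto h1 ?_
  filter_upwards [Ioo_mem_nhdsGT hab] with s hs
  rw [slope_def_field]
  exact div_nonneg (sub_nonneg.2 (h s hs.1 hs.2)) (sub_nonneg.2 hs.1.le)

theorem second_deriv_nonneg {φ ψ : ℝ → ℝ} {H : ℝ} (h1 : ∀ s, HasDerivAt φ (ψ s) s)
    (h2 : HasDerivAt ψ H 0) (hm : IsLocalMin φ 0) : 0 ≤ H := by
  by_contra! hH
  have hψ0 : ψ 0 = 0 := hm.hasDerivAt_eq_zero (h1 0)
  set χ : ℝ → ℝ := fun s => φ s + (-H / 4) * s ^ 2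
  have d1 : ∀ s, HasDerivAt χ (ψ s + (-H / 2) * s) s := fun s => by
    have := (h1 s).add (((hasDerivAt_id s).pow 2).const_mul (-H / 4))
    exact this.congr_deriv (by simp; ring)
  have e1 : deriv χ = fun s => ψ s + (-H / 2) * s := funext fun s => (d1 s).deriv
  have d2 : HasDerivAt (deriv χ) (H + (-H/2)) 0 := by
    rw [e1]
    exact (h2.add ((hasDerivAt_id (0:ℝ)).const_mul (-H / 2))).congr_deriv (by simp)
  have hmax : IsLocalMax χ 0 := by
    apply isLocalMax_of_deriv_deriv_neg
    · rw [d2.deriv]; linarith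
    · rw [e1]; simp [hψ0]
    · exact (d1 0).continuousAt
  have := hmax.and hm
  obtain ⟨ε, hε, hb⟩ := Metric.eventually_nhds_iff.1 this
  have h3 := hb (y := ε / 2) (by simp [abs_of_pos hε]; linarith)
  have h4 : φ (ε/2) + (-H / 4) * (ε/2) ^ 2 ≤ φ 0 + (-H/4) * 0^2 := h3.1
  have h5 : φ 0 ≤ φ (ε/2) := h3.2
  have : 0 < (-H / 4) * (ε/2) ^ 2 := by have : 0 < -H/4 := by linarith
                                        positivity
  linarith

variable {d : ℕ}

/-- cylinder -/
def Zc (t1 t2 : ℝ) (xc : Sp d) (R : ℝ) : Set (ℝ × Sp d) := Icc t1 t2 ×ˢ Metric.closedBall xc R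

/-- the contact set -/
def contact (J : Jet d) (t1 t2 : ℝ) (xc : Sp d) (R η : ℝ) : Set (ℝ × Sp d) :=
  {z | z ∈ Zc t1 t2 xc R ∧ z.1 < t2 ∧ ‖z.2 - xc‖ < R ∧
    (J.v z < 0 ∧ J.v z - inner ℝ (J.g z) (z.2 - xc) ≤ -(2 * η * R)) ∧ ‖J.g z‖ ≤ η ∧
    ∀ w ∈ Zc t1 t2 xc R, z.1 < w.1 → J.v z + inner ℝ (J.g z) (w.2 - z.2) ≤ J.v w}

theorem Zc_compact {t1 t2 : ℝ} {xc : Sp d} {R : ℝ} : IsCompact (Zc t1 t2 xc R) :=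
  isCompact_Icc.prod (isCompact_closedBall _ _)

theorem contact_meas {J : Jet d} (hJ : J.Ok) (t1 t2 : ℝ) (xc : Sp d) (R η : ℝ) :
    MeasurableSet (contact J t1 t2 xc R η) := by
  have hcv := hJ.cv
  have hcg := hJ.cg
  have h1 : MeasurableSet (Zc t1 t2 xc R) := (Zc_compact).isClosed.measurableSet
  have h2 : MeasurableSet {z : ℝ × Sp d | z.1 < t2} := measurableSet_lt (by fun_prop) (by fun_prop)
  have h3 : MeasurableSet {z : ℝ × Sp d | ‖z.2 - xc‖ < R} :=
    (isOpen_lt (by fun_prop) (by fun_prop)).measurableSet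
  have h4 : MeasurableSet {z : ℝ × Sp d | J.v z < 0} :=
    (isOpen_lt (by fun_prop) (by fun_prop)).measurableSet
  have h4b : MeasurableSet {z : ℝ × Sp d | J.v z - inner ℝ (J.g z) (z.2 - xc) ≤ -(2 * η * R)} :=
    (isClosed_le (by fun_prop) (by fun_prop)).measurableSet
  have h5 : MeasurableSet {z : ℝ × Sp d | ‖J.g z‖ ≤ η} :=
    (isClosed_le (by fun_prop) (by fun_prop)).measurableSet
  have h6 : MeasurableSet {z : ℝ × Sp d | ∀ w ∈ Zc t1 t2 xc R, z.1 < w.1 →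
      J.v z + inner ℝ (J.g z) (w.2 - z.2) ≤ J.v w} := by
    apply IsClosed.measurableSet
    have : {z : ℝ × Sp d | ∀ w ∈ Zc t1 t2 xc R, z.1 < w.1 →
        J.v z + inner ℝ (J.g z) (w.2 - z.2) ≤ J.v w} = ⋂ w ∈ Zc t1 t2 xc R,
      ({z : ℝ × Sp d | w.1 ≤ z.1} ∪ {z | J.v z + inner ℝ (J.g z) (w.2 - z.2) ≤ J.v w}) := by
      ext z; simp [imp_iff_not_or]
    rw [this]
    refine isClosed_biInter fun w _ => ?_
    exact (isClosed_le (by fun_prop) (by fun_prop)).union (isClosed_le (by fun_prop) (by fun_prop))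
  exact h1.inter (h2.inter (h3.inter ((h4.inter h4b).inter (h5.inter h6))))

theorem contact_same {J : Jet d} (hJ : J.Ok) {t1 t2 : ℝ} {xc : Sp d} {R : ℝ} {p : Sp d} {h : ℝ}
    {z : ℝ × Sp d} (hz : z ∈ Zc t1 t2 xc R) (ht : z.1 < t2)
    (hw : ∀ w ∈ Zc t1 t2 xc R, z.1 < w.1 → h + inner ℝ p (w.2 - z.2) ≤ J.v w) (x : Sp d)
    (hx : x ∈ Metric.closedBall xc R) : h + inner ℝ p (x - z.2) ≤ J.v (z.1, x) := by
  have := nonneg_of_right (φ := fun s => J.v (s, x) - (h + inner ℝ p (x - z.2))) ht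
    (by have := hJ.cv; fun_prop) (fun s h1 h2 => by
      have := hw (s, x) ⟨⟨hz.1.1.trans h1.le, h2.le⟩, hx⟩ h1
      simpa using this)
  simpa using this

theorem line_deriv {J : Jet d} (hJ : J.Ok) (t : ℝ) (x ξ : Sp d) (s : ℝ) :
    HasDerivAt (fun s : ℝ => J.v (t, x + s • ξ)) (inner ℝ (J.g (t, x + s • ξ)) ξ) s := by
  have hl : HasDerivAt (fun s : ℝ => (t, x + s • ξ)) ((0 : ℝ), ξ) s := by
    refine (hasDerivAt_const s t).prodMk ?_
    simpa using ((hasDerivAt_id s).smul_const ξ).const_add x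
  exact ((hJ.hv (t, x + s • ξ)).comp_hasDerivAt s hl).congr_deriv (by simp)

theorem line_deriv2 {J : Jet d} (hJ : J.Ok) (t : ℝ) (x ξ : Sp d) (s : ℝ) :
    HasDerivAt (fun s : ℝ => inner ℝ (J.g (t, x + s • ξ)) ξ)
      (inner ℝ (Matrix.toEuclideanCLM (n := Fin d) (𝕜 := ℝ) (J.H (t, x + s • ξ)) ξ) ξ) s := by
  have hl : HasDerivAt (fun s : ℝ => (t, x + s • ξ)) ((0 : ℝ), ξ) s := by
    refine (hasDerivAt_const s t).prodMk ?_
    simpa using ((hasDerivAt_id s).smul_const ξ).const_add x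
  have h1 := (hJ.hg (t, x + s • ξ)).comp_hasDerivAt s hl
  have := h1.inner (𝕜 := ℝ) (hasDerivAt_const s ξ)
  simpa using this

theorem time_deriv {J : Jet d} (hJ : J.Ok) (t : ℝ) (x : Sp d) :
    HasDerivAt (fun s : ℝ => J.v (s, x)) (J.t (t, x)) t := by
  have hl : HasDerivAt (fun s : ℝ => (s, x)) ((1 : ℝ), (0 : Sp d)) t :=
    (hasDerivAt_id t).prodMk (hasDerivAt_const t x)
  exact ((hJ.hv (t, x)).comp_hasDerivAt t hl).congr_deriv (by simp)

theorem line_ev {x ξ xc : Sp d} {R : ℝ} (h : ‖x - xc‖ < R) :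
    ∀ᶠ s : ℝ in nhds 0, x + s • ξ ∈ Metric.closedBall xc R := by
  have : ContinuousAt (fun s : ℝ => ‖x + s • ξ - xc‖) 0 := by fun_prop
  have := this.eventually_lt (continuousAt_const (y := R)) (by simpa using h)
  filter_upwards [this] with s hs
  rw [mem_closedBall_iff_norm]; exact hs.le

theorem contact_t {J : Jet d} (hJ : J.Ok) {t1 t2 : ℝ} {xc : Sp d} {R η : ℝ} {z : ℝ × Sp d}
    (hz : z ∈ contact J t1 t2 xc R η) : 0 ≤ J.t z := by
  obtain ⟨h1, h2, h3, -, -, h6⟩ := hz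
  refine deriv_nonneg_of_right h2 (time_deriv hJ z.1 z.2) fun s hs hs2 => ?_
  have := h6 (s, z.2) ⟨⟨h1.1.1.trans hs.le, hs2.le⟩, h1.2⟩ hs
  simpa using this

theorem contact_H {J : Jet d} (hJ : J.Ok) {t1 t2 : ℝ} {xc : Sp d} {R η : ℝ} {z : ℝ × Sp d}
    (hz : z ∈ contact J t1 t2 xc R η) : (J.H z).PosSemidef := by
  obtain ⟨h1, h2, h3, -, -, h6⟩ := hz
  refine Matrix.PosSemidef.of_dotProduct_mulVec_nonneg ?_ fun y => ?_
  · have := hJ.hs z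
    rw [Matrix.IsHermitian, Matrix.conjTranspose_eq_transpose_of_trivial]; exact this
  · set ξ : Sp d := WithLp.toLp 2 y
    have hL : ∀ s, HasDerivAt (fun s : ℝ => J.v (z.1, z.2 + s • ξ) - s * inner ℝ (J.g z) ξ)
        (inner ℝ (J.g (z.1, z.2 + s • ξ)) ξ - inner ℝ (J.g z) ξ) s := fun s => by
      exact ((line_deriv hJ z.1 z.2 ξ s).sub
        ((hasDerivAt_id s).mul_const (inner ℝ (J.g z) ξ))).congr_deriv (by simp)
    have hL2 := (line_deriv2 hJ z.1 z.2 ξ 0).sub_const (inner ℝ (J.g z) ξ)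
    have := second_deriv_nonneg hL hL2 (by
      filter_upwards [line_ev (ξ := ξ) h3] with s hs
      have := contact_same hJ h1 h2 h6 _ hs
      simp [inner_smul_right] at this ⊢
      linarith)
    rw [real_inner_comm, Matrix.inner_toEuclideanCLM] at this
    simpa [ξ] using this

theorem contact_exists {J : Jet d} (hJ : J.Ok) {t1 t2 : ℝ} {xc : Sp d} {R μ : ℝ}
    (hR : 0 < R) (hμ : 0 < μ)
    (hb : ∀ z ∈ Zc t1 t2 xc R, (z.1 = t2 ∨ ‖z.2 - xc‖ = R) → 0 ≤ J.v z)
    {z0 : ℝ × Sp d} (hz0 : z0 ∈ Zc t1 t2 xc R) (hv0 : J.v z0 ≤ -μ)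
    {h : ℝ} {p : Sp d} (hh1 : -(3 * μ / 4) ≤ h) (hh2 : h ≤ -(μ / 2)) (hp : ‖p‖ ≤ μ / (4 * R)) :
    ∃ z ∈ contact J t1 t2 xc R (μ / (4 * R)), J.g z = p ∧ J.v z - inner ℝ (J.g z) (z.2 - xc) = h := by
  have hcv := hJ.cv
  set F : ℝ × Sp d → ℝ := fun w => J.v w - inner ℝ p (w.2 - xc) with hF
  have hFc : Continuous F := by fun_prop
  have hpb : ∀ w ∈ Zc t1 t2 xc R, |inner ℝ p (w.2 - xc)| ≤ μ / 4 := by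
    intro w hw
    have h1 : ‖w.2 - xc‖ ≤ R := mem_closedBall_iff_norm.1 hw.2
    calc |inner ℝ p (w.2 - xc)| ≤ ‖p‖ * ‖w.2 - xc‖ := abs_real_inner_le_norm _ _
      _ ≤ μ / (4 * R) * R := by gcongr
      _ = μ / 4 := by field_simp
  have hS : IsCompact (Zc t1 t2 xc R ∩ {w | F w ≤ h}) :=
    Zc_compact.inter_right (isClosed_le hFc continuous_const)
  have hS0 : (Zc t1 t2 xc R ∩ {w | F w ≤ h}).Nonempty := by
    refine ⟨z0, hz0, ?_⟩
    have := abs_le.1 (hpb z0 hz0)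
    simp only [hF, Set.mem_ofPred_eq]; linarith
  obtain ⟨z, ⟨hzZ, hzF⟩, hmax⟩ := hS.exists_isMaxOn hS0 (continuous_fst.continuousOn)
  have hzF' : F z ≤ h := hzF
  have hvz : J.v z < 0 := by
    have := abs_le.1 (hpb z hzZ)
    simp only [hF] at hzF'; linarith
  have hzt : z.1 < t2 := lt_of_le_of_ne hzZ.1.2 fun e => by
    have := hb z hzZ (Or.inl e); linarith
  have hzx : ‖z.2 - xc‖ < R := lt_of_le_of_ne (mem_closedBall_iff_norm.1 hzZ.2)
    fun e => by have := hb z hzZ (Or.inr e); linarith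
  have hout : ∀ w ∈ Zc t1 t2 xc R, z.1 < w.1 → h ≤ F w := by
    intro w hw hlt
    by_contra! hc
    exact absurd (hmax ⟨hw, hc.le⟩) (not_le.2 hlt)
  have hFz : F z = h := by
    refine le_antisymm hzF' ?_
    have := nonneg_of_right (φ := fun s => F (s, z.2) - h) hzt (by fun_prop)
      (fun s h1 h2 => sub_nonneg.2 (hout (s, z.2) ⟨⟨hzZ.1.1.trans h1.le, h2.le⟩, hzZ.2⟩ h1))
    simpa using this
  have hcon : ∀ w ∈ Zc t1 t2 xc R, z.1 < w.1 → J.v z + inner ℝ p (w.2 - z.2) ≤ J.v w := by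
    intro w hw hlt
    have h1 := hout w hw hlt
    rw [← hFz] at h1
    simp only [hF] at h1
    have : w.2 - z.2 = (w.2 - xc) - (z.2 - xc) := by abel
    rw [this, inner_sub_right]; linarith
  have hg : J.g z = p := by
    have key : ∀ ξ : Sp d, inner ℝ (J.g z - p) ξ = 0 := by
      intro ξ
      have hm : IsLocalMin (fun s : ℝ => J.v (z.1, z.2 + s • ξ) - s * inner ℝ p ξ) 0 := by
        filter_upwards [line_ev (ξ := ξ) hzx] with s hs
        have := contact_same hJ hzZ hzt hcon _ hs
        simp [inner_smul_right] at this ⊢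
        linarith
      have hd := (line_deriv hJ z.1 z.2 ξ 0).sub ((hasDerivAt_id (0:ℝ)).mul_const (inner ℝ p ξ))
      have := hm.hasDerivAt_eq_zero hd
      rw [inner_sub_left]
      simpa using this
    have := key (J.g z - p)
    rw [inner_self_eq_zero] at this
    exact sub_eq_zero.1 this
  have hh3 : J.v z - inner ℝ (J.g z) (z.2 - xc) ≤ -(2 * (μ / (4 * R)) * R) := by
    rw [hg]
    have : 2 * (μ / (4 * R)) * R = μ / 2 := by field_simp; norm_num
    rw [this]; exact hzF'.trans hh2
  refine ⟨z, ⟨hzZ, hzt, hzx, ⟨hvz, hh3⟩, by rw [hg]; exact hp, by rw [hg]; exact hcon⟩, hg, ?_⟩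
  rw [hg]; exact hFz

/-- the dimensional constant in the ABP estimate. -/
def cd (d : ℕ) : ℝ := (volume (Metric.closedBall (0 : Sp d) 1)).toReal / 4 ^ (d + 1)

theorem cd_pos (d : ℕ) : 0 < cd d := by
  unfold cd
  have h1 : 0 < volume (Metric.closedBall (0 : Sp d) 1) := Metric.measure_closedBall_pos _ _ one_pos
  have h2 : volume (Metric.closedBall (0 : Sp d) 1) < ⊤ := measure_closedBall_lt_top
  have := ENNReal.toReal_pos h1.ne' h2.ne
  positivity

instance instHaar : (volume : Measure (ℝ × Sp d)).IsAddHaarMeasure := by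
  rw [Measure.volume_eq_prod]; infer_instance

theorem tso_fderiv {J : Jet d} (hJ : J.Ok) (xc : Sp d) (z : ℝ × Sp d) :
    HasFDerivAt (fun z => (J.v z - inner ℝ (J.g z) (z.2 - xc), J.g z))
      (((J.t z • ContinuousLinearMap.fst ℝ ℝ (Sp d)) -
      (innerSL ℝ (z.2 - xc)).comp (J.dg z)).prod (J.dg z)) z := by
  refine HasFDerivAt.prodMk ?_ (hJ.hg z)
  have h1 := (hJ.hg z).inner ℝ ((hasFDerivAt_snd (p := z) (𝕜 := ℝ)).sub_const xc)
  have h2 := (hJ.hv z).sub h1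
  refine h2.congr_fderiv ?_
  refine ContinuousLinearMap.ext fun w => ?_
  simp [fderivInnerCLM_apply, real_inner_comm, inner_sub_right]
  ring

/-- the core ABP lemma. -/
theorem core {J : Jet d} (hJ : J.Ok) {t1 t2 : ℝ} {xc : Sp d} {R μ : ℝ}
    (hR : 0 < R) (hμ : 0 < μ)
    (hb : ∀ z ∈ Zc t1 t2 xc R, (z.1 = t2 ∨ ‖z.2 - xc‖ = R) → 0 ≤ J.v z)
    {z0 : ℝ × Sp d} (hz0 : z0 ∈ Zc t1 t2 xc R) (hv0 : J.v z0 ≤ -μ)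
    (G : ℝ × Sp d → ℝ)
    (hG : ∀ z ∈ contact J t1 t2 xc R (μ / (4 * R)), J.t z + (J.H z).trace ≤ G z) :
    ENNReal.ofReal (cd d * μ ^ (d + 1) / R ^ d) ≤
      ∫⁻ z in contact J t1 t2 xc R (μ / (4 * R)), ENNReal.ofReal (G z) ^ (d + 1) := by
  set Γ := contact J t1 t2 xc R (μ / (4 * R)) with hΓ
  set Φ : ℝ × Sp d → ℝ × Sp d := fun z => (J.v z - inner ℝ (J.g z) (z.2 - xc), J.g z)
  have hm : MeasurableSet Γ := contact_meas hJ _ _ _ _ _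
  have h1 := MeasureTheory.addHaar_image_le_lintegral_abs_det_fderiv (μ := volume) hm
    (fun z (_ : z ∈ Γ) => (tso_fderiv hJ xc z).hasFDerivWithinAt)
  have hsub : (Icc (-(3 * μ / 4)) (-(μ / 2))) ×ˢ Metric.closedBall (0 : Sp d) (μ / (4 * R)) ⊆ Φ '' Γ := by
    rintro ⟨h, p⟩ ⟨hh, hp⟩
    obtain ⟨z, hz, e1, e2⟩ := contact_exists hJ hR hμ hb hz0 hv0 hh.1 hh.2
      (by simpa [mem_closedBall_iff_norm] using hp)
    exact ⟨z, hz, Prod.ext e2 e1⟩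
  have hη : 0 ≤ μ / (4 * R) := by positivity
  have hvol : volume ((Icc (-(3 * μ / 4)) (-(μ / 2))) ×ˢ Metric.closedBall (0 : Sp d) (μ / (4 * R)))
      = ENNReal.ofReal (cd d * μ ^ (d + 1) / R ^ d) := by
    rw [Measure.volume_eq_prod, Measure.prod_prod, Real.volume_Icc,
      Measure.addHaar_closedBall' _ _ hη]
    have h2 : volume (Metric.closedBall (0 : Sp d) 1) < ⊤ := measure_closedBall_lt_top
    rw [← ENNReal.ofReal_toReal h2.ne, ← ENNReal.ofReal_mul (by positivity),
      ← ENNReal.ofReal_mul (by linarith)]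
    congr 1
    simp only [finrank_euclideanSpace, Fintype.card_fin, cd]
    rw [div_pow, mul_pow]
    field_simp
    ring
  rw [← hvol]
  refine (measure_mono hsub).trans (h1.trans ?_)
  refine setLIntegral_mono' hm fun z hz => ?_
  have ht := contact_t hJ hz
  have hH := contact_H hJ hz
  have htr : 0 ≤ (J.H z).trace := hH.trace_nonneg
  rw [tso_det, abs_of_nonneg (mul_nonneg ht hH.det_nonneg),
    ← ENNReal.ofReal_pow (by have := hG z hz; linarith)]
  refine ENNReal.ofReal_le_ofReal ?_
  calc J.t z * (J.H z).det ≤ J.t z * (J.H z).trace ^ d := by gcongr; exact psd_det_le hH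
    _ ≤ (J.t z + (J.H z).trace) * (J.t z + (J.H z).trace) ^ d := by gcongr <;> linarith
    _ = (J.t z + (J.H z).trace) ^ (d + 1) := by ring
    _ ≤ _ := by gcongr; exact hG z hz

end PGE

namespace PGE

variable {d : ℕ}

/-- quadratic jet -/
def quad (α m : ℝ) (p : Sp d) (β : ℝ) (y : Sp d) : Jet d where
  v z := α + m * z.1 + inner ℝ p z.2 + β / 2 * ‖z.2 - y‖ ^ 2
  t _ := m
  g z := p + β • (z.2 - y)
  q _ := 0
  H _ := β • 1

theorem quad_ok (α m : ℝ) (p : Sp d) (β : ℝ) (y : Sp d) : (quad α m p β y).Ok where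
  hv z := by
    have h1 : HasFDerivAt (fun z : ℝ × Sp d => z.2 - y) (ContinuousLinearMap.snd ℝ ℝ (Sp d)) z :=
      hasFDerivAt_snd.sub_const y
    have h2 := (h1.norm_sq).const_mul (β / 2)
    have h3 : HasFDerivAt (fun z : ℝ × Sp d => inner ℝ p z.2)
        ((innerSL ℝ p).comp (ContinuousLinearMap.snd ℝ ℝ (Sp d))) z :=
      ((innerSL ℝ p).comp (ContinuousLinearMap.snd ℝ ℝ (Sp d))).hasFDerivAt
    have h4 : HasFDerivAt (fun z : ℝ × Sp d => α + m * z.1)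
        (m • ContinuousLinearMap.fst ℝ ℝ (Sp d)) z :=
      (hasFDerivAt_fst.const_mul m).const_add α
    refine ((h4.add h3).add h2).congr_fderiv ?_
    refine ContinuousLinearMap.ext fun w => ?_
    simp [quad, inner_add_left, inner_smul_left, inner_sub_left]
    ring
  hg z := by
    have h1 : HasFDerivAt (fun z : ℝ × Sp d => z.2 - y) (ContinuousLinearMap.snd ℝ ℝ (Sp d)) z :=
      hasFDerivAt_snd.sub_const y
    have h2 := (h1.const_smul β).const_add p
    refine h2.congr_fderiv ?_
    refine ContinuousLinearMap.ext fun w => ?_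
    simp [quad]
  hs z := by simp [quad, Matrix.IsSymm]

theorem add_pow_le2 {x y : ℝ} (hx : 0 ≤ x) (hy : 0 ≤ y) (n : ℕ) :
    (x + y) ^ n ≤ 2 ^ n * (x ^ n + y ^ n) := by
  have h : x + y ≤ 2 * max x y := by
    have := le_max_left x y; have := le_max_right x y; linarith
  calc (x + y) ^ n ≤ (2 * max x y) ^ n := by gcongr
    _ = 2 ^ n * (max x y) ^ n := by rw [mul_pow]
    _ ≤ _ := by
      gcongr
      rcases le_total x y with h | h
      · rw [max_eq_right h]; have := pow_nonneg hx n; linarith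
      · rw [max_eq_left h]; have := pow_nonneg hy n; linarith

theorem contact_sub {J : Jet d} {t1 t2 : ℝ} {xc : Sp d} {R η : ℝ} :
    contact J t1 t2 xc R η ⊆ Zc t1 t2 xc R := fun _ hz => hz.1

theorem Zc_vol {t1 t2 : ℝ} (h : t1 ≤ t2) {xc : Sp d} {R : ℝ} (hR : 0 ≤ R) :
    volume (Zc t1 t2 xc R) = ENNReal.ofReal ((t2 - t1) * (4 ^ (d + 1) * cd d * R ^ d)) := by
  rw [Zc, Measure.volume_eq_prod, Measure.prod_prod, Real.volume_Icc,
    Measure.addHaar_closedBall' _ _ hR]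
  have h2 : volume (Metric.closedBall (0 : Sp d) 1) < ⊤ := measure_closedBall_lt_top
  rw [← ENNReal.ofReal_toReal h2.ne, ← ENNReal.ofReal_mul (by positivity),
    ← ENNReal.ofReal_mul (by linarith)]
  congr 1
  simp only [finrank_euclideanSpace, Fintype.card_fin, cd]
  field_simp

theorem core2 {J : Jet d} (hJ : J.Ok) {t1 t2 : ℝ} {xc : Sp d} {R μ : ℝ}
    (hR : 0 < R) (hμ : 0 < μ)
    (hb : ∀ z ∈ Zc t1 t2 xc R, (z.1 = t2 ∨ ‖z.2 - xc‖ = R) → 0 ≤ J.v z)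
    {z0 : ℝ × Sp d} (hz0 : z0 ∈ Zc t1 t2 xc R) (hv0 : J.v z0 ≤ -μ)
    {δ : ℝ} (hδ0 : 0 < δ) (hδ1 : δ < 1) {a : ℝ × Sp d → Matrix (Fin d) (Fin d) ℝ}
    (ha : ∀ z, Ell δ (a z)) {f : ℝ × Sp d → ℝ} (hf : ∀ z, 0 ≤ f z) {k F : ℝ} (hk : 0 ≤ k)
    (hF0 : 0 ≤ F)
    (hG : ∀ z ∈ contact J t1 t2 xc R (μ / (4 * R)), J.t z + ip (a z) (J.H z) ≤ f z + k)
    (hF : ∫⁻ z in Zc t1 t2 xc R, ENNReal.ofReal (f z) ^ (d + 1) ≤ ENNReal.ofReal F) :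
    cd d * μ ^ (d + 1) / R ^ d ≤ (2 / δ) ^ (d + 1) *
      (F + k ^ (d + 1) * (volume (contact J t1 t2 xc R (μ / (4 * R)))).toReal) := by
  set Γ := contact J t1 t2 xc R (μ / (4 * R)) with hΓ
  have hm : MeasurableSet Γ := contact_meas hJ _ _ _ _ _
  have hfin : volume Γ ≠ ⊤ :=
    ((measure_mono contact_sub).trans_lt (Zc_compact.measure_lt_top)).ne
  have h1 := core hJ hR hμ hb hz0 hv0 (fun z => δ⁻¹ * (f z + k)) (fun z hz => by
    have ht := contact_t hJ hz
    have h2 := (ha z).trace_le (contact_H hJ hz)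
    have h3 := hG z hz
    rw [inv_mul_eq_div, le_div_iff₀ hδ0]
    nlinarith)
  have hnn : 0 ≤ (2 / δ) ^ (d + 1) *
      (F + k ^ (d + 1) * (volume Γ).toReal) := by positivity
  refine (ENNReal.ofReal_le_ofReal_iff hnn).1 (h1.trans ?_)
  calc ∫⁻ z in Γ, ENNReal.ofReal (δ⁻¹ * (f z + k)) ^ (d + 1)
      ≤ ∫⁻ z in Γ, ENNReal.ofReal ((2 / δ) ^ (d + 1)) *
          (ENNReal.ofReal (f z) ^ (d + 1) + ENNReal.ofReal (k ^ (d + 1))) := by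
        refine lintegral_mono fun z => ?_
        have hfz := hf z
        rw [← ENNReal.ofReal_pow (by positivity), ← ENNReal.ofReal_pow (by positivity),
          ← ENNReal.ofReal_add (by positivity) (by positivity),
          ← ENNReal.ofReal_mul (by positivity)]
        refine ENNReal.ofReal_le_ofReal ?_
        rw [mul_pow, div_eq_mul_inv, mul_pow, mul_comm (2 ^ (d+1)), mul_assoc]
        gcongr
        exact add_pow_le2 (hf z) hk _
    _ = ENNReal.ofReal ((2 / δ) ^ (d + 1)) *
        ((∫⁻ z in Γ, ENNReal.ofReal (f z) ^ (d + 1)) + ENNReal.ofReal (k ^ (d + 1)) * volume Γ) := by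
        rw [lintegral_const_mul' _ _ ENNReal.ofReal_ne_top, lintegral_add_right _ measurable_const,
          setLIntegral_const]
    _ ≤ ENNReal.ofReal ((2 / δ) ^ (d + 1)) * (ENNReal.ofReal F +
        ENNReal.ofReal (k ^ (d + 1)) * ENNReal.ofReal (volume Γ).toReal) := by
        rw [ENNReal.ofReal_toReal hfin]
        gcongr
        exact (lintegral_mono_set contact_sub).trans hF
    _ = _ := by
        rw [← ENNReal.ofReal_mul (by positivity), ← ENNReal.ofReal_add (by positivity) (by positivity),
          ← ENNReal.ofReal_mul (by positivity)]

theorem contact_vol_le {J : Jet d} {t1 t2 : ℝ} {xc : Sp d} {R η : ℝ} (h : t1 ≤ t2) (hR : 0 ≤ R) :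
    (volume (contact J t1 t2 xc R η)).toReal ≤ (t2 - t1) * (4 ^ (d + 1) * cd d * R ^ d) := by
  refine ENNReal.toReal_le_of_le_ofReal ?_ ?_
  · have := cd_pos d
    have : 0 ≤ t2 - t1 := by linarith
    positivity
  · rw [← Zc_vol h hR]; exact measure_mono contact_sub

/-- one slab -/
theorem slab {δ K : ℝ} (hδ0 : 0 < δ) (hδ1 : δ < 1) (hK : 0 ≤ K)
    {J : Jet d} (hJ : J.Ok) {t1 t2 : ℝ} {xc : Sp d} {R : ℝ} (hR0 : 1 / 2 ≤ R) (hR1 : R ≤ 1)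
    {a : ℝ × Sp d → Matrix (Fin d) (Fin d) ℝ} (ha : ∀ z, Ell δ (a z))
    {b : ℝ × Sp d → Sp d} (hb : ∀ z, ‖b z‖ ≤ K) {c : ℝ × Sp d → ℝ} (hc : ∀ z, 0 ≤ c z)
    {f : ℝ × Sp d → ℝ} (hf : ∀ z, 0 ≤ f z) 
    (hL : ∀ z ∈ Zc t1 t2 xc R,
      J.t z + ip (a z) (J.H z) + inner ℝ (b z) (J.g z) - c z * J.v z ≤ f z)
    (hF : ∫⁻ z in Zc t1 t2 xc R, ENNReal.ofReal (f z) ^ (d + 1) ≤ 1)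
    (ht : t2 - t1 ≤ 1 / (4 * ((2 * K / δ) ^ (d + 1) + 1))) {m : ℝ} (hm : 0 ≤ m)
    (hbd : ∀ z ∈ Zc t1 t2 xc R, (z.1 = t2 ∨ ‖z.2 - xc‖ = R) → -m ≤ J.v z)
    {z0 : ℝ × Sp d} (hz0 : z0 ∈ Zc t1 t2 xc R) :
    -(m + (1 + 2 * (2 / δ) ^ (d + 1) / cd d)) ≤ J.v z0 := by
  by_contra! hcon
  set μ := 1 + 2 * (2 / δ) ^ (d + 1) / cd d with hμ
  have hcd := cd_pos d
  have hμ1 : 1 ≤ μ := by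
    have : 0 ≤ 2 * (2 / δ) ^ (d + 1) / cd d := by positivity
    linarith
  have hRp : 0 < R := by linarith
  have ht12 : t1 ≤ t2 := hz0.1.1.trans hz0.1.2
  set J' := J.add (quad m 0 0 0 0) with hJ'
  have hJok : J'.Ok := hJ.add (quad_ok _ _ _ _ _)
  have ev : ∀ z, J'.v z = J.v z + m := fun z => by simp [hJ', Jet.add, quad]
  have et : ∀ z, J'.t z = J.t z := fun z => by simp [hJ', Jet.add, quad]
  have eg : ∀ z, J'.g z = J.g z := fun z => by simp [hJ', Jet.add, quad]
  have eH : ∀ z, J'.H z = J.H z := fun z => by simp [hJ', Jet.add, quad]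
  have key := core2 hJok hRp (by linarith : 0 < μ) (fun z hz h => by
      have := hbd z hz h; rw [ev]; linarith) hz0 (by rw [ev]; linarith) hδ0 hδ1 ha hf
      (k := K * (μ / (4 * R))) (F := 1) (by positivity) zero_le_one (fun z hz => by
        have h1 := hL z hz.1
        have h2 : ‖J'.g z‖ ≤ μ / (4 * R) := hz.2.2.2.2.1
        have h3 : J'.v z < 0 := hz.2.2.2.1.1
        rw [ev] at h3
        rw [eg] at h2
        rw [et, eH]
        have h4 : |inner ℝ (b z) (J.g z)| ≤ K * (μ / (4 * R)) :=
          (abs_real_inner_le_norm _ _).trans (mul_le_mul (hb z) h2 (norm_nonneg _) hK)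
        have h5 := (abs_le.1 h4).1
        have h6 : c z * J.v z ≤ 0 := mul_nonpos_of_nonneg_of_nonpos (hc z) (by linarith)
        linarith) (by simpa using hF)
  have hV := contact_vol_le (J := J') (xc := xc) (η := μ / (4 * R)) ht12 hRp.le
  have h7 : cd d * μ ^ (d + 1) / R ^ d ≤ (2 / δ) ^ (d + 1) *
      (1 + (K * (μ / (4 * R))) ^ (d + 1) * ((t2 - t1) * (4 ^ (d + 1) * cd d * R ^ d))) :=
    key.trans (by gcongr)
  have h8 : (2 / δ) ^ (d + 1) *
      (1 + (K * (μ / (4 * R))) ^ (d + 1) * ((t2 - t1) * (4 ^ (d + 1) * cd d * R ^ d))) =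
      (2 / δ) ^ (d + 1) + (2 * K / δ) ^ (d + 1) * (t2 - t1) * cd d * μ ^ (d + 1) / R := by
    rw [mul_pow, div_pow μ, mul_pow 4 R, mul_div_right_comm 2 K δ, mul_pow (2/δ) K]
    field_simp
    ring
  rw [h8] at h7
  have h9 : cd d * μ ^ (d + 1) ≤ cd d * μ ^ (d + 1) / R ^ d := by
    rw [le_div_iff₀ (by positivity)]
    exact mul_le_of_le_one_right (by positivity) (pow_le_one₀ hRp.le hR1)
  set A := (2 * K / δ) ^ (d + 1) with hA
  have hA0 : 0 ≤ A := by positivity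
  have h10 : A * (t2 - t1) ≤ 1 / 4 := by
    calc A * (t2 - t1) ≤ A * (1 / (4 * (A + 1))) := by gcongr
      _ ≤ 1 / 4 := by
        rw [mul_one_div, div_le_div_iff₀ (by positivity) (by positivity)]; linarith
  have h11 : A * (t2 - t1) * cd d * μ ^ (d + 1) / R ≤ 1 / 2 * (cd d * μ ^ (d + 1)) := by
    rw [div_le_iff₀ hRp]
    have : 0 ≤ cd d * μ ^ (d + 1) := by positivity
    calc A * (t2 - t1) * cd d * μ ^ (d + 1) = A * (t2 - t1) * (cd d * μ ^ (d + 1)) := by ring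
      _ ≤ 1 / 4 * (cd d * μ ^ (d + 1)) := by gcongr
      _ = 1 / 2 * (cd d * μ ^ (d + 1)) * (1 / 2) := by ring
      _ ≤ _ := by gcongr
  have h12 : cd d * μ ≤ cd d * μ ^ (d + 1) := by
    gcongr; exact le_self_pow₀ hμ1 (by omega)
  have h13 : cd d * μ = cd d + 2 * (2 / δ) ^ (d + 1) := by rw [hμ]; field_simp
  linarith

/-- slab height -/
def tau (d : ℕ) (δ K : ℝ) : ℝ := 1 / (4 * ((2 * K / δ) ^ (d + 1) + 1))

/-- sup bound constant -/
def N0 (d : ℕ) (δ K : ℝ) : ℝ := 1 + (⌈2 / tau d δ K⌉₊ : ℝ) * (1 + 2 * (2 / δ) ^ (d + 1) / cd d)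

theorem tau_pos {δ K : ℝ} (hδ0 : 0 < δ) (hK : 0 ≤ K) : 0 < tau d δ K := by
  unfold tau; positivity

theorem N0_ge {δ K : ℝ} (hδ0 : 0 < δ) : 1 ≤ N0 d δ K := by
  have := cd_pos d
  have : 0 ≤ (⌈2 / tau d δ K⌉₊ : ℝ) * (1 + 2 * (2 / δ) ^ (d + 1) / cd d) := by positivity
  unfold N0; linarith

theorem global_abp {δ K : ℝ} (hδ0 : 0 < δ) (hδ1 : δ < 1) (hK : 0 ≤ K)
    {J : Jet d} (hJ : J.Ok) {t1 t2 : ℝ} {xc : Sp d} {R : ℝ} (hR0 : 1 / 2 ≤ R) (hR1 : R ≤ 1)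
    {a : ℝ × Sp d → Matrix (Fin d) (Fin d) ℝ} (ha : ∀ z, Ell δ (a z))
    {b : ℝ × Sp d → Sp d} (hb : ∀ z, ‖b z‖ ≤ K) {c : ℝ × Sp d → ℝ} (hc : ∀ z, 0 ≤ c z)
    {f : ℝ × Sp d → ℝ} (hf : ∀ z, 0 ≤ f z) 
    (hL : ∀ z ∈ Zc t1 t2 xc R,
      J.t z + ip (a z) (J.H z) + inner ℝ (b z) (J.g z) - c z * J.v z ≤ f z)
    (hF : ∫⁻ z in Zc t1 t2 xc R, ENNReal.ofReal (f z) ^ (d + 1) ≤ 1)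
    (ht : t2 - t1 ≤ 2)
    (hbd : ∀ z ∈ Zc t1 t2 xc R, (z.1 = t2 ∨ ‖z.2 - xc‖ = R) → -1 ≤ J.v z)
    {z0 : ℝ × Sp d} (hz0 : z0 ∈ Zc t1 t2 xc R) :
    - N0 d δ K ≤ J.v z0 := by
  have hτ := tau_pos (d := d) hδ0 hK
  set μ := 1 + 2 * (2 / δ) ^ (d + 1) / cd d with hμ
  have hcd := cd_pos d
  have hμ0 : 0 ≤ μ := by positivity
  have step : ∀ n : ℕ, ∀ z ∈ Zc t1 t2 xc R, t2 - n * tau d δ K ≤ z.1 → -(1 + n * μ) ≤ J.v z := by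
    intro n
    induction n with
    | zero =>
      intro z hz h
      have := hbd z hz (Or.inl (le_antisymm hz.1.2 (by simpa using h)))
      simpa using this
    | succ n ih =>
      intro z hz h
      push_cast at h ⊢
      by_cases h1 : t2 - n * tau d δ K ≤ z.1
      · have := ih z hz h1; linarith
      push Not at h1
      have hnn : 0 ≤ n * tau d δ K := by positivity
      have hsub : Zc z.1 (t2 - n * tau d δ K) xc R ⊆ Zc t1 t2 xc R := by
        rintro w ⟨hw1, hw2⟩
        exact ⟨⟨hz.1.1.trans hw1.1, by have := hw1.2; linarith⟩, hw2⟩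
      have := slab hδ0 hδ1 hK hJ hR0 hR1 ha hb hc hf (fun w hw => hL w (hsub hw))
        ((lintegral_mono_set hsub).trans hF) (t1 := z.1) (t2 := t2 - n * tau d δ K)
        (by unfold tau at h ⊢; linarith) (m := 1 + n * μ) (by positivity)
        (fun w hw hw2 => by
          rcases hw2 with h3 | h3
          · exact ih w (hsub hw) h3.ge
          · have := hbd w (hsub hw) (Or.inr h3)
            have : 0 ≤ n * μ := by positivity
            linarith) (z0 := z) ⟨⟨le_rfl, h1.le⟩, hz.2⟩
      linarith
  have hn : 2 ≤ (⌈2 / tau d δ K⌉₊ : ℝ) * tau d δ K := by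
    have := Nat.le_ceil (2 / tau d δ K)
    rwa [div_le_iff₀ hτ] at this
  have := step ⌈2 / tau d δ K⌉₊ z0 hz0 (by have := hz0.1.1; linarith)
  exact this

end PGE

namespace PGE

variable {d : ℕ}

/-- the data of the interior problem -/
structure Dat (d : ℕ) where
  δ : ℝ
  K : ℝ
  J : Jet d
  a : ℝ × Sp d → Matrix (Fin d) (Fin d) ℝ
  b : ℝ × Sp d → Sp d
  f : ℝ × Sp d → ℝ
  T0 : ℝ
  T1 : ℝ
  R : ℝ

/-- the domain -/
def Dat.Om (D : Dat d) : Set (ℝ × Sp d) := Zc D.T0 D.T1 0 D.R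

/-- validity of data -/
structure Dat.Ok (D : Dat d) : Prop where
  hδ0 : 0 < D.δ
  hδ1 : D.δ < 1
  hK : 0 ≤ D.K
  ok : D.J.Ok
  ha : ∀ z, Ell D.δ (D.a z)
  hb : ∀ z, ‖D.b z‖ ≤ D.K
  hf : ∀ z, 0 ≤ D.f z
  hL : ∀ z ∈ D.Om, D.J.t z + ip (D.a z) (D.J.H z) + inner ℝ (D.b z) (D.J.g z) ≤ D.f z
  hu : ∀ z ∈ D.Om, |D.J.v z| ≤ 1
  hF : ∫⁻ z in D.Om, ENNReal.ofReal (D.f z) ^ (d + 1) ≤ 1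
  hR0 : 1 / 2 ≤ D.R
  hR1 : D.R ≤ 1
  hT : D.T1 - D.T0 ≤ 2

/-- good set -/
def Dat.A (D : Dat d) (M : ℝ) : Set (ℝ × Sp d) :=
  {z | ∀ w ∈ D.Om, z.1 < w.1 → D.J.v z + inner ℝ (D.J.g z) (w.2 - z.2)
    - M / 2 * ‖w.2 - z.2‖ ^ 2 - M * (w.1 - z.1) ≤ D.J.v w}

theorem Dat.A_closed {D : Dat d} (hD : D.Ok) (M : ℝ) : IsClosed (D.A M) := by
  have hcv := hD.ok.cv
  have hcg := hD.ok.cg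
  have : D.A M = ⋂ w ∈ D.Om, ({z : ℝ × Sp d | w.1 ≤ z.1} ∪
      {z | D.J.v z + inner ℝ (D.J.g z) (w.2 - z.2)
    - M / 2 * ‖w.2 - z.2‖ ^ 2 - M * (w.1 - z.1) ≤ D.J.v w}) := by
    ext z; simp [Dat.A, imp_iff_not_or]
  rw [this]
  refine isClosed_biInter fun w _ => ?_
  exact (isClosed_le (by fun_prop) (by fun_prop)).union (isClosed_le (by fun_prop) (by fun_prop))

theorem Dat.A_mono {D : Dat d} {M M' : ℝ} (h : M ≤ M') : D.A M ⊆ D.A M' := by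
  intro z hz w hw hlt
  refine le_trans ?_ (hz w hw hlt)
  have h1 : 0 ≤ ‖w.2 - z.2‖ ^ 2 := by positivity
  have h2 : 0 ≤ w.1 - z.1 := by linarith
  nlinarith

/-- on the slice of equal times. -/
theorem Dat.A_same {D : Dat d} (hD : D.Ok) {M : ℝ} {z : ℝ × Sp d} (hz : z ∈ D.A M) (ho : z ∈ D.Om)
    (ht : z.1 < D.T1) {w : ℝ × Sp d} (hw : w ∈ D.Om) (hlt : z.1 ≤ w.1) :
    D.J.v z + inner ℝ (D.J.g z) (w.2 - z.2)
    - M / 2 * ‖w.2 - z.2‖ ^ 2 - M * (w.1 - z.1) ≤ D.J.v w := by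
  rcases hlt.lt_or_eq with h | h
  · exact hz w hw h
  have hcv := hD.ok.cv
  have := nonneg_of_right (φ := fun s => D.J.v (s, w.2) - (D.J.v z + inner ℝ (D.J.g z) (w.2 - z.2)
    - M / 2 * ‖w.2 - z.2‖ ^ 2 - M * (s - z.1))) ht (by fun_prop) (fun s h1 h2 => by
      have := hz (s, w.2) ⟨⟨ho.1.1.trans h1.le, h2.le⟩, hw.2⟩ h1
      simpa using this)
  have e : (z.1, w.2) = w := Prod.ext h rfl
  simp only [e, sub_nonneg] at this
  rw [← h]; exact this

/-- gradient bound -/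
theorem Dat.grad_le {D : Dat d} (hD : D.Ok) {M ρ : ℝ} {z : ℝ × Sp d} (hz : z ∈ D.A M)
    (ho : z ∈ D.Om) (ht : z.1 < D.T1) (hρ : 0 < ρ) (hρ1 : ρ ≤ 1) (hx : ‖z.2‖ ≤ D.R - ρ)
    (hM : 1 ≤ M * ρ ^ 2) : ‖D.J.g z‖ ≤ 3 * M := by
  by_cases h0 : D.J.g z = 0
  · rw [h0, norm_zero]
    have : 0 < M := by
      by_contra! h
      have : M * ρ ^ 2 ≤ 0 := mul_nonpos_of_nonpos_of_nonneg h (by positivity)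
      linarith
    linarith
  have hn : 0 < ‖D.J.g z‖ := norm_pos_iff.2 h0
  set e : Sp d := (ρ / ‖D.J.g z‖) • D.J.g z with he
  have hen : ‖e‖ = ρ := by
    rw [he, norm_smul, Real.norm_of_nonneg (by positivity)]; field_simp
  have hw : (z.1, z.2 + e) ∈ D.Om := by
    refine ⟨ho.1, ?_⟩
    rw [mem_closedBall_iff_norm, sub_zero]
    have := norm_add_le z.2 e
    simp only; linarith
  have h1 := Dat.A_same hD hz ho ht hw le_rfl
  have hin : inner ℝ (D.J.g z) e = ρ * ‖D.J.g z‖ := by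
    rw [he, inner_smul_right, real_inner_self_eq_norm_sq]; field_simp
  simp only [add_sub_cancel_left, hin, hen, sub_self, mul_zero, sub_zero] at h1
  have h2 := (abs_le.1 (hD.hu z ho)).1
  have h3 := (abs_le.1 (hD.hu _ hw)).2
  have h4 : ρ * ‖D.J.g z‖ ≤ 2 + M / 2 * ρ ^ 2 := by linarith
  have h5 : ρ * ‖D.J.g z‖ ≤ ρ * (3 * M) := by
    have hM0 : 0 < M := by
      by_contra! h
      have : M * ρ ^ 2 ≤ 0 := mul_nonpos_of_nonpos_of_nonneg h (by positivity)
      linarith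
    calc ρ * ‖D.J.g z‖ ≤ 3 * (M * ρ ^ 2) := by linarith
      _ = ρ * (3 * M) * ρ := by ring
      _ ≤ ρ * (3 * M) := mul_le_of_le_one_right (by positivity) hρ1
  exact le_of_mul_le_mul_left h5 hρ

/-- constants of the measure step -/
def cB (C0 : ℝ) : ℝ := 8 * (C0 + 1) + 8

def c2 (d : ℕ) (δ K C0 : ℝ) : ℝ := K * (7 + cB C0) + (2 + C0) + (1 + cB C0) * (d / δ)

def c4 (d : ℕ) (δ : ℝ) : ℝ := cd d / (2 * (2 / δ) ^ (d + 1))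

def th (d : ℕ) (δ K C0 : ℝ) : ℝ := cd d / (2 * (2 / δ * c2 d δ K C0) ^ (d + 1))

theorem c4_pos {δ : ℝ} (hδ : 0 < δ) : 0 < c4 d δ := by
  have := cd_pos d
  unfold c4; positivity

theorem c2_pos {δ K C0 : ℝ} (hδ : 0 < δ) (hK : 0 ≤ K) (hC : 0 ≤ C0) : 0 < c2 d δ K C0 := by
  unfold c2 cB; positivity

theorem th_pos {δ K C0 : ℝ} (hδ : 0 < δ) (hK : 0 ≤ K) (hC : 0 ≤ C0) : 0 < th d δ K C0 := by
  have := cd_pos d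
  have := c2_pos (d := d) hδ hK hC
  unfold th; positivity

set_option maxHeartbeats 1000000 in
theorem Dat.step2 {D : Dat d} (hD : D.Ok) {C0 M r s : ℝ} {x1 : Sp d} (hC0 : 0 ≤ C0) (hM : 0 < M)
    (hr : 0 < r) (hr1 : r ≤ 1) (hQ : Zc (s - r ^ 2) s x1 r ⊆ D.Om)
    (hF : ∫⁻ z in Zc (s - r ^ 2) s x1 r, ENNReal.ofReal (D.f z) ^ (d + 1) ≤
      ENNReal.ofReal (c4 d D.δ * M ^ (d + 1) * r ^ (d + 2)))
    {α m0 M0 : ℝ} {p0 y0 : Sp d} (hm0 : 0 ≤ m0) (hm1 : m0 ≤ M) (hM0 : 0 ≤ M0) (hM1 : M0 ≤ M)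
    (hP : ∀ w ∈ D.Om, s - r ^ 2 ≤ w.1 →
      α - m0 * w.1 + inner ℝ p0 w.2 - M0 / 2 * ‖w.2 - y0‖ ^ 2 ≤ D.J.v w)
    (hgP : ∀ x ∈ Metric.closedBall x1 r, ‖p0 - M0 • (x - y0)‖ ≤ 6 * M)
    {x2 : Sp d} (hx2 : ‖x2 - x1‖ ≤ r / 2)
    (hz2 : D.J.v (s - r ^ 2, x2) ≤ α - m0 * (s - r ^ 2) + inner ℝ p0 x2 - M0 / 2 * ‖x2 - y0‖ ^ 2
      + C0 * M * r ^ 2) :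
    ENNReal.ofReal (th d D.δ D.K C0 * r ^ (d + 2)) ≤
      volume (D.A ((1 + cB C0) * M) ∩ Zc (s - r ^ 2) s x1 r) := by
  set C := cB C0 with hC
  have hCe : C = 8 * (C0 + 1) + 8 := rfl
  set J' := (D.J.add (quad (-α) m0 (-p0) M0 y0)).add
    (quad (-((C0 + 1) * M * s)) ((C0 + 1) * M) 0 (C * M) x2) with hJ'
  have hJok : J'.Ok := (hD.ok.add (quad_ok _ _ _ _ _)).add (quad_ok _ _ _ _ _)
  have ev : ∀ z, J'.v z = D.J.v z - (α - m0 * z.1 + inner ℝ p0 z.2 - M0 / 2 * ‖z.2 - y0‖ ^ 2)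
      + C * M / 2 * ‖z.2 - x2‖ ^ 2 - (C0 + 1) * M * (s - z.1) := fun z => by
    simp [hJ', Jet.add, quad]; ring
  have et : ∀ z, J'.t z = D.J.t z + m0 + (C0 + 1) * M := fun z => by simp [hJ', Jet.add, quad]
  have eg : ∀ z, J'.g z = D.J.g z - (p0 - M0 • (z.2 - y0)) + (C * M) • (z.2 - x2) := fun z => by
    simp [hJ', Jet.add, quad]; abel
  have eH : ∀ z, J'.H z = D.J.H z + (M0 + C * M) • 1 := fun z => by
    simp [hJ', Jet.add, quad, add_smul, add_assoc]
  have hCp : 16 ≤ C := by linarith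
  have hZQ : Zc (s - r ^ 2) s x2 (r / 2) ⊆ Zc (s - r ^ 2) s x1 r := by
    rintro w ⟨h1, h2⟩
    refine ⟨h1, ?_⟩
    rw [mem_closedBall_iff_norm] at h2 ⊢
    have := norm_add_le (w.2 - x2) (x2 - x1)
    rw [sub_add_sub_cancel] at this
    linarith
  have hs2 : 0 < r ^ 2 := by positivity
  have hη : M * r ^ 2 / (4 * (r / 2)) = M * r / 2 := by field_simp; norm_num
  have key := core2 hJok (t1 := s - r ^ 2) (t2 := s) (xc := x2) (R := r / 2) (μ := M * r ^ 2)
    (z0 := (s - r ^ 2, x2)) (by positivity) (by positivity) (fun z hz h => by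
      have h1 := hP z (hQ (hZQ hz)) hz.1.1
      rw [ev]
      have h2 : 0 ≤ C * M / 2 * ‖z.2 - x2‖ ^ 2 := by positivity
      rcases h with h | h
      · rw [h] at h1 ⊢; linarith
      · rw [h]
        have h3 : (C0 + 1) * M * (s - z.1) ≤ (C0 + 1) * M * r ^ 2 := by
          gcongr; have := hz.1.1; linarith
        have h4 : C * M / 2 * (r / 2) ^ 2 = (C0 + 1) * M * r ^ 2 + M * r ^ 2 := by rw [hCe]; ring
        have : 0 < M * r ^ 2 := by positivity
        linarith)
    ⟨⟨le_rfl, by linarith⟩, Metric.mem_closedBall_self (by positivity)⟩ (by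
      rw [ev]
      simp only [sub_self, norm_zero]
      linarith) hD.hδ0 hD.hδ1 hD.ha hD.hf (k := c2 d D.δ D.K C0 * M)
      (F := c4 d D.δ * M ^ (d + 1) * r ^ (d + 2))
      (by have := c2_pos (d := d) hD.hδ0 hD.hK hC0; positivity)
      (by have := c4_pos (d := d) hD.hδ0; positivity)
      (fun z hz => by
        have hzQ := hZQ hz.1
        have h1 := hD.hL z (hQ hzQ)
        have h2 : ‖J'.g z‖ ≤ M * r / 2 := hη ▸ hz.2.2.2.2.1
        have h3 : D.J.g z = J'.g z + (p0 - M0 • (z.2 - y0)) - (C * M) • (z.2 - x2) := by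
          rw [eg]; abel
        have h4 : ‖(C * M) • (z.2 - x2)‖ ≤ C * M := by
          rw [norm_smul, Real.norm_of_nonneg (by positivity)]
          refine mul_le_of_le_one_right (by positivity) ?_
          have := hz.2.2.1; linarith
        have h5 : ‖D.J.g z‖ ≤ (7 + C) * M := by
          rw [h3]
          have e1 := norm_sub_le (J'.g z + (p0 - M0 • (z.2 - y0))) ((C * M) • (z.2 - x2))
          have e2 := norm_add_le (J'.g z) (p0 - M0 • (z.2 - y0))
          have e3 := hgP z.2 hzQ.2
          nlinarith
        have h6 : |inner ℝ (D.b z) (D.J.g z)| ≤ D.K * ((7 + C) * M) :=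
          (abs_real_inner_le_norm _ _).trans (mul_le_mul (hD.hb z) h5 (norm_nonneg _) hD.hK)
        have h7 := (abs_le.1 h6).1
        rw [et, eH, ip_add, ip_smul]
        have h8 := (hD.ha z).ip_one_le
        have h9 : (M0 + C * M) * ip (D.a z) 1 ≤ (M + C * M) * (d * D.δ⁻¹) := by
          have : 0 ≤ (d : ℝ) * D.δ⁻¹ := by have := hD.hδ0; positivity
          calc _ ≤ (M0 + C * M) * (d * D.δ⁻¹) := by gcongr
            _ ≤ _ := by gcongr
        have h10 : c2 d D.δ D.K C0 * M = D.K * ((7 + C) * M) + (2 + C0) * M +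
          (M + C * M) * (d * D.δ⁻¹) := by
          unfold c2; rw [← hC]; ring
        rw [h10]
        linarith)
      ((lintegral_mono_set hZQ).trans hF)
  rw [hη] at key
  set Γ := contact J' (s - r ^ 2) s x2 (r / 2) (M * r / 2) with hΓ
  have hsub : Γ ⊆ D.A ((1 + C) * M) ∩ Zc (s - r ^ 2) s x1 r := by
    intro z hz
    refine ⟨fun w hw hlt => ?_, hZQ hz.1⟩
    have hws : s - r ^ 2 ≤ w.1 := hz.1.1.1.trans hlt.le
    have hu := hP w hw hws
    -- tangent plane inequality
    have key2 : J'.v z + inner ℝ (J'.g z) (w.2 - z.2) ≤ J'.v w := by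
      by_cases hwZ : w ∈ Zc (s - r ^ 2) s x2 (r / 2)
      · exact hz.2.2.2.2.2 w hwZ hlt
      have h1 := hz.2.2.2.1.2
      have h2 : ‖J'.g z‖ ≤ M * r / 2 := hz.2.2.2.2.1
      have h3 : J'.v z + inner ℝ (J'.g z) (w.2 - z.2) =
          (J'.v z - inner ℝ (J'.g z) (z.2 - x2)) + inner ℝ (J'.g z) (w.2 - x2) := by
        have : w.2 - z.2 = (w.2 - x2) - (z.2 - x2) := by abel
        rw [this, inner_sub_right]; ring
      have h4 : inner ℝ (J'.g z) (w.2 - x2) ≤ M * r / 2 * ‖w.2 - x2‖ :=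
        (real_inner_le_norm _ _).trans (by gcongr)
      rw [h3, ev w]
      set Dw := ‖w.2 - x2‖ with hDw
      have hDw0 : 0 ≤ Dw := norm_nonneg _
      have h5 : 2 * (M * r / 2) * (r / 2) = M * r ^ 2 / 2 := by ring
      rw [h5] at h1
      suffices hs : M * r / 2 * Dw - M * r ^ 2 / 2 ≤ C * M / 2 * Dw ^ 2 - (C0 + 1) * M * (s - w.1) by
        linarith
      by_cases hD2 : Dw ≤ r / 2
      · have hws2 : s < w.1 := by
          by_contra! hc
          exact hwZ ⟨⟨hws, hc⟩, by rw [mem_closedBall_iff_norm]; exact hD2⟩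
        have e1 : M * r / 2 * Dw ≤ M * r / 2 * (r / 2) := by gcongr
        have e2 : 0 ≤ C * M / 2 * Dw ^ 2 := by positivity
        have e3 : 0 ≤ (C0 + 1) * M * (w.1 - s) :=
          mul_nonneg (by positivity) (by linarith)
        have e4 : 0 < M * r ^ 2 := by positivity
        nlinarith
      · push Not at hD2
        have e1 : s - w.1 ≤ 4 * Dw ^ 2 := by nlinarith
        have e2 : (C0 + 1) * M * (s - w.1) ≤ (C0 + 1) * M * (4 * Dw ^ 2) := by gcongr
        have e3 : M * r / 2 * Dw ≤ M * Dw * Dw := by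
          have : r / 2 ≤ Dw := hD2.le
          calc M * r / 2 * Dw = M * (r / 2) * Dw := by ring
            _ ≤ _ := by gcongr
        have e4 : C * M / 2 * Dw ^ 2 = (C0 + 1) * M * (4 * Dw ^ 2) + 4 * (M * Dw * Dw) := by
          rw [hCe]; ring
        have e5 : 0 ≤ M * Dw * Dw := by positivity
        have e6 : 0 ≤ M * r ^ 2 / 2 := by positivity
        linarith
    -- expand
    rw [ev z, ev w, eg z] at key2
    have q1 : ‖w.2 - y0‖ ^ 2 = ‖z.2 - y0‖ ^ 2 + 2 * inner ℝ (z.2 - y0) (w.2 - z.2)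
        + ‖w.2 - z.2‖ ^ 2 := by
      have : w.2 - y0 = (z.2 - y0) + (w.2 - z.2) := by abel
      rw [this, norm_add_sq_real]
    have q2 : ‖w.2 - x2‖ ^ 2 = ‖z.2 - x2‖ ^ 2 + 2 * inner ℝ (z.2 - x2) (w.2 - z.2)
        + ‖w.2 - z.2‖ ^ 2 := by
      have : w.2 - x2 = (z.2 - x2) + (w.2 - z.2) := by abel
      rw [this, norm_add_sq_real]
    have q3 : inner ℝ p0 (w.2 - z.2) = inner ℝ p0 w.2 - inner ℝ p0 z.2 := inner_sub_right _ _ _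
    rw [inner_add_left, inner_sub_left, inner_sub_left, inner_smul_left, inner_smul_left, q1, q2,
      q3] at key2
    simp only [conj_trivial] at key2
    have q4 : 0 ≤ ‖w.2 - z.2‖ ^ 2 := by positivity
    have q5 : 0 ≤ w.1 - z.1 := by linarith
    have q6 : M0 * ‖w.2 - z.2‖ ^ 2 ≤ M * ‖w.2 - z.2‖ ^ 2 := by gcongr
    have q7 : m0 * (w.1 - z.1) ≤ M * (w.1 - z.1) := by gcongr
    have q8 : (C0 + 1) * M * (w.1 - z.1) ≤ C * M * (w.1 - z.1) := by
      gcongr; linarith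
    linarith
  have hfin : volume Γ ≠ ⊤ :=
    ((measure_mono contact_sub).trans_lt (Zc_compact.measure_lt_top)).ne
  refine le_trans ?_ (measure_mono hsub)
  rw [← ENNReal.ofReal_toReal hfin]
  refine ENNReal.ofReal_le_ofReal ?_
  have hδ := hD.hδ0
  have hcd := cd_pos d
  have hc2 := c2_pos (d := d) hD.hδ0 hD.hK hC0
  have k1 : cd d * (M * r ^ 2) ^ (d + 1) / (r / 2) ^ d
      = 2 ^ d * (cd d * M ^ (d + 1) * r ^ (d + 2)) := by
    rw [div_pow r 2 d]
    field_simp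
    ring
  have k2 : (2 / D.δ) ^ (d + 1) * (c4 d D.δ * M ^ (d + 1) * r ^ (d + 2) +
      (c2 d D.δ D.K C0 * M) ^ (d + 1) * (volume Γ).toReal) =
      1 / 2 * (cd d * M ^ (d + 1) * r ^ (d + 2)) +
      (2 / D.δ * c2 d D.δ D.K C0) ^ (d + 1) * (volume Γ).toReal * M ^ (d + 1) := by
    rw [c4, mul_pow, mul_pow]
    field_simp
  rw [k1, k2] at key
  have k3 : (1 : ℝ) ≤ 2 ^ d := one_le_pow₀ (by norm_num)
  have k4 : 0 < cd d * M ^ (d + 1) * r ^ (d + 2) := by positivity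
  have k5 : 1 / 2 * (cd d * r ^ (d + 2)) * M ^ (d + 1) ≤
      (2 / D.δ * c2 d D.δ D.K C0) ^ (d + 1) * (volume Γ).toReal * M ^ (d + 1) := by nlinarith
  have k6 := le_of_mul_le_mul_right k5 (by positivity)
  rw [th, div_mul_eq_mul_div, div_le_iff₀ (by positivity)]
  linarith

theorem Dat.initStep {D : Dat d} (hD : D.Ok) {C0 M r s : ℝ} {x1 : Sp d} (hC0 : 1 ≤ C0) (hM : 0 < M)
    (hr : 0 < r) (hr1 : r ≤ 1) (hQ : Zc (s - r ^ 2) s x1 r ⊆ D.Om)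
    (hMr : 2 + 1 / c4 d D.δ ≤ M * r ^ 2) :
    ENNReal.ofReal (th d D.δ D.K C0 * r ^ (d + 2)) ≤
      volume (D.A ((1 + cB C0) * M) ∩ Zc (s - r ^ 2) s x1 r) := by
  have h4 := c4_pos (d := d) hD.hδ0
  have h4' : 0 < 1 / c4 d D.δ := by positivity
  have hz : (s - r ^ 2, x1) ∈ Zc (s - r ^ 2) s x1 r :=
    ⟨⟨le_rfl, by simp; positivity⟩, Metric.mem_closedBall_self hr.le⟩
  refine Dat.step2 hD (by linarith) hM hr hr1 hQ ?_ (α := -1) (m0 := 0) (M0 := 0) (p0 := 0) (y0 := 0)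
    le_rfl hM.le le_rfl hM.le ?_ ?_ (x2 := x1) (by simp; positivity) ?_
  · refine (lintegral_mono_set hQ).trans (hD.hF.trans ?_)
    rw [← ENNReal.ofReal_one]
    refine ENNReal.ofReal_le_ofReal ?_
    have e1 : (M * r ^ 2) ^ (d + 1) ≤ M ^ (d + 1) * r ^ (d + 2) := by
      rw [mul_pow, ← pow_mul]
      gcongr ?_ * ?_
      exact pow_le_pow_of_le_one hr.le hr1 (by omega)
    have e2 : M * r ^ 2 ≤ (M * r ^ 2) ^ (d + 1) := le_self_pow₀ (by linarith) (by omega)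
    have e3 : 1 / c4 d D.δ ≤ M ^ (d + 1) * r ^ (d + 2) := by linarith
    rw [div_le_iff₀ h4] at e3
    linarith
  · intro w hw _
    have := (abs_le.1 (hD.hu w hw)).1
    simpa using this
  · intro x _; simp; positivity
  · have := (abs_le.1 (hD.hu _ (hQ hz))).2
    simp
    have : M * r ^ 2 ≤ C0 * (M * r ^ 2) := le_mul_of_one_le_left (by positivity) hC0
    linarith

end PGE

namespace PGE

variable {d : ℕ}

theorem hasDerivAt_max_pow (n : ℕ) (y : ℝ) :
    HasDerivAt (fun y : ℝ => max y 0 ^ (n + 2)) ((n + 2 : ℝ) * max y 0 ^ (n + 1)) y := by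
  rcases lt_trichotomy y 0 with h | h | h
  · have : (fun y : ℝ => max y 0 ^ (n + 2)) =ᶠ[nhds y] fun _ => 0 := by
      filter_upwards [gt_mem_nhds h] with x hx
      rw [max_eq_right hx.le]; simp
    rw [max_eq_right h.le]
    simpa using (hasDerivAt_const y (0 : ℝ)).congr_of_eventuallyEq this
  · subst h
    simp only [max_self, ne_eq, Nat.add_eq_zero_iff, one_ne_zero, and_false, not_false_eq_true,
      zero_pow, mul_zero]
    have h1 : HasDerivWithinAt (fun y : ℝ => max y 0 ^ (n + 2)) 0 (Iic 0) 0 := by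
      refine (hasDerivWithinAt_const (0:ℝ) (Iic 0) (0:ℝ)).congr (fun x hx => ?_) (by simp)
      rw [max_eq_right hx]; simp
    have h2 : HasDerivWithinAt (fun y : ℝ => max y 0 ^ (n + 2)) 0 (Ici 0) 0 := by
      have := (hasDerivAt_pow (n + 2) (0 : ℝ)).hasDerivWithinAt (s := Ici 0)
      simp only [ne_eq, Nat.add_eq_zero_iff, one_ne_zero, and_false, not_false_eq_true,
      zero_pow, mul_zero, Nat.add_sub_cancel, show n + 2 - 1 = n + 1 by omega] at this
      refine this.congr (fun x hx => ?_) (by simp)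
      rw [max_eq_left hx]
    have := h1.union h2
    rw [Iic_union_Ici] at this
    exact this.hasDerivAt Filter.univ_mem
  · have : (fun y : ℝ => max y 0 ^ (n + 2)) =ᶠ[nhds y] fun y => y ^ (n + 2) := by
      filter_upwards [lt_mem_nhds h] with x hx
      rw [max_eq_left hx.le]
    rw [max_eq_left h.le]
    refine ((hasDerivAt_pow (n + 2) y).congr_of_eventuallyEq this).congr_deriv ?_
    push_cast
    rfl

/-- barrier ingredients: `tb` final time, `x1` centre, `r` radius, `l = λ/r²`. -/
def bE (tb l : ℝ) (z : ℝ × Sp d) : ℝ := Real.exp (-(l * (tb - z.1)))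

def bY (tb r : ℝ) (x1 : Sp d) (z : ℝ × Sp d) : ℝ :=
  r ^ 2 / 4 + 5 * (tb - z.1) - ‖z.2 - x1‖ ^ 2

def bM (tb r : ℝ) (x1 : Sp d) (z : ℝ × Sp d) : ℝ := max (bY tb r x1 z) 0

def outer (y : Sp d) : Matrix (Fin d) (Fin d) ℝ := Matrix.of fun i j => y i * y j

theorem outer_apply (y ξ : Sp d) :
    Matrix.toEuclideanCLM (n := Fin d) (𝕜 := ℝ) (outer y) ξ = (inner ℝ y ξ) • y := by
  ext i
  rw [Matrix.ofLp_toEuclideanCLM]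
  simp only [outer, Matrix.mulVec, dotProduct, PiLp.inner_apply, Matrix.of_apply, PiLp.smul_apply,
    smul_eq_mul, Finset.sum_mul, RCLike.inner_apply, conj_trivial]
  refine Finset.sum_congr rfl fun j _ => by ring

def barJ (tb r l : ℝ) (x1 : Sp d) : Jet d where
  v z := bE tb l z * bM tb r x1 z ^ 3
  t z := bE tb l z * (l * bM tb r x1 z ^ 3 - 15 * bM tb r x1 z ^ 2)
  g z := (-(6 * bE tb l z * bM tb r x1 z ^ 2)) • (z.2 - x1)
  q z := (-(6 * bE tb l z * (l * bM tb r x1 z ^ 2 - 10 * bM tb r x1 z))) • (z.2 - x1)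
  H z := (24 * bE tb l z * bM tb r x1 z) • outer (z.2 - x1) - (6 * bE tb l z * bM tb r x1 z ^ 2) • 1

theorem bE_deriv (tb l : ℝ) (z : ℝ × Sp d) :
    HasFDerivAt (bE tb l) ((l * bE tb l z) • ContinuousLinearMap.fst ℝ ℝ (Sp d)) z := by
  have h1 : HasFDerivAt (fun z : ℝ × Sp d => -(l * (tb - z.1)))
      (l • ContinuousLinearMap.fst ℝ ℝ (Sp d)) z := by
    have := ((hasFDerivAt_fst (𝕜 := ℝ) (p := z)).const_sub tb).const_mul l |>.neg
    exact this.congr_fderiv (by simp)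
  exact h1.exp.congr_fderiv (ContinuousLinearMap.ext fun w => by simp [bE]; ring)

theorem bY_deriv (tb r : ℝ) (x1 : Sp d) (z : ℝ × Sp d) :
    HasFDerivAt (bY tb r x1) ((-5 : ℝ) • ContinuousLinearMap.fst ℝ ℝ (Sp d) -
      (2 : ℝ) • (innerSL ℝ (z.2 - x1)).comp (ContinuousLinearMap.snd ℝ ℝ (Sp d))) z := by
  have h1 : HasFDerivAt (fun z : ℝ × Sp d => z.2 - x1) (ContinuousLinearMap.snd ℝ ℝ (Sp d)) z :=
      hasFDerivAt_snd.sub_const x1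
  have h2 := ((hasFDerivAt_fst (𝕜 := ℝ) (p := z)).const_sub tb).const_mul 5 |>.const_add (r ^ 2 / 4)
  refine (h2.sub h1.norm_sq).congr_fderiv (ContinuousLinearMap.ext fun w => ?_)
  simp

theorem bM_deriv (tb r : ℝ) (x1 : Sp d) (n : ℕ) (z : ℝ × Sp d) :
    HasFDerivAt (fun z => bM tb r x1 z ^ (n + 2))
      (((n + 2 : ℝ) * bM tb r x1 z ^ (n + 1)) • ((-5 : ℝ) • ContinuousLinearMap.fst ℝ ℝ (Sp d) -
      (2 : ℝ) • (innerSL ℝ (z.2 - x1)).comp (ContinuousLinearMap.snd ℝ ℝ (Sp d)))) z :=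
  (hasDerivAt_max_pow n (bY tb r x1 z)).comp_hasFDerivAt z (bY_deriv tb r x1 z)

theorem barJ_ok (tb r l : ℝ) (x1 : Sp d) : (barJ tb r l x1).Ok where
  hv z := by
    refine ((bE_deriv tb l z).mul (bM_deriv tb r x1 1 z)).congr_fderiv
      (ContinuousLinearMap.ext fun w => ?_)
    simp [barJ, inner_smul_left, -neg_smul, inner_sub_left, inner_neg_left]
    ring
  hg z := by
    have h1 : HasFDerivAt (fun z : ℝ × Sp d => z.2 - x1) (ContinuousLinearMap.snd ℝ ℝ (Sp d)) z :=
      hasFDerivAt_snd.sub_const x1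
    have h2 : HasFDerivAt (fun z => -(6 * bE tb l z * bM tb r x1 z ^ 2)) _ z :=
      (((bE_deriv tb l z).const_mul 6).mul (bM_deriv tb r x1 0 z)).neg
    refine (h2.smul h1).congr_fderiv (ContinuousLinearMap.ext fun w => ?_)
    have e : Matrix.toEuclideanCLM (n := Fin d) (𝕜 := ℝ) ((barJ tb r l x1).H z) w.2 =
      (24 * bE tb l z * bM tb r x1 z * inner ℝ (z.2 - x1) w.2) • (z.2 - x1) -
       (6 * bE tb l z * bM tb r x1 z ^ 2) • w.2 := by
      simp only [barJ, map_sub, map_smul, map_one]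
      simp [outer_apply, smul_smul]
    rw [Jet.dg_apply, e]
    simp only [barJ, ContinuousLinearMap.add_apply, ContinuousLinearMap.smul_apply,
      ContinuousLinearMap.smulRight_apply, ContinuousLinearMap.neg_apply,
      ContinuousLinearMap.sub_apply, ContinuousLinearMap.comp_apply, ContinuousLinearMap.coe_fst',
      ContinuousLinearMap.coe_snd', innerSL_apply_apply, smul_eq_mul]
    push_cast
    module
  hs z := by
    refine Matrix.IsSymm.sub (Matrix.IsSymm.smul ?_ _) (Matrix.IsSymm.smul Matrix.isSymm_one _)
    ext i j; simp [outer, mul_comm]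

theorem ip_sub {d : ℕ} (a H G : Matrix (Fin d) (Fin d) ℝ) : ip a (H - G) = ip a H - ip a G := by
  simp [ip, mul_sub]

theorem ip_outer {a : Matrix (Fin d) (Fin d) ℝ} {δ : ℝ} (ha : Ell δ a) (y : Sp d) :
    δ * ‖y‖ ^ 2 ≤ ip a (outer y) := by
  have := (ha y).1
  simpa [ip, outer, mul_assoc] using this

/-- The barrier is a subsolution. -/
theorem bar_sub {δ K : ℝ} (hδ : 0 < δ) {tb r lam : ℝ} {x1 : Sp d} (hr : 0 < r) (hr1 : r ≤ 1)
    (hlam : lam = (15 + 24 * δ + 6 * (d / δ) + 48 * K) ^ 2 / (24 * δ))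
    {a : Matrix (Fin d) (Fin d) ℝ} (ha : Ell δ a) {b : Sp d} (hb : ‖b‖ ≤ K) {z : ℝ × Sp d}
    (hz : z.1 ≤ tb) (hx : ‖z.2 - x1‖ ≤ 8 * r) :
    0 ≤ (barJ tb r (lam / r ^ 2) x1).t z + ip a ((barJ tb r (lam / r ^ 2) x1).H z) +
      inner ℝ b ((barJ tb r (lam / r ^ 2) x1).g z) := by
  set B := 15 + 24 * δ + 6 * (d / δ) + 48 * K with hB
  set E := bE tb (lam / r ^ 2) z with hE
  have hE0 : 0 < E := Real.exp_pos _
  set m := bM tb r x1 z with hm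
  have hm0 : 0 ≤ m := le_max_right _ _
  have e : (barJ tb r (lam / r ^ 2) x1).t z + ip a ((barJ tb r (lam / r ^ 2) x1).H z) +
      inner ℝ b ((barJ tb r (lam / r ^ 2) x1).g z) =
      E * m * (lam / r ^ 2 * m ^ 2 - 15 * m + 24 * ip a (outer (z.2 - x1)) - 6 * m * ip a 1
        - 6 * m * inner ℝ b (z.2 - x1)) := by
    simp only [barJ, ip_sub, ip_smul, inner_smul_right]
    ring
  rw [e]
  rcases hm0.eq_or_lt with h0 | h0
  · rw [← h0]; simp
  refine mul_nonneg (by positivity) ?_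
  have hmy : m = bY tb r x1 z := by
    rw [hm, bM] at h0 ⊢
    rcases max_cases (bY tb r x1 z) 0 with ⟨h, _⟩ | ⟨h, _⟩
    · exact h
    · rw [h] at h0; exact absurd h0 (lt_irrefl _)
  have h1 := ip_outer ha (z.2 - x1)
  have h2 := ha.ip_one_le
  have h3 : inner ℝ b (z.2 - x1) ≤ 8 * K := by
    have hK : 0 ≤ K := (norm_nonneg _).trans hb
    calc inner ℝ b (z.2 - x1) ≤ ‖b‖ * ‖z.2 - x1‖ := real_inner_le_norm _ _
      _ ≤ K * (8 * r) := by gcongr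
      _ ≤ K * (8 * 1) := by gcongr
      _ = 8 * K := by ring
  have h4 : r ^ 2 / 4 - m ≤ ‖z.2 - x1‖ ^ 2 := by rw [hmy, bY]; linarith
  have h5 : δ * (r ^ 2 / 4 - m) ≤ ip a (outer (z.2 - x1)) := le_trans (by gcongr) h1
  have h6 : m * ip a 1 ≤ m * (d / δ) := by rw [div_eq_mul_inv]; gcongr
  have h7 : m * inner ℝ b (z.2 - x1) ≤ m * (8 * K) := by gcongr
  have h8 : 0 ≤ lam / r ^ 2 * m ^ 2 - B * m + 6 * δ * r ^ 2 := by
    have : lam / r ^ 2 * m ^ 2 - B * m + 6 * δ * r ^ 2 =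
      (B * m / r - 12 * δ * r) ^ 2 / (24 * δ) := by
      rw [hlam]; field_simp; ring
    rw [this]; positivity
  rw [hB] at h8
  linarith

/-- constants of the barrier step. -/
def bC1 (d : ℕ) (δ K : ℝ) : ℝ := 1 + d / δ + 13 * K

def blam (d : ℕ) (δ K : ℝ) : ℝ := (15 + 24 * δ + 6 * (d / δ) + 48 * K) ^ 2 / (24 * δ)

def bC0 (d : ℕ) (δ K : ℝ) : ℝ := (5 * bC1 d δ K + 1) * Real.exp (5 * blam d δ K)

def c5 (d : ℕ) (δ : ℝ) : ℝ := c4 d δ / (2 * 8 ^ d)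

theorem bC0_ge {δ K : ℝ} (hδ : 0 < δ) (hK : 0 ≤ K) : 1 ≤ bC0 d δ K := by
  unfold bC0
  have h1 : 0 ≤ bC1 d δ K := by unfold bC1; positivity
  have h2 : 0 ≤ blam d δ K := by unfold blam; positivity
  have h3 : 1 ≤ Real.exp (5 * blam d δ K) := Real.one_le_exp (by positivity)
  nlinarith

set_option maxHeartbeats 1000000 in
theorem Dat.step1 {D : Dat d} (hD : D.Ok) {M r s ρ : ℝ} {x1 : Sp d} (hM : 0 < M)
    (hr : 0 < r) (hr1 : r ≤ 1) (hKr : D.K * r ≤ D.δ / 16) (hρ : 0 < ρ) (hρ1 : ρ ≤ 1)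
    (hMρ : 1 ≤ M * ρ ^ 2)
    (hQ : Zc (s - 6 * r ^ 2) s x1 (8 * r) ⊆ Zc D.T0 D.T1 0 (D.R - ρ))
    (hF : ∫⁻ z in Zc (s - 6 * r ^ 2) s x1 (8 * r), ENNReal.ofReal (D.f z) ^ (d + 1) ≤
      ENNReal.ofReal (c5 d D.δ * M ^ (d + 1) * r ^ (d + 2)))
    {z0 : ℝ × Sp d} (hz0 : z0 ∈ D.A M) (hz0Q : z0 ∈ Zc (s - 6 * r ^ 2) (s - 2 * r ^ 2) x1 (2 * r)) :
    ∃ x2 : Sp d, ‖x2 - x1‖ ≤ r / 2 ∧ D.J.v (s - r ^ 2, x2) ≤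
      D.J.v z0 + inner ℝ (D.J.g z0) (x2 - z0.2) - M / 2 * ‖x2 - z0.2‖ ^ 2
        - M * ((s - r ^ 2) - z0.1) + bC0 d D.δ D.K * M * r ^ 2 := by
  by_contra! hcon
  have hδ := hD.hδ0
  have hKnn := hD.hK
  set tb := s - r ^ 2 with htb
  set C1 := bC1 d D.δ D.K with hC1
  set lam := blam d D.δ D.K with hlam
  set C0 := bC0 d D.δ D.K with hC0
  have hr2 : 0 < r ^ 2 := by positivity
  have hC1p : 0 < C1 := by rw [hC1]; unfold bC1; positivity
  have hlamp : 0 ≤ lam := by rw [hlam]; unfold blam; positivity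
  have hC0p : 1 ≤ C0 := bC0_ge hδ hKnn
  set κ := C0 * M / r ^ 4 with hκ
  have hκ0 : 0 ≤ κ := by positivity
  have hOm : Zc (s - 6 * r ^ 2) s x1 (8 * r) ⊆ D.Om := by
    intro w hw
    have := hQ hw
    exact ⟨this.1, Metric.closedBall_subset_closedBall (by linarith) this.2⟩
  have hsub : Zc z0.1 tb x1 (8 * r) ⊆ Zc (s - 6 * r ^ 2) s x1 (8 * r) := by
    rintro w ⟨h1, h2⟩
    refine ⟨⟨hz0Q.1.1.trans h1.1, ?_⟩, h2⟩
    have := h1.2; linarith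
  have hz0B : z0 ∈ Zc z0.1 tb x1 (8 * r) :=
    ⟨⟨le_rfl, by have := hz0Q.1.2; linarith⟩,
      Metric.closedBall_subset_closedBall (by linarith) hz0Q.2⟩
  have hz0Om : z0 ∈ D.Om := hOm (hsub hz0B)
  have hz0x : ‖z0.2‖ ≤ D.R - ρ := by
    have := (hQ (hsub hz0B)).2
    simpa using this
  have hsT : s ≤ D.T1 := by
    have h1 : (s, x1) ∈ Zc (s - 6 * r ^ 2) s x1 (8 * r) :=
      ⟨⟨by simp; positivity, le_rfl⟩, Metric.mem_closedBall_self (by positivity)⟩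
    exact (hQ h1).1.2
  have hz0t : z0.1 < D.T1 := by have := hz0Q.1.2; linarith
  have hgrad := Dat.grad_le hD hz0 hz0Om hz0t hρ hρ1 hz0x hMρ
  have hz0d : ‖z0.2 - x1‖ ≤ 2 * r := mem_closedBall_iff_norm.1 hz0Q.2
  set J' := ((D.J.add (quad (-(D.J.v z0 - inner ℝ (D.J.g z0) z0.2 + M * z0.1)) M (-D.J.g z0) M
    z0.2)).add ((barJ tb r (lam / r ^ 2) x1).smul (-κ))).add (quad (C1 * M * tb) (-(C1 * M)) 0 0 0)
    with hJ'
  have hJok : J'.Ok := ((hD.ok.add (quad_ok _ _ _ _ _)).add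
    ((barJ_ok _ _ _ _).smul _)).add (quad_ok _ _ _ _ _)
  have ev : ∀ z, J'.v z = D.J.v z - (D.J.v z0 + inner ℝ (D.J.g z0) (z.2 - z0.2)
      - M / 2 * ‖z.2 - z0.2‖ ^ 2 - M * (z.1 - z0.1)) - κ * (barJ tb r (lam / r ^ 2) x1).v z
      + C1 * M * (tb - z.1) := fun z => by
    simp [hJ', Jet.add, Jet.smul, quad, inner_sub_right]; ring
  have et : ∀ z, J'.t z = D.J.t z + M - κ * (barJ tb r (lam / r ^ 2) x1).t z - C1 * M := fun z => by
    simp [hJ', Jet.add, Jet.smul, quad]; ring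
  have eg : ∀ z, D.J.g z = J'.g z + (D.J.g z0 - M • (z.2 - z0.2)) +
      κ • (barJ tb r (lam / r ^ 2) x1).g z := fun z => by
    simp [hJ', Jet.add, Jet.smul, quad]
    module
  have eH : ∀ z, J'.H z = D.J.H z + M • 1 - κ • (barJ tb r (lam / r ^ 2) x1).H z := fun z => by
    simp [hJ', Jet.add, Jet.smul, quad]; abel
  have hup : ∀ w ∈ Zc z0.1 tb x1 (8 * r), D.J.v z0 + inner ℝ (D.J.g z0) (w.2 - z0.2)
      - M / 2 * ‖w.2 - z0.2‖ ^ 2 - M * (w.1 - z0.1) ≤ D.J.v w := fun w hw =>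
    Dat.A_same hD hz0 hz0Om hz0t (hOm (hsub hw)) hw.1.1
  have hη : M * r ^ 2 / (4 * (8 * r)) = M * r / 32 := by field_simp; norm_num
  have ht0 : z0.1 ≤ tb := by have := hz0Q.1.2; linarith
  have hσ : tb - z0.1 ≤ 5 * r ^ 2 := by have := hz0Q.1.1; linarith
  have key := core2 hJok (t1 := z0.1) (t2 := tb) (xc := x1) (R := 8 * r) (μ := M * r ^ 2)
    (z0 := z0) (by positivity) (by positivity) (fun z hz h => by
      have h1 := hup z hz
      rw [ev]
      have hzt : 0 ≤ tb - z.1 := by have := hz.1.2; linarith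
      have hzt2 : 0 ≤ C1 * M * (tb - z.1) := by positivity
      have h2 : C1 * M * (tb - z.1) ≥ 0 := by positivity
      rcases h with h | h
      · -- top
        by_cases hx : ‖z.2 - x1‖ ≤ r / 2
        · have h3 := hcon z.2 hx
          have e1 : (tb, z.2) = z := Prod.ext h.symm rfl
          rw [e1, ← h] at h3
          have h4 : (barJ tb r (lam / r ^ 2) x1).v z ≤ r ^ 6 := by
            have hb1 : bE tb (lam / r ^ 2) z = 1 := by simp [bE, h]
            have hb2 : bM tb r x1 z ≤ r ^ 2 := by
              refine max_le ?_ hr2.le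
              rw [bY, h]
              have : 0 ≤ ‖z.2 - x1‖ ^ 2 := by positivity
              linarith
            have hb3 : 0 ≤ bM tb r x1 z := le_max_right _ _
            calc (barJ tb r (lam / r ^ 2) x1).v z = bM tb r x1 z ^ 3 := by simp [barJ, hb1]
              _ ≤ (r ^ 2) ^ 3 := by gcongr
              _ = r ^ 6 := by ring
          have h5 : κ * (barJ tb r (lam / r ^ 2) x1).v z ≤ C0 * M * r ^ 2 := by
            calc _ ≤ κ * r ^ 6 := by gcongr
              _ = _ := by rw [hκ]; field_simp
          linarith
        · have h4 : (barJ tb r (lam / r ^ 2) x1).v z = 0 := by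
            have : bM tb r x1 z = 0 := by
              rw [bM, max_eq_right]
              rw [bY, h]
              push Not at hx
              nlinarith
            simp [barJ, this]
          rw [h4]; linarith
      · have h4 : (barJ tb r (lam / r ^ 2) x1).v z = 0 := by
          have : bM tb r x1 z = 0 := by
            rw [bM, max_eq_right]
            rw [bY, h]
            have := hz.1.1
            nlinarith
          simp [barJ, this]
        rw [h4]; linarith) hz0B (by
      rw [ev]
      simp only [sub_self, inner_zero_right, norm_zero]
      have h1 : Real.exp (-(5 * lam)) * r ^ 6 ≤ (barJ tb r (lam / r ^ 2) x1).v z0 := by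
        have hb1 : Real.exp (-(5 * lam)) ≤ bE tb (lam / r ^ 2) z0 := by
          rw [bE]
          refine Real.exp_le_exp.2 (neg_le_neg ?_)
          calc lam / r ^ 2 * (tb - z0.1) ≤ lam / r ^ 2 * (5 * r ^ 2) := by gcongr
            _ = 5 * lam := by field_simp
        have hb2 : r ^ 2 ≤ bM tb r x1 z0 := by
          refine le_trans ?_ (le_max_left _ _)
          rw [bY]
          have h3 : ‖z0.2 - x1‖ ^ 2 ≤ (2 * r) ^ 2 := by gcongr
          have h4 : r ^ 2 ≤ tb - z0.1 := by have := hz0Q.1.2; linarith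
          nlinarith
        have hbE : 0 ≤ bE tb (lam / r ^ 2) z0 := (Real.exp_pos _).le
        calc Real.exp (-(5 * lam)) * r ^ 6 = Real.exp (-(5 * lam)) * (r ^ 2) ^ 3 := by ring
          _ ≤ bE tb (lam / r ^ 2) z0 * bM tb r x1 z0 ^ 3 := by gcongr
      have h2 : (5 * C1 + 1) * M * r ^ 2 ≤ κ * (barJ tb r (lam / r ^ 2) x1).v z0 := by
        calc (5 * C1 + 1) * M * r ^ 2 = κ * (Real.exp (-(5 * lam)) * r ^ 6) := by
              rw [hκ, hC0, bC0, ← hC1, ← hlam, Real.exp_neg]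
              field_simp
          _ ≤ _ := by gcongr
      have h3 : C1 * M * (tb - z0.1) ≤ C1 * M * (5 * r ^ 2) := by gcongr
      linarith) hD.hδ0 hD.hδ1 hD.ha hD.hf (k := D.K * (M * r / 32))
      (F := c5 d D.δ * M ^ (d + 1) * r ^ (d + 2))
      (by positivity)
      (by have := c4_pos (d := d) hD.hδ0; unfold c5; positivity)
      (fun z hz => by
        have h1 := hD.hL z (hOm (hsub hz.1))
        have h2 : ‖J'.g z‖ ≤ M * r / 32 := hη ▸ hz.2.2.2.2.1
        have hzx : ‖z.2 - x1‖ ≤ 8 * r := hz.2.2.1.le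
        have h3 : ‖D.J.g z0 - M • (z.2 - z0.2)‖ ≤ 13 * M := by
          have e1 := norm_sub_le (D.J.g z0) (M • (z.2 - z0.2))
          rw [norm_smul, Real.norm_of_nonneg hM.le] at e1
          have e2 : ‖z.2 - z0.2‖ ≤ 10 := by
            have : z.2 - z0.2 = (z.2 - x1) - (z0.2 - x1) := by abel
            rw [this]
            have := norm_sub_le (z.2 - x1) (z0.2 - x1)
            linarith
          nlinarith
        have h4 : |inner ℝ (D.b z) (J'.g z)| ≤ D.K * (M * r / 32) :=
          (abs_real_inner_le_norm _ _).trans (mul_le_mul (hD.hb z) h2 (norm_nonneg _) hD.hK)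
        have h5 : |inner ℝ (D.b z) (D.J.g z0 - M • (z.2 - z0.2))| ≤ D.K * (13 * M) :=
          (abs_real_inner_le_norm _ _).trans (mul_le_mul (hD.hb z) h3 (norm_nonneg _) hD.hK)
        have h6 := bar_sub hδ hr hr1 (rfl : lam = _) (hD.ha z) (hD.hb z) hz.2.1.le hzx
        have h6' := mul_nonneg hκ0 h6
        rw [eg, inner_add_right, inner_add_right, inner_smul_right] at h1
        rw [et, eH, ip_sub, ip_add, ip_smul, ip_smul]
        have h8 : M * ip (D.a z) 1 ≤ M * (d / D.δ) := by
          rw [div_eq_mul_inv]; gcongr; exact (hD.ha z).ip_one_le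
        have h9 : C1 * M = M + M * (d / D.δ) + D.K * (13 * M) := by
          rw [hC1, bC1]; ring
        have h10 := (abs_le.1 h4).1
        have h11 := (abs_le.1 h5).1
        linarith)
      ((lintegral_mono_set hsub).trans hF)
  have hV := contact_vol_le (J := J') (xc := x1) (η := M * r ^ 2 / (4 * (8 * r))) ht0
    (by positivity : 0 ≤ 8 * r)
  have hcd := cd_pos d
  have hV2 : (volume (contact J' z0.1 tb x1 (8 * r) (M * r ^ 2 / (4 * (8 * r))))).toReal ≤
      5 * r ^ 2 * (4 ^ (d + 1) * cd d * (8 * r) ^ d) := hV.trans (by gcongr)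
  have k0 : cd d * (M * r ^ 2) ^ (d + 1) / (8 * r) ^ d ≤ (2 / D.δ) ^ (d + 1) *
      (c5 d D.δ * M ^ (d + 1) * r ^ (d + 2) + (D.K * (M * r / 32)) ^ (d + 1) *
        (5 * r ^ 2 * (4 ^ (d + 1) * cd d * (8 * r) ^ d))) := key.trans (by gcongr)
  set X := cd d * M ^ (d + 1) * r ^ (d + 2) / 8 ^ d with hX
  have hXp : 0 < X := by positivity
  have k1 : cd d * (M * r ^ 2) ^ (d + 1) / (8 * r) ^ d = X := by
    rw [hX, mul_pow 8 r]; field_simp; ring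
  have k2 : (2 / D.δ) ^ (d + 1) * (c5 d D.δ * M ^ (d + 1) * r ^ (d + 2)) = 1 / 4 * X := by
    rw [hX, c5, c4]; field_simp; norm_num
  have k3 : (2 / D.δ) ^ (d + 1) * ((D.K * (M * r / 32)) ^ (d + 1) *
        (5 * r ^ 2 * (4 ^ (d + 1) * cd d * (8 * r) ^ d))) =
        (16 * (D.K * r) / D.δ) ^ (d + 1) * (5 / 64) * X := by
    have e16 : 16 * (D.K * r) / D.δ = (2 / D.δ) * D.K * r * 8 := by ring
    have e32 : D.K * (M * r / 32) = D.K * M * r / (4 * 8) := by ring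
    rw [hX, e16, e32, div_pow (D.K * M * r)]
    simp only [mul_pow]
    field_simp
    ring
  have k4 : (16 * (D.K * r) / D.δ) ^ (d + 1) ≤ 1 := by
    refine pow_le_one₀ (by positivity) ?_
    rw [div_le_one hδ]; linarith
  rw [mul_add, k1, k2, k3] at k0
  nlinarith

/-- The key lemma: propagation. -/
theorem Dat.KL {D : Dat d} (hD : D.Ok) {M r s ρ : ℝ} {x1 : Sp d} (hM : 0 < M)
    (hr : 0 < r) (hr1 : r ≤ 1) (hKr : D.K * r ≤ D.δ / 16) (hρ : 0 < ρ) (hρ1 : ρ ≤ 1)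
    (hMρ : 1 ≤ M * ρ ^ 2)
    (hQ : Zc (s - 6 * r ^ 2) s x1 (8 * r) ⊆ Zc D.T0 D.T1 0 (D.R - ρ))
    (hF : ∫⁻ z in Zc (s - 6 * r ^ 2) s x1 (8 * r), ENNReal.ofReal (D.f z) ^ (d + 1) ≤
      ENNReal.ofReal (c5 d D.δ * M ^ (d + 1) * r ^ (d + 2)))
    {z0 : ℝ × Sp d} (hz0 : z0 ∈ D.A M) (hz0Q : z0 ∈ Zc (s - 6 * r ^ 2) (s - 2 * r ^ 2) x1 (2 * r)) :
    ENNReal.ofReal (th d D.δ D.K (bC0 d D.δ D.K) * r ^ (d + 2)) ≤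
      volume (D.A ((1 + cB (bC0 d D.δ D.K)) * M) ∩ Zc (s - r ^ 2) s x1 r) := by
  obtain ⟨x2, hx2, hv⟩ := Dat.step1 hD hM hr hr1 hKr hρ hρ1 hMρ hQ hF hz0 hz0Q
  have hr2 : 0 < r ^ 2 := by positivity
  have hOm : Zc (s - 6 * r ^ 2) s x1 (8 * r) ⊆ D.Om := by
    intro w hw
    have := hQ hw
    exact ⟨this.1, Metric.closedBall_subset_closedBall (by linarith) this.2⟩
  have hsub : Zc (s - r ^ 2) s x1 r ⊆ Zc (s - 6 * r ^ 2) s x1 (8 * r) := by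
    rintro w ⟨h1, h2⟩
    exact ⟨⟨by have := h1.1; linarith, h1.2⟩, Metric.closedBall_subset_closedBall (by linarith) h2⟩
  have hsub0 : Zc (s - 6 * r ^ 2) (s - 2 * r ^ 2) x1 (2 * r) ⊆
      Zc (s - 6 * r ^ 2) s x1 (8 * r) := by
    rintro w ⟨h1, h2⟩
    exact ⟨⟨h1.1, by have := h1.2; linarith⟩, Metric.closedBall_subset_closedBall (by linarith) h2⟩
  have hz0x : ‖z0.2‖ ≤ D.R - ρ := by
    have := (hQ (hsub0 hz0Q)).2
    simpa using this
  have hsT : s ≤ D.T1 := by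
    have h1 : (s, x1) ∈ Zc (s - 6 * r ^ 2) s x1 (8 * r) :=
      ⟨⟨by simp; positivity, le_rfl⟩, Metric.mem_closedBall_self (by positivity)⟩
    exact (hQ h1).1.2
  have hz0t : z0.1 < D.T1 := by have := hz0Q.1.2; linarith
  have hgrad := Dat.grad_le hD hz0 (hOm (hsub0 hz0Q)) hz0t hρ hρ1 hz0x hMρ
  have hz0d : ‖z0.2 - x1‖ ≤ 2 * r := mem_closedBall_iff_norm.1 hz0Q.2
  have hC0 := bC0_ge (d := d) hD.hδ0 hD.hK
  refine Dat.step2 hD (by linarith) hM hr hr1 (hsub.trans hOm) ?_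
    (α := D.J.v z0 - inner ℝ (D.J.g z0) z0.2 + M * z0.1) (m0 := M) (M0 := M) (p0 := D.J.g z0)
    (y0 := z0.2) hM.le le_rfl hM.le le_rfl ?_ ?_ hx2 ?_
  · refine (lintegral_mono_set hsub).trans (hF.trans (ENNReal.ofReal_le_ofReal ?_))
    have := c4_pos (d := d) hD.hδ0
    gcongr
    unfold c5
    refine div_le_self this.le ?_
    have : (1 : ℝ) ≤ 8 ^ d := one_le_pow₀ (by norm_num)
    linarith
  · intro w hw hws
    have := hz0 w hw (by have := hz0Q.1.2; linarith)
    rw [inner_sub_right] at this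
    linarith
  · intro x hx
    have hx' : ‖x - x1‖ ≤ r := mem_closedBall_iff_norm.1 hx
    have e1 := norm_sub_le (D.J.g z0) (M • (x - z0.2))
    rw [norm_smul, Real.norm_of_nonneg hM.le] at e1
    have e2 : ‖x - z0.2‖ ≤ 3 := by
      have : x - z0.2 = (x - x1) - (z0.2 - x1) := by abel
      rw [this]
      have := norm_sub_le (x - x1) (z0.2 - x1)
      linarith
    nlinarith
  · rw [inner_sub_right] at hv
    linarith

end PGE

namespace PGE

variable {d : ℕ}

/-- chain of times -/
def sch (s0 r0 : ℝ) (j : ℕ) : ℝ := s0 - 2 / 3 * ((2 ^ j * r0) ^ 2 - r0 ^ 2)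

theorem Dat.chain {D : Dat d} (hD : D.Ok) {M r ρ : ℝ} (hM : 0 < M)
    (hr : 0 < r) (hr1 : r ≤ 1 / 2) (hKr : D.K * r ≤ D.δ / 16) (hρ : 0 < ρ) (hρ1 : ρ ≤ 1)
    (hMρ : 1 ≤ M * ρ ^ 2) (hMr : 2 + 1 / c4 d D.δ ≤ M * r ^ 2) {z : ℝ × Sp d}
    (hz : z ∉ D.A ((1 + cB (bC0 d D.δ D.K)) * M))
    (hz1 : D.T0 + 40 * r ^ 2 ≤ z.1) (hz2 : z.1 < D.T1) (hz3 : ‖z.2‖ ≤ D.R - ρ - 8 * r) :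
    ∃ r' s, 0 < r' ∧ r' < r ∧ |z.1 - s| ≤ r' ^ 2 ∧ s < D.T1 ∧
      ENNReal.ofReal (th d D.δ D.K (bC0 d D.δ D.K) * (2 * r') ^ (d + 2)) ≤
        volume (D.A ((1 + cB (bC0 d D.δ D.K)) * M) ∩
          Zc (s - 6 * r' ^ 2) (s - 2 * r' ^ 2) z.2 (2 * r')) ∧
      ((∀ w ∈ Zc (s - 6 * r' ^ 2) (s - 2 * r' ^ 2) z.2 (2 * r'), w ∉ D.A M) ∨
        ENNReal.ofReal (c5 d D.δ * M ^ (d + 1) * r' ^ (d + 2)) ≤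
          ∫⁻ z in Zc (s - 6 * r' ^ 2) s z.2 (8 * r'), ENNReal.ofReal (D.f z) ^ (d + 1)) := by
  set C0 := bC0 d D.δ D.K with hC0
  have hC0' : 1 ≤ C0 := bC0_ge hD.hδ0 hD.hK
  have hth : 0 < th d D.δ D.K C0 := th_pos hD.hδ0 hD.hK (by linarith)
  set θ := th d D.δ D.K C0 with hθ
  set A' := D.A ((1 + cB C0) * M) with hA'
  -- a small starting radius
  obtain ⟨ε, hε, hball⟩ := Metric.isOpen_iff.1 (Dat.A_closed hD ((1 + cB C0) * M)).isOpen_compl z hz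
  obtain ⟨r0, hr0, hr0r, hr0e, hr0T⟩ : ∃ r0, 0 < r0 ∧ r0 < r ∧ r0 < ε ∧ r0 < D.T1 - z.1 := by
    have : 0 < min r (min ε (D.T1 - z.1)) := lt_min hr (lt_min hε (by linarith))
    refine ⟨min r (min ε (D.T1 - z.1)) / 2, by positivity, ?_, ?_, ?_⟩
    · have := min_le_left r (min ε (D.T1 - z.1)); linarith
    · have := (min_le_right r (min ε (D.T1 - z.1))).trans (min_le_left _ _); linarith
    · have := (min_le_right r (min ε (D.T1 - z.1))).trans (min_le_right _ _); linarith
  have hr0sq : r0 ^ 2 ≤ r0 := by nlinarith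
  set s0 := z.1 + r0 ^ 2 / 2 with hs0
  set rj : ℕ → ℝ := fun j => 2 ^ j * r0 with hrj
  set sj : ℕ → ℝ := fun j => sch s0 r0 j with hsj
  have rpos : ∀ j, 0 < rj j := fun j => by positivity
  have rge : ∀ j, r0 ≤ rj j := fun j => by
    have : (1 : ℝ) ≤ 2 ^ j := one_le_pow₀ (by norm_num)
    simp only [hrj]; nlinarith
  have rsucc : ∀ j, rj (j + 1) = 2 * rj j := fun j => by simp only [hrj]; ring
  have ssucc : ∀ j, sj (j + 1) = sj j - 2 * rj j ^ 2 := fun j => by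
    simp only [hsj, hrj, sch]; ring
  have sup : ∀ j, sj j ≤ s0 := fun j => by
    have h1 : r0 ^ 2 ≤ rj j ^ 2 := by have := rge j; gcongr
    simp only [hsj, sch]
    simp only [hrj] at h1
    linarith
  have slo : ∀ j, z.1 - 2 / 3 * rj j ^ 2 ≤ sj j := fun j => by
    simp only [hsj, hrj, sch]
    have : 0 ≤ r0 ^ 2 := by positivity
    linarith
  have s0T : s0 < D.T1 := by rw [hs0]; linarith
  let P : ℕ → Prop := fun j => ENNReal.ofReal (θ * rj j ^ (d + 2)) ≤
    volume (A' ∩ Zc (sj j - rj j ^ 2) (sj j) z.2 (rj j))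
  have hP0 : ¬ P 0 := by
    have h1 : A' ∩ Zc (sj 0 - rj 0 ^ 2) (sj 0) z.2 (rj 0) = ∅ := by
      refine eq_empty_of_forall_notMem fun w hw => ?_
      refine hball ?_ hw.1
      have h2 := hw.2.1
      have h3 := hw.2.2
      simp only [hrj, hsj, sch, pow_zero, one_mul, sub_self, mul_zero, sub_zero] at h2 h3
      rw [Metric.mem_ball, Prod.dist_eq, max_lt_iff]
      refine ⟨?_, lt_of_le_of_lt h3 hr0e⟩
      rw [Real.dist_eq, abs_lt]
      have := h2.1; have := h2.2
      constructor <;> nlinarith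
    simp only [P, h1, measure_empty, nonpos_iff_eq_zero, ENNReal.ofReal_eq_zero, not_le]
    have := rpos 0
    positivity
  obtain ⟨n, hn1, hn2⟩ : ∃ n, r ≤ rj n ∧ ∀ m < n, rj m < r := by
    have hex : ∃ n, r ≤ rj n := by
      obtain ⟨n, hn⟩ := pow_unbounded_of_one_lt (r / r0) (one_lt_two)
      refine ⟨n, ?_⟩
      rw [div_lt_iff₀ hr0] at hn
      exact hn.le
    classical
    exact ⟨Nat.find hex, Nat.find_spec hex, fun m hm => not_le.1 (Nat.find_min hex hm)⟩
  have hn0 : n ≠ 0 := by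
    rintro rfl
    simp [hrj] at hn1
    linarith
  have hn3 : rj n < 2 * r := by
    obtain ⟨m, rfl⟩ := Nat.exists_eq_succ_of_ne_zero hn0
    rw [rsucc]
    have := hn2 m (Nat.lt_succ_self m)
    linarith
  have hPn : P n := by
    refine Dat.initStep hD hC0' hM (rpos n) (by linarith) ?_ ?_
    · rintro w ⟨h1, h2⟩
      have h3 := slo n
      have h4 := sup n
      have h5 := h1.1
      have h6 := h1.2
      have h7 : rj n ^ 2 ≤ (2 * r) ^ 2 := by have := rpos n; gcongr
      refine ⟨⟨by nlinarith, by linarith⟩, ?_⟩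
      rw [mem_closedBall_zero_iff]
      have h8 := mem_closedBall_iff_norm.1 h2
      have h9 := norm_le_norm_sub_add w.2 z.2
      linarith
    · refine hMr.trans ?_
      gcongr
  classical
  have hexP : ∃ j, P j := ⟨n, hPn⟩
  obtain ⟨j, hj⟩ : ∃ j, Nat.find hexP = j + 1 := by
    refine Nat.exists_eq_succ_of_ne_zero fun h => ?_
    have := Nat.find_spec hexP
    rw [h] at this
    exact hP0 this
  have hPj : ¬ P j := Nat.find_min hexP (by omega)
  have hPj1 : P (j + 1) := by have := Nat.find_spec hexP; rwa [hj] at this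
  have hjn : j < n := by have := Nat.find_le (h := hexP) hPn; omega
  have hrjr : rj j < r := hn2 j hjn
  have hsq : r0 ^ 2 ≤ rj j ^ 2 := by have := rge j; gcongr
  have hsq2 : rj j ^ 2 ≤ r ^ 2 := by have := (rpos j).le; gcongr
  have eQ : Zc (sj (j + 1) - rj (j + 1) ^ 2) (sj (j + 1)) z.2 (rj (j + 1)) =
      Zc (sj j - 6 * rj j ^ 2) (sj j - 2 * rj j ^ 2) z.2 (2 * rj j) := by
    rw [ssucc, rsucc]; congr 1; ring
  have hslo := slo j
  have hsup := sup j
  refine ⟨rj j, sj j, rpos j, hrjr, ?_, by linarith, ?_, ?_⟩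
  · rw [abs_le]; constructor
    · linarith
    · have : 0 ≤ rj j ^ 2 := by positivity
      linarith
  · have := hPj1
    simp only [P] at this
    rwa [eQ, rsucc] at this
  · by_contra! hcon
    obtain ⟨⟨w, hw, hwA⟩, hIntg⟩ := hcon
    refine hPj (Dat.KL hD hM (rpos j) (by linarith) ?_ hρ hρ1 hMρ ?_ hIntg.le hwA hw)
    · refine le_trans ?_ hKr
      have := hD.hK
      gcongr
    · rintro w ⟨h1, h2⟩
      have h5 := h1.1
      have h6 := h1.2
      refine ⟨⟨by nlinarith, by linarith⟩, ?_⟩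
      rw [mem_closedBall_zero_iff]
      have h8 := mem_closedBall_iff_norm.1 h2
      have h9 := norm_le_norm_sub_add w.2 z.2
      linarith

/-- Covering constant -/
def cK (d : ℕ) : ℝ := 80 * (4 ^ (d + 1) * cd d * 24 ^ d)

theorem Dat.cover {D : Dat d} (hD : D.Ok) {M r ρ : ℝ} (hM : 0 < M)
    (hr : 0 < r) (hr1 : r ≤ 1 / 2) (hKr : D.K * r ≤ D.δ / 16) (hρ : 0 < ρ) (hρ1 : ρ ≤ 1)
    (hMρ : 1 ≤ M * ρ ^ 2) (hMr : 2 + 1 / c4 d D.δ ≤ M * r ^ 2) {E V : Set (ℝ × Sp d)}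
    (hE : ∀ z ∈ E, z ∉ D.A ((1 + cB (bC0 d D.δ D.K)) * M) ∧
      D.T0 + 40 * r ^ 2 ≤ z.1 ∧ z.1 < D.T1 ∧ ‖z.2‖ ≤ D.R - ρ - 8 * r)
    (hV : ∀ z ∈ E, ∀ w : ℝ × Sp d, z.1 - 8 * r ^ 2 ≤ w.1 → w.1 < D.T1 → ‖w.2 - z.2‖ ≤ 2 * r → w ∈ V)
    (hVm : MeasurableSet V) :
    volume E ≤ ENNReal.ofReal (cK d) * (ENNReal.ofReal (th d D.δ D.K (bC0 d D.δ D.K))⁻¹ *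
      volume ((V ∩ D.A ((1 + cB (bC0 d D.δ D.K)) * M)) \ D.A M) +
        ENNReal.ofReal ((c5 d D.δ * M ^ (d + 1))⁻¹)) := by
  classical
  set C0 := bC0 d D.δ D.K with hC0
  have hC0' : 1 ≤ C0 := bC0_ge hD.hδ0 hD.hK
  have hth : 0 < th d D.δ D.K C0 := th_pos hD.hδ0 hD.hK (by linarith)
  set θ := th d D.δ D.K C0 with hθ
  set A' := D.A ((1 + cB C0) * M) with hA'
  have hc5 : 0 < c5 d D.δ * M ^ (d + 1) := by
    have := c4_pos (d := d) hD.hδ0; unfold c5; positivity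
  set ω := c5 d D.δ * M ^ (d + 1) with hω
  have key : ∀ z : ℝ × Sp d, ∃ p : ℝ × ℝ, z ∈ E → 0 < p.1 ∧ p.1 < r ∧ |z.1 - p.2| ≤ p.1 ^ 2 ∧
      p.2 < D.T1 ∧ ENNReal.ofReal (θ * (2 * p.1) ^ (d + 2)) ≤
        volume (A' ∩ Zc (p.2 - 6 * p.1 ^ 2) (p.2 - 2 * p.1 ^ 2) z.2 (2 * p.1)) ∧
      ((∀ w ∈ Zc (p.2 - 6 * p.1 ^ 2) (p.2 - 2 * p.1 ^ 2) z.2 (2 * p.1), w ∉ D.A M) ∨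
        ENNReal.ofReal (ω * p.1 ^ (d + 2)) ≤
          ∫⁻ z in Zc (p.2 - 6 * p.1 ^ 2) p.2 z.2 (8 * p.1), ENNReal.ofReal (D.f z) ^ (d + 1)) := by
    intro z
    by_cases hz : z ∈ E
    · obtain ⟨h1, h2, h3, h4⟩ := hE z hz
      obtain ⟨r', s, h⟩ := Dat.chain hD hM hr hr1 hKr hρ hρ1 hMρ hMr h1 h2 h3 h4
      exact ⟨(r', s), fun _ => h⟩
    · exact ⟨0, fun h => absurd h hz⟩
  choose p hp using key
  set BQ : ℝ × Sp d → Set (ℝ × Sp d) := fun z =>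
    Zc ((p z).2 - 6 * (p z).1 ^ 2) (p z).2 z.2 (8 * (p z).1) with hBQ
  obtain ⟨u, huE, hudisj, hu⟩ := Vitali.exists_disjoint_subfamily_covering_enlargement BQ E
    (fun z => (p z).1) 2 one_lt_two (fun z hz => (hp z hz).1.le) r (fun z hz => (hp z hz).2.1.le)
    (fun z hz => ⟨((p z).2, z.2), ⟨by have := (hp z hz).1; simp; positivity, le_rfl⟩,
      Metric.mem_closedBall_self (by have := (hp z hz).1; positivity)⟩)
  have hcount : u.Countable := by
    refine hudisj.countable_of_nonempty_interior fun z hz => ?_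
    have h0 := (hp z (huE hz)).1
    refine ⟨((p z).2 - 3 * (p z).1 ^ 2, z.2), ?_⟩
    rw [hBQ]
    simp only [Zc, interior_prod_eq, interior_Icc]
    have : 0 < (p z).1 ^ 2 := by positivity
    exact ⟨⟨by simp; linarith, by simp; linarith⟩,
      Metric.ball_subset_interior_closedBall (Metric.mem_ball_self (by positivity))⟩
  set S := (V ∩ A') \ D.A M with hS
  have hSm : MeasurableSet S :=
    (hVm.inter (Dat.A_closed hD _).measurableSet).diff (Dat.A_closed hD _).measurableSet
  have hZm : ∀ t1 t2 (x : Sp d) R, MeasurableSet (Zc t1 t2 x R) := fun t1 t2 x R =>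
    measurableSet_Icc.prod Metric.isClosed_closedBall.measurableSet
  have hOmm : MeasurableSet D.Om := hZm _ _ _ _
  set μ : Measure (ℝ × Sp d) := (ENNReal.ofReal θ⁻¹) • volume.restrict S +
    (ENNReal.ofReal ω⁻¹) • (volume.restrict D.Om).withDensity (fun z => ENNReal.ofReal (D.f z) ^ (d + 1))
    with hμ
  have hsub : ∀ z ∈ E, BQ z ⊆ D.Om := by
    rintro z hz w ⟨h1, h2⟩
    obtain ⟨k1, k2, k3, k4, -⟩ := hp z hz
    obtain ⟨-, e2, e3, e4⟩ := hE z hz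
    have h5 := h1.1
    have h6 := h1.2
    have h7 := (abs_le.1 k3).2
    have hsq2 : (p z).1 ^ 2 ≤ r ^ 2 := by gcongr
    refine ⟨⟨by nlinarith, by linarith⟩, ?_⟩
    rw [mem_closedBall_zero_iff]
    have h8 := mem_closedBall_iff_norm.1 h2
    have h9 := norm_le_norm_sub_add w.2 z.2
    linarith
  have hμb : ∀ z ∈ E, ENNReal.ofReal ((p z).1 ^ (d + 2)) ≤ μ (BQ z) := by
    intro z hz
    obtain ⟨k1, k2, k3, k4, k5, k6⟩ := hp z hz
    rw [hμ, Measure.add_apply, Measure.smul_apply, Measure.smul_apply, smul_eq_mul, smul_eq_mul,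
      Measure.restrict_apply (hZm _ _ _ _), withDensity_apply _ (hZm _ _ _ _),
      Measure.restrict_restrict (hZm _ _ _ _), inter_eq_left.2 (hsub z hz)]
    rcases k6 with k6 | k6
    · refine le_trans ?_ le_self_add
      have h1 : A' ∩ Zc ((p z).2 - 6 * (p z).1 ^ 2) ((p z).2 - 2 * (p z).1 ^ 2) z.2 (2 * (p z).1)
          ⊆ BQ z ∩ S := by
        rintro w ⟨hw1, hw2⟩
        have hwt := hw2.1.1
        have hwt2 := hw2.1.2
        have h7 := (abs_le.1 k3).2
        have hsq2 : (p z).1 ^ 2 ≤ r ^ 2 := by gcongr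
        have hsq3 : 0 < (p z).1 ^ 2 := by positivity
        refine ⟨⟨⟨hwt, by linarith⟩, Metric.closedBall_subset_closedBall (by linarith) hw2.2⟩,
          ⟨hV z hz w (by linarith) (by linarith) ?_, hw1⟩, k6 w hw2⟩
        have := mem_closedBall_iff_norm.1 hw2.2
        linarith
      calc ENNReal.ofReal ((p z).1 ^ (d + 2))
          ≤ ENNReal.ofReal θ⁻¹ * ENNReal.ofReal (θ * (2 * (p z).1) ^ (d + 2)) := by
            rw [← ENNReal.ofReal_mul (by positivity)]
            refine ENNReal.ofReal_le_ofReal ?_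
            rw [inv_mul_cancel_left₀ hth.ne']
            gcongr; linarith
        _ ≤ _ := by gcongr; exact k5.trans (measure_mono h1)
    · refine le_trans ?_ le_add_self
      calc ENNReal.ofReal ((p z).1 ^ (d + 2))
          = ENNReal.ofReal ω⁻¹ * ENNReal.ofReal (ω * ((p z).1) ^ (d + 2)) := by
            rw [← ENNReal.ofReal_mul (by positivity), inv_mul_cancel_left₀ hc5.ne']
        _ ≤ _ := by gcongr
  have hcov : E ⊆ ⋃ z ∈ u, Zc ((p z).2 - 40 * (p z).1 ^ 2) ((p z).2 + 40 * (p z).1 ^ 2) z.2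
      (24 * (p z).1) := by
    intro z hz
    obtain ⟨w, hw, ⟨y, hy1, hy2⟩, hle⟩ := hu z hz
    obtain ⟨k1, k2, k3, k4, -⟩ := hp z hz
    obtain ⟨l1, l2, l3, l4, -⟩ := hp w (huE hw)
    refine mem_iUnion₂.2 ⟨w, hw, ⟨?_, ?_⟩, ?_⟩
    · have := hy1.1.2; have := hy2.1.1; have := (abs_le.1 k3).1; nlinarith
    · have := hy1.1.1; have := hy2.1.2; have := (abs_le.1 k3).2; nlinarith
    · have e1 := Metric.mem_closedBall.1 hy1.2
      have e2 := Metric.mem_closedBall.1 hy2.2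
      rw [dist_comm] at e1
      refine Metric.mem_closedBall.2 ((dist_triangle z.2 y.2 w.2).trans ?_)
      linarith
  have hcd := cd_pos d
  calc volume E ≤ volume (⋃ z ∈ u, Zc ((p z).2 - 40 * (p z).1 ^ 2) ((p z).2 + 40 * (p z).1 ^ 2) z.2
      (24 * (p z).1)) := measure_mono hcov
    _ ≤ ∑' z : u, volume (Zc ((p z).2 - 40 * (p z).1 ^ 2) ((p z).2 + 40 * (p z).1 ^ 2) z.1.2
      (24 * (p z).1)) := measure_biUnion_le _ hcount _
    _ ≤ ∑' z : u, ENNReal.ofReal (cK d) * μ (BQ z) := by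
        refine ENNReal.tsum_le_tsum fun z => ?_
        have h0 := (hp z (huE z.2)).1
        have h1 : 0 < (p z).1 ^ 2 := by positivity
        rw [Zc_vol (by linarith) (by positivity)]
        refine le_trans (le_of_eq ?_) (mul_le_mul_right (hμb z (huE z.2)) _)
        rw [← ENNReal.ofReal_mul (by unfold cK; positivity)]
        congr 1
        rw [cK, mul_pow]; ring
    _ = ENNReal.ofReal (cK d) * ∑' z : u, μ (BQ z) := ENNReal.tsum_mul_left
    _ ≤ ENNReal.ofReal (cK d) * μ univ := by
        gcongr
        have := hcount.to_subtype
        rw [← measure_iUnion (f := fun z : u => BQ z)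
          (fun i j hij => hudisj i.2 j.2 (Subtype.coe_injective.ne hij)) (fun i => hZm _ _ _ _)]
        exact measure_mono (subset_univ _)
    _ ≤ _ := by
        gcongr
        rw [hμ, Measure.add_apply, Measure.smul_apply, Measure.smul_apply, smul_eq_mul, smul_eq_mul,
          Measure.restrict_apply MeasurableSet.univ, withDensity_apply _ MeasurableSet.univ,
          Measure.restrict_univ, univ_inter]
        gcongr
        calc _ ≤ ENNReal.ofReal ω⁻¹ * 1 := by gcongr; exact hD.hF
          _ = _ := mul_one _

end PGE

namespace PGE

variable {d : ℕ}

theorem rec_bound {x : ℕ → ℝ} {V C1 C2 p : ℝ} (hC1 : 0 < C1) (hC2 : 0 ≤ C2) (hV : 0 ≤ V)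
    (hp0 : 0 ≤ p) (hp : p ≤ 1 / 2) (hx0 : x 0 ≤ V)
    (hx : ∀ k, x (k + 1) ≤ C1 * (x k - x (k + 1)) + C2 * p ^ k) (k : ℕ) :
    x k ≤ (V + 2 * C2) * ((1 + 2 * C1) / (2 * (1 + C1))) ^ k := by
  set q := (1 + 2 * C1) / (2 * (1 + C1)) with hq
  have hqe : (1 + C1) * q = C1 + 1 / 2 := by rw [hq]; field_simp; ring
  have hq2 : p ≤ q := by
    refine hp.trans ?_
    rw [hq, div_le_div_iff₀ (by norm_num) (by positivity)]; linarith
  have hq0 : 0 < q := by positivity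
  induction k with
  | zero => simp; linarith
  | succ k ih =>
    have h1 := hx k
    have h2 : p ^ k ≤ q ^ k := by gcongr
    have h3 : C2 * p ^ k ≤ C2 * q ^ k := by gcongr
    have h4 : C1 * x k ≤ C1 * ((V + 2 * C2) * q ^ k) := by gcongr
    have h5 : 0 ≤ q ^ k := by positivity
    have h6 : (1 + C1) * x (k + 1) ≤ (1 + C1) * ((V + 2 * C2) * q ^ (k + 1)) := by
      have : (1 + C1) * ((V + 2 * C2) * q ^ (k + 1)) = (C1 + 1 / 2) * ((V + 2 * C2) * q ^ k) := by
        rw [← hqe]; ring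
      rw [this]
      have h7 : 0 ≤ V * q ^ k := by positivity
      nlinarith
    exact le_of_mul_le_mul_left h6 (by linarith)

/-- growth factor -/
def CC (d : ℕ) (δ K : ℝ) : ℝ := 1 + cB (bC0 d δ K)

def c1 (δ K : ℝ) : ℝ := δ / (160 * (K + 1))

def Lam (d : ℕ) (δ : ℝ) : ℝ := 2 + 1 / c4 d δ

theorem CC_ge {δ K : ℝ} (hδ : 0 < δ) (hK : 0 ≤ K) : 25 ≤ CC d δ K := by
  have := bC0_ge (d := d) hδ hK
  unfold CC cB; linarith

theorem Om_vol {D : Dat d} (hD : D.Ok) : volume D.Om ≤ ENNReal.ofReal (2 * (4 ^ (d + 1) * cd d)) := by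
  have hcd := cd_pos d
  have hR := hD.hR0
  rcases le_or_gt D.T0 D.T1 with h | h
  · rw [Dat.Om, Zc_vol h (by linarith)]
    refine ENNReal.ofReal_le_ofReal ?_
    have h1 : D.R ^ d ≤ 1 := pow_le_one₀ (by linarith) hD.hR1
    have h2 := hD.hT
    have h3 : 0 ≤ 4 ^ (d + 1) * cd d := by positivity
    calc (D.T1 - D.T0) * (4 ^ (d + 1) * cd d * D.R ^ d) ≤ 2 * (4 ^ (d + 1) * cd d * 1) := by gcongr
      _ = _ := by ring
  · simp [Dat.Om, Zc, Icc_eq_empty (not_le.2 h)]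

set_option maxHeartbeats 800000 in
theorem Dat.decay {δ K : ℝ} (hδ0 : 0 < δ) (hδ1 : δ < 1) (hK : 0 ≤ K) :
    ∃ B q : ℝ, 0 < B ∧ 0 < q ∧ q < 1 ∧ ∀ D : Dat d, D.Ok → D.δ = δ → D.K = K → ∀ ρ, 0 < ρ →
      ρ ≤ 1 / 4 → ∀ k : ℕ, volume ((Ioo (D.T0 + 1 / 2) D.T1 ×ˢ Metric.closedBall (0 : Sp d) (D.R - 2 * ρ)) \
        D.A (Lam d δ / (c1 δ K * ρ) ^ 2 * CC d δ K ^ k)) ≤ ENNReal.ofReal (B * q ^ k) := by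
  have hbC := bC0_ge (d := d) hδ0 hK
  have hth : 0 < th d δ K (bC0 d δ K) := th_pos hδ0 hK (by linarith)
  have hcd := cd_pos d
  have hcK : 0 < cK d := by unfold cK; positivity
  have hc4 := c4_pos (d := d) hδ0
  have hc5 : 0 < c5 d δ := by unfold c5; positivity
  have hCC := CC_ge (d := d) hδ0 hK
  set C1 := cK d * (th d δ K (bC0 d δ K))⁻¹ with hC1
  set C2 := cK d * (c5 d δ)⁻¹ with hC2
  set V := 2 * (4 ^ (d + 1) * cd d) with hV
  have hC1p : 0 < C1 := by positivity
  have hC2p : 0 < C2 := by positivity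
  refine ⟨V + 2 * C2, (1 + 2 * C1) / (2 * (1 + C1)), by positivity, by positivity, ?_, ?_⟩
  · rw [div_lt_one (by positivity)]; linarith
  intro D hD e1 e2 ρ hρ hρ1
  subst e1; subst e2
  set C := CC d D.δ D.K with hC
  set κ := (Real.sqrt C)⁻¹ with hκ
  have hsq5 : 5 ≤ Real.sqrt C := Real.le_sqrt_of_sq_le (by linarith)
  have hκ0 : 0 < κ := by positivity
  have hκ5 : κ ≤ 1 / 5 := by rw [hκ, one_div]; gcongr
  have hκC : κ ^ 2 * C = 1 := by
    rw [hκ, inv_pow, Real.sq_sqrt (by linarith)]; field_simp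
  have hc1 : 0 < c1 D.δ D.K := by unfold c1; positivity
  have hc1u : c1 D.δ D.K * (D.K + 1) ≤ D.δ / 160 := by unfold c1; field_simp; linarith
  have hc1v : c1 D.δ D.K ≤ 1 / 160 := by nlinarith
  set R0 := c1 D.δ D.K * ρ with hR0
  have hR0p : 0 < R0 := by positivity
  have hR0ρ : R0 ≤ ρ / 160 := by rw [hR0]; nlinarith
  have hL : 2 ≤ Lam d D.δ := by unfold Lam; have : 0 < 1 / c4 d D.δ := by positivity
                                linarith
  set Rk : ℕ → ℝ := fun k => R0 * κ ^ k with hRk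
  set Mk : ℕ → ℝ := fun k => Lam d D.δ / R0 ^ 2 * C ^ k with hMk
  have hRkp : ∀ k, 0 < Rk k := fun k => by positivity
  have hRkl : ∀ k, Rk k ≤ R0 := fun k => by
    have : κ ^ k ≤ 1 := pow_le_one₀ hκ0.le (by linarith)
    simp only [hRk]; nlinarith
  have hMkp : ∀ k, 0 < Mk k := fun k => by positivity
  have hMR : ∀ k, Mk k * Rk k ^ 2 = Lam d D.δ := fun k => by
    have : (κ ^ 2 * C) ^ k = 1 := by rw [hκC, one_pow]
    calc Mk k * Rk k ^ 2 = Lam d D.δ * (κ ^ 2 * C) ^ k := by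
          simp only [hMk, hRk, mul_pow, ← pow_mul]; field_simp; ring
      _ = _ := by rw [this, mul_one]
  have hMs : ∀ k, Mk (k + 1) = C * Mk k := fun k => by simp only [hMk]; ring
  have hRs : ∀ k, Rk (k + 1) = κ * Rk k := fun k => by simp only [hRk]; ring
  have hMk1 : ∀ k, C ^ k ≤ Mk k := fun k => by
    have : 1 ≤ Lam d D.δ / R0 ^ 2 := by
      rw [one_le_div (by positivity)]; nlinarith
    simp only [hMk]
    exact le_mul_of_one_le_left (by positivity) this
  set U : ℕ → Set (ℝ × Sp d) := fun k => Ioo (D.T0 + 1 / 2 - ρ + 10 * (R0 - Rk k)) D.T1 ×ˢ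
    Metric.ball (0 : Sp d) (D.R - ρ - 10 * (R0 - Rk k)) with hU
  have hUm : ∀ k, MeasurableSet (U k) := fun k => measurableSet_Ioo.prod measurableSet_ball
  have hUOm : ∀ k, U k ⊆ D.Om := by
    rintro k w ⟨h1, h2⟩
    have h5 := h1.1
    have h6 := h1.2
    have h7 := hRkl k
    rw [mem_ball_zero_iff] at h2
    refine ⟨⟨by linarith, h6.le⟩, ?_⟩
    rw [mem_closedBall_zero_iff]
    linarith
  have hUs : ∀ k, U (k + 1) ⊆ U k := by
    intro k
    have h1 : Rk (k + 1) ≤ Rk k := by rw [hRs]; have := hRkp k; nlinarith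
    exact prod_mono (Ioo_subset_Ioo_left (by linarith)) (Metric.ball_subset_ball (by linarith))
  set a : ℕ → ℝ≥0∞ := fun k => volume (U k \ D.A (Mk k)) with ha
  have haV : ∀ k, a k ≤ ENNReal.ofReal V := fun k =>
    (measure_mono (diff_subset.trans (hUOm k))).trans (Om_vol hD)
  have hatop : ∀ k, a k ≠ ⊤ := fun k => ((haV k).trans_lt ENNReal.ofReal_lt_top).ne
  have hstep : ∀ k, a (k + 1) ≤ ENNReal.ofReal (cK d) *
      (ENNReal.ofReal (th d D.δ D.K (bC0 d D.δ D.K))⁻¹ *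
      volume ((U k ∩ D.A (Mk (k + 1))) \ D.A (Mk k)) +
        ENNReal.ofReal ((c5 d D.δ * Mk k ^ (d + 1))⁻¹)) := by
    intro k
    have h0 := hRkl k
    have h1 := hRkp k
    rw [hMs]
    have e : a (k + 1) = volume (U (k + 1) \ D.A (C * Mk k)) := by simp only [ha, hMs]
    rw [e]
    have hinc : 8 * Rk k ≤ 10 * (Rk k - Rk (k + 1)) := by rw [hRs]; nlinarith
    have hp1 := hRkp (k + 1)
    refine Dat.cover hD (r := Rk k) (ρ := ρ) (hMkp k) h1 (by linarith) ?_ hρ (by linarith) ?_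
      (hMR k).ge ?_ ?_ (hUm k)
    · have := hD.hK
      nlinarith
    · have h3 := hMR k
      have h4 : Rk k ^ 2 ≤ ρ ^ 2 := by gcongr; linarith
      have h5 : Mk k * Rk k ^ 2 ≤ Mk k * ρ ^ 2 := by have := hMkp k; gcongr
      linarith
    · rintro z ⟨⟨hz1, hz2⟩, hz3⟩
      rw [mem_ball_zero_iff] at hz2
      have := hz1.1
      refine ⟨hz3, by nlinarith, hz1.2, by linarith⟩
    · rintro z ⟨⟨hz1, hz2⟩, hz3⟩ w hw1 hw2 hw3
      rw [mem_ball_zero_iff] at hz2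
      have := hz1.1
      refine ⟨⟨by nlinarith, hw2⟩, ?_⟩
      rw [mem_ball_zero_iff]
      have h9 := norm_le_norm_sub_add w.2 z.2
      linarith
  have hAm : ∀ M, MeasurableSet (D.A M) := fun M => (Dat.A_closed hD M).measurableSet
  have hsplit : ∀ k, volume ((U k ∩ D.A (Mk (k + 1))) \ D.A (Mk k)) + a (k + 1) ≤ a k := by
    intro k
    rw [ha]
    have hmono : D.A (Mk k) ⊆ D.A (Mk (k + 1)) := Dat.A_mono (by
      rw [hMs]; have := hMkp k; nlinarith)
    rw [← measure_union (by
      rw [Set.disjoint_left]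
      rintro w ⟨⟨_, h1⟩, _⟩ ⟨_, h2⟩
      exact h2 h1) ((hUm _).diff (hAm _))]
    refine measure_mono ?_
    rintro w (⟨⟨h1, h2⟩, h3⟩ | ⟨h1, h2⟩)
    · exact ⟨h1, h3⟩
    · exact ⟨hUs k h1, fun h => h2 (hmono h)⟩
  have hrec : ∀ k, (a (k + 1)).toReal ≤ C1 * ((a k).toReal - (a (k + 1)).toReal) + C2 * (C⁻¹) ^ k := by
    intro k
    set b := volume ((U k ∩ D.A (Mk (k + 1))) \ D.A (Mk k)) with hb
    have hbtop : b ≠ ⊤ := ((le_self_add.trans (hsplit k)).trans_lt (hatop k).lt_top).ne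
    have h1 : b.toReal + (a (k + 1)).toReal ≤ (a k).toReal := by
      rw [← ENNReal.toReal_add hbtop (hatop _)]
      exact ENNReal.toReal_mono (hatop k) (hsplit k)
    have h2 := hstep k
    rw [← hb, ← ENNReal.ofReal_toReal hbtop, ← ENNReal.ofReal_mul (by positivity),
      ← ENNReal.ofReal_add (by positivity) (by have := hMkp k; positivity),
      ← ENNReal.ofReal_mul (by positivity)] at h2
    have h3 := ENNReal.toReal_le_of_le_ofReal (by have := hMkp k; positivity) h2
    refine h3.trans ?_
    have h4 : (c5 d D.δ * Mk k ^ (d + 1))⁻¹ ≤ (c5 d D.δ)⁻¹ * (C⁻¹) ^ k := by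
      rw [mul_inv, inv_pow]
      have h5 : C ^ k ≤ Mk k ^ (d + 1) := by
        have h6 : 1 ≤ C ^ k := one_le_pow₀ (by linarith)
        calc C ^ k ≤ Mk k := hMk1 k
          _ ≤ Mk k ^ (d + 1) := le_self_pow₀ (h6.trans (hMk1 k)) (by omega)
      gcongr
    calc _ ≤ cK d * ((th d D.δ D.K (bC0 d D.δ D.K))⁻¹ * ((a k).toReal - (a (k + 1)).toReal) +
          (c5 d D.δ)⁻¹ * (C⁻¹) ^ k) := by gcongr; linarith
      _ = _ := by rw [hC1, hC2]; ring
  intro k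
  have hfin := rec_bound hC1p hC2p.le (by positivity : 0 ≤ V) (by positivity : 0 ≤ C⁻¹)
    (by rw [one_div]; gcongr; linarith) (x := fun k => (a k).toReal)
    (ENNReal.toReal_le_of_le_ofReal (by positivity) (haV 0)) hrec k
  rw [← ENNReal.le_ofReal_iff_toReal_le (hatop k) (by positivity)] at hfin
  refine le_trans (measure_mono ?_) hfin
  refine diff_subset_diff_left ?_
  have := hRkp k
  exact prod_mono (Ioo_subset_Ioo_left (by linarith)) (Metric.closedBall_subset_ball (by linarith))

end PGE

namespace PGE

variable {d : ℕ}

theorem pow_diff_le (d : ℕ) {R ρ : ℝ} (hR0 : 1 / 2 ≤ R) (hR1 : R ≤ 1) (hρ : 0 ≤ ρ) (hρ1 : ρ ≤ 1 / 4) :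
    R ^ d - (R - 2 * ρ) ^ d ≤ 4 * d * ρ := by
  have h1 : 1 + (d : ℝ) * (-(2 * ρ / R)) ≤ (1 + -(2 * ρ / R)) ^ d :=
    one_add_mul_le_pow (by
      have : 2 * ρ / R ≤ 1 := by rw [div_le_one (by linarith)]; linarith
      linarith) d
  have h2 : (R - 2 * ρ) ^ d = R ^ d * (1 + -(2 * ρ / R)) ^ d := by
    rw [← mul_pow]; congr 1; field_simp; ring
  have h3 : R ^ d ≤ 1 := pow_le_one₀ (by linarith) hR1
  have h4 : 0 < R ^ d := by positivity
  have h5 : 2 * ρ / R ≤ 4 * ρ := by rw [div_le_iff₀ (by linarith)]; nlinarith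
  have h6 : 0 ≤ 2 * ρ / R := by positivity
  rw [h2]
  have h7 : R ^ d * (1 + (d : ℝ) * (-(2 * ρ / R))) ≤ R ^ d * (1 + -(2 * ρ / R)) ^ d := by gcongr
  have h8 : R ^ d * ((d : ℝ) * (2 * ρ / R)) ≤ 1 * ((d : ℝ) * (4 * ρ)) := by gcongr
  linarith

/-- the estimation region -/
def Dat.G (D : Dat d) : Set (ℝ × Sp d) := Ioo (D.T0 + 1 / 2) D.T1 ×ˢ Metric.ball (0 : Sp d) D.R

theorem Dat.decay2 {δ K : ℝ} (hδ0 : 0 < δ) (hδ1 : δ < 1) (hK : 0 ≤ K) :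
    ∃ B q H : ℝ, 0 < B ∧ 0 < q ∧ q < 1 ∧ 0 < H ∧ ∀ D : Dat d, D.Ok → D.δ = δ → D.K = K → ∀ j : ℕ,
      volume (D.G ∩ {z | H * (CC d δ K ^ 2) ^ j < ‖D.J.g z‖}) ≤ ENNReal.ofReal (B * q ^ j) := by
  obtain ⟨B, q, hB, hq0, hq1, hdec⟩ := Dat.decay (d := d) hδ0 hδ1 hK
  have hcd := cd_pos d
  have hCC := CC_ge (d := d) hδ0 hK
  set C := CC d δ K with hC
  set κ := (Real.sqrt C)⁻¹ with hκ
  have hsq5 : 5 ≤ Real.sqrt C := Real.le_sqrt_of_sq_le (by linarith)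
  have hκ0 : 0 < κ := by positivity
  have hκ5 : κ ≤ 1 / 5 := by rw [hκ, one_div]; gcongr
  have hκC : κ ^ 2 * C = 1 := by
    rw [hκ, inv_pow, Real.sq_sqrt (by linarith)]; field_simp
  have hc1 : 0 < c1 δ K := by unfold c1; positivity
  have hc1u : c1 δ K * (K + 1) ≤ δ / 160 := by unfold c1; field_simp; linarith
  have hc1v : c1 δ K ≤ 1 / 160 := by nlinarith
  have hc4 := c4_pos (d := d) hδ0
  have hL : 2 ≤ Lam d δ := by unfold Lam; have : 0 < 1 / c4 d δ := by positivity
                              linarith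
  refine ⟨B + 2 * (4 ^ (d + 1) * cd d * d), max q κ, 48 * Lam d δ / c1 δ K ^ 2, by positivity,
    lt_max_of_lt_left hq0, max_lt hq1 (by linarith), by positivity, ?_⟩
  intro D hD e1 e2 j
  set ρ := 1 / 4 * κ ^ j with hρ
  have hρ0 : 0 < ρ := by positivity
  have hρ1 : ρ ≤ 1 / 4 := by
    have : κ ^ j ≤ 1 := pow_le_one₀ hκ0.le (by linarith)
    linarith
  set M := Lam d δ / (c1 δ K * ρ) ^ 2 * C ^ j with hM
  have hR0 := hD.hR0
  have hMe : 3 * M = 48 * Lam d δ / c1 δ K ^ 2 * (C ^ 2) ^ j := by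
    have h1 : (κ ^ j) ^ 2 * C ^ j = 1 := by
      rw [← pow_mul, mul_comm j 2, pow_mul, ← mul_pow, hκC, one_pow]
    have h2 : (C ^ 2) ^ j = C ^ j * C ^ j := by rw [← mul_pow, sq]
    rw [hM, hρ, h2]
    have h3 : C ^ j = ((κ ^ j) ^ 2)⁻¹ := by
      rw [eq_comm, inv_eq_iff_eq_inv]; exact eq_inv_of_mul_eq_one_left h1
    rw [h3]
    field_simp
    norm_num
  have hMρ : 1 ≤ M * ρ ^ 2 := by
    have h1 : M * ρ ^ 2 = Lam d δ / c1 δ K ^ 2 * C ^ j := by rw [hM]; field_simp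
    rw [h1]
    have h2 : 1 ≤ C ^ j := one_le_pow₀ (by linarith)
    have h3 : 1 ≤ Lam d δ / c1 δ K ^ 2 := by rw [one_le_div (by positivity)]; nlinarith
    nlinarith
  have hsub : D.G ∩ {z | 48 * Lam d δ / c1 δ K ^ 2 * (C ^ 2) ^ j < ‖D.J.g z‖} ⊆
      ((Ioo (D.T0 + 1 / 2) D.T1 ×ˢ Metric.closedBall (0 : Sp d) (D.R - 2 * ρ)) \ D.A M) ∪
      (Zc D.T0 D.T1 0 D.R \ Zc D.T0 D.T1 0 (D.R - 2 * ρ)) := by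
    rintro z ⟨⟨hz1, hz2⟩, hz3⟩
    have hz1' := hz1.1
    have hz1'' := hz1.2
    have hOm : z ∈ Zc D.T0 D.T1 0 D.R :=
      ⟨⟨by linarith, hz1.2.le⟩, Metric.ball_subset_closedBall hz2⟩
    by_cases hzr : z.2 ∈ Metric.closedBall (0 : Sp d) (D.R - 2 * ρ)
    · left
      refine ⟨⟨hz1, hzr⟩, fun hA => ?_⟩
      rw [mem_closedBall_zero_iff] at hzr
      have := Dat.grad_le hD hA hOm hz1.2 hρ0 (by linarith) (by linarith) hMρ
      rw [hMe] at this
      exact absurd hz3 (not_lt.2 this)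
    · right
      exact ⟨hOm, fun h => hzr h.2⟩
  refine (measure_mono hsub).trans ((measure_union_le _ _).trans ?_)
  have hlay : volume (Zc D.T0 D.T1 (0 : Sp d) D.R \ Zc D.T0 D.T1 0 (D.R - 2 * ρ)) ≤
      ENNReal.ofReal (2 * (4 ^ (d + 1) * cd d * d) * κ ^ j) := by
    rcases le_or_gt D.T0 D.T1 with hTT | hTT
    swap
    · simp [Zc, Icc_eq_empty (not_le.2 hTT)]
    have hTT2 := hD.hT
    have hs1 : Zc D.T0 D.T1 (0 : Sp d) (D.R - 2 * ρ) ⊆ Zc D.T0 D.T1 0 D.R :=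
      prod_mono le_rfl (Metric.closedBall_subset_closedBall (by linarith))
    have hs2 : MeasurableSet (Zc D.T0 D.T1 (0 : Sp d) (D.R - 2 * ρ)) :=
      measurableSet_Icc.prod Metric.isClosed_closedBall.measurableSet
    have hs3 : volume (Zc D.T0 D.T1 (0 : Sp d) (D.R - 2 * ρ)) ≠ ⊤ := by
      rw [Zc_vol hTT (by linarith)]; exact ENNReal.ofReal_ne_top
    rw [measure_diff hs1 hs2.nullMeasurableSet hs3, Zc_vol hTT (by linarith),
        Zc_vol hTT (by linarith), ← ENNReal.ofReal_sub _ (by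
          have : 0 ≤ D.R - 2 * ρ := by linarith
          have : 0 ≤ D.T1 - D.T0 := by linarith
          positivity)]
    refine ENNReal.ofReal_le_ofReal ?_
    have h1 := pow_diff_le d hD.hR0 hD.hR1 hρ0.le hρ1
    have h2 : 0 ≤ D.R ^ d - (D.R - 2 * ρ) ^ d := by
      rw [sub_nonneg]; gcongr <;> linarith
    calc (D.T1 - D.T0) * (4 ^ (d + 1) * cd d * D.R ^ d) -
          (D.T1 - D.T0) * (4 ^ (d + 1) * cd d * (D.R - 2 * ρ) ^ d) =
          (D.T1 - D.T0) * (4 ^ (d + 1) * cd d * (D.R ^ d - (D.R - 2 * ρ) ^ d)) := by ring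
      _ ≤ 2 * (4 ^ (d + 1) * cd d * (4 * d * ρ)) := by gcongr
      _ = _ := by rw [hρ]; ring
  refine (add_le_add (hdec D hD e1 e2 ρ hρ0 hρ1 j) hlay).trans ?_
  rw [← ENNReal.ofReal_add (by positivity) (by positivity)]
  refine ENNReal.ofReal_le_ofReal ?_
  have h1 : q ^ j ≤ max q κ ^ j := by gcongr; exact le_max_left _ _
  have h2 : κ ^ j ≤ max q κ ^ j := by gcongr; exact le_max_right _ _
  have h3 : B * q ^ j ≤ B * max q κ ^ j := by gcongr
  have h4 : 2 * (4 ^ (d + 1) * cd d * d) * κ ^ j ≤ 2 * (4 ^ (d + 1) * cd d * d) * max q κ ^ j := by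
    gcongr
  linarith

theorem layer {α : Type*} [MeasurableSpace α] (μ : Measure α) {p : α → ℝ} (hp : Measurable p)
    {H A γ : ℝ} (hH : 0 < H) (hA : 1 < A) (hγ : 0 < γ) :
    ∫⁻ z, ENNReal.ofReal (p z) ^ γ ∂μ ≤ ENNReal.ofReal H ^ γ *
      (μ univ + ∑' j : ℕ, ENNReal.ofReal (A ^ (j + 1)) ^ γ * μ {z | H * A ^ j < p z}) := by
  have hm : ∀ j : ℕ, MeasurableSet {z | H * A ^ j < p z} := fun j => measurableSet_lt measurable_const hp
  have hpt : ∀ z, ENNReal.ofReal (p z) ^ γ ≤ ENNReal.ofReal H ^ γ *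
      (1 + ∑' j : ℕ, ENNReal.ofReal (A ^ (j + 1)) ^ γ * ({z | H * A ^ j < p z}.indicator 1 z)) := by
    intro z
    by_cases h : p z ≤ H
    · calc ENNReal.ofReal (p z) ^ γ ≤ ENNReal.ofReal H ^ γ * 1 := by
            rw [mul_one]; gcongr
        _ ≤ _ := by gcongr; exact le_self_add
    push Not at h
    have hex : ∃ n : ℕ, p z ≤ H * A ^ n := by
      obtain ⟨n, hn⟩ := pow_unbounded_of_one_lt (p z / H) hA
      refine ⟨n, ?_⟩
      rw [div_lt_iff₀ hH] at hn
      linarith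
    classical
    obtain ⟨j, hj⟩ : ∃ j, Nat.find hex = j + 1 := by
      refine Nat.exists_eq_succ_of_ne_zero fun h0 => ?_
      have := Nat.find_spec hex
      rw [h0] at this
      simp at this
      linarith
    have h1 : p z ≤ H * A ^ (j + 1) := by have := Nat.find_spec hex; rwa [hj] at this
    have h2 : H * A ^ j < p z := not_le.1 (Nat.find_min hex (by omega))
    calc ENNReal.ofReal (p z) ^ γ ≤ ENNReal.ofReal (H * A ^ (j + 1)) ^ γ := by gcongr
      _ = ENNReal.ofReal H ^ γ * (ENNReal.ofReal (A ^ (j + 1)) ^ γ *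
          ({z | H * A ^ j < p z}.indicator 1 z)) := by
          rw [indicator_of_mem (by exact h2), Pi.one_apply, mul_one, ENNReal.ofReal_mul hH.le,
            ENNReal.mul_rpow_of_nonneg _ _ hγ.le]
      _ ≤ ENNReal.ofReal H ^ γ * (∑' j : ℕ, ENNReal.ofReal (A ^ (j + 1)) ^ γ *
          ({z | H * A ^ j < p z}.indicator 1 z)) := by
          gcongr
          exact ENNReal.le_tsum (f := fun j : ℕ => ENNReal.ofReal (A ^ (j + 1)) ^ γ *
          ({z | H * A ^ j < p z}.indicator 1 z)) j
      _ ≤ _ := by gcongr; exact le_add_self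
  refine (lintegral_mono hpt).trans ?_
  have hm1 : ∀ j : ℕ, Measurable fun z => ENNReal.ofReal (A ^ (j + 1)) ^ γ *
      ({z | H * A ^ j < p z}.indicator (1 : α → ℝ≥0∞) z) := fun j =>
    (measurable_one.indicator (hm j)).const_mul _
  have hm2 : Measurable fun z => 1 + ∑' j : ℕ, ENNReal.ofReal (A ^ (j + 1)) ^ γ *
      ({z | H * A ^ j < p z}.indicator (1 : α → ℝ≥0∞) z) :=
    measurable_const.add (Measurable.tsum hm1)
  rw [lintegral_const_mul _ hm2, lintegral_add_left measurable_const, lintegral_tsum fun j => (hm1 j).aemeasurable]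
  simp only [lintegral_const, one_mul]
  gcongr with j
  rw [lintegral_const_mul _ (measurable_one.indicator (hm j)), lintegral_indicator_one (hm j)]

theorem Dat.grad_int {δ K : ℝ} (hδ0 : 0 < δ) (hδ1 : δ < 1) (hK : 0 ≤ K) :
    ∃ γ N : ℝ, 0 < γ ∧ γ ≤ 1 ∧ 0 < N ∧ ∀ D : Dat d, D.Ok → D.δ = δ → D.K = K →
      ∫⁻ z in D.G, ENNReal.ofReal ‖D.J.g z‖ ^ γ ≤ ENNReal.ofReal N := by
  obtain ⟨B, q, H, hB, hq0, hq1, hH, hdec⟩ := Dat.decay2 (d := d) hδ0 hδ1 hK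
  have hCC := CC_ge (d := d) hδ0 hK
  have hcd := cd_pos d
  set A := CC d δ K ^ 2 with hA
  have hA1 : 1 < A := by rw [hA]; nlinarith
  have hlA : 0 < Real.log A := Real.log_pos hA1
  have hlq : 0 < -Real.log q := by have := Real.log_neg hq0 hq1; linarith
  set γ := min 1 (-Real.log q / (2 * Real.log A)) with hγ
  have hγ0 : 0 < γ := lt_min one_pos (by positivity)
  have hγ1 : γ ≤ 1 := min_le_left _ _
  set q' := A ^ γ * q with hq'
  have hq'0 : 0 < q' := by positivity
  have hq'1 : q' < 1 := by
    rw [← Real.log_neg_iff hq'0, hq', Real.log_mul (by positivity) hq0.ne',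
      Real.log_rpow (by linarith)]
    have h1 : γ ≤ -Real.log q / (2 * Real.log A) := min_le_right _ _
    rw [le_div_iff₀ (by positivity)] at h1
    linarith
  set V := 2 * (4 ^ (d + 1) * cd d) with hV
  have hAγ : A ^ γ ≤ A := by
    calc A ^ γ ≤ A ^ (1 : ℝ) := Real.rpow_le_rpow_of_exponent_le hA1.le hγ1
      _ = A := Real.rpow_one A
  have hs : 0 < 1 - q' := by linarith
  refine ⟨γ, H ^ γ * (V + A * B * (1 - q')⁻¹), hγ0, hγ1, by positivity, ?_⟩
  intro D hD e1 e2
  have hgm : Measurable fun z => ‖D.J.g z‖ := (hD.ok.cg.norm).measurable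
  refine (layer _ hgm hH hA1 hγ0).trans ?_
  have hGm : MeasurableSet D.G := measurableSet_Ioo.prod measurableSet_ball
  rw [ENNReal.ofReal_mul (by positivity), ENNReal.ofReal_rpow_of_pos hH,
    ENNReal.ofReal_add (by positivity) (by positivity)]
  gcongr
  · rw [Measure.restrict_apply MeasurableSet.univ, univ_inter]
    refine (measure_mono ?_).trans (Om_vol hD)
    rintro z ⟨h1, h2⟩
    have := h1.1
    exact ⟨⟨by linarith, h1.2.le⟩, Metric.ball_subset_closedBall h2⟩
  · calc ∑' j : ℕ, ENNReal.ofReal (A ^ (j + 1)) ^ γ *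
          (volume.restrict D.G) {z | H * A ^ j < ‖D.J.g z‖}
        ≤ ∑' j : ℕ, ENNReal.ofReal (A * B * q' ^ j) := by
          refine ENNReal.tsum_le_tsum fun j => ?_
          rw [Measure.restrict_apply (measurableSet_lt measurable_const hgm), inter_comm,
            ENNReal.ofReal_rpow_of_pos (by positivity)]
          refine (mul_le_mul_right (hdec D hD e1 e2 j) _).trans ?_
          rw [← ENNReal.ofReal_mul (by positivity)]
          refine ENNReal.ofReal_le_ofReal ?_
          have h1 : (A ^ (j + 1)) ^ γ = (A ^ γ) ^ (j + 1) := by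
            rw [← Real.rpow_natCast, ← Real.rpow_mul (by positivity), mul_comm,
              Real.rpow_mul (by positivity), Real.rpow_natCast]
          rw [h1, hq', mul_pow, pow_succ]
          have h2 : 0 ≤ (A ^ γ) ^ j * q ^ j * B := by positivity
          nlinarith
      _ = ENNReal.ofReal (A * B * (1 - q')⁻¹) := by
          rw [← ENNReal.ofReal_tsum_of_nonneg (fun j => by positivity)
            ((summable_geometric_of_lt_one hq'0.le hq'1).mul_left _), tsum_mul_left,
            tsum_geometric_of_lt_one hq'0.le hq'1]
      _ ≤ _ := le_rfl

end PGE

namespace PGE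

variable {d : ℕ}

theorem smul_op (a : Matrix (Fin d) (Fin d) ℝ) (b : Sp d) (J : Jet d) (s : ℝ) (z : ℝ × Sp d) :
    (J.smul s).t z + ip a ((J.smul s).H z) + inner ℝ b ((J.smul s).g z) =
      s * (J.t z + ip a (J.H z) + inner ℝ b (J.g z)) := by
  have h1 : (J.smul s).H z = s • J.H z := rfl
  have h2 : (J.smul s).g z = s • J.g z := rfl
  have h3 : (J.smul s).t z = s * J.t z := rfl
  rw [h1, h2, h3, ip_smul, inner_smul_right]
  ring

/-- scaling of an integral of a power of the gradient. -/
theorem grad_scale (S : Set (ℝ × Sp d)) (g : ℝ × Sp d → Sp d) {A γ : ℝ} (hA : 0 < A) (hγ : 0 < γ) :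
    ∫⁻ z in S, ENNReal.ofReal ‖g z‖ ^ γ =
      ENNReal.ofReal (A ^ γ) * ∫⁻ z in S, ENNReal.ofReal ‖A⁻¹ • g z‖ ^ γ := by
  rw [← lintegral_const_mul' _ _ ENNReal.ofReal_ne_top]
  refine lintegral_congr fun z => ?_
  rw [← ENNReal.ofReal_rpow_of_pos hA, ← ENNReal.mul_rpow_of_nonneg _ _ hγ.le,
    ← ENNReal.ofReal_mul hA.le, norm_smul, Real.norm_of_nonneg (by positivity : 0 ≤ A⁻¹)]
  congr 2
  field_simp

theorem smooth1 {δ K : ℝ} (hδ0 : 0 < δ) (hδ1 : δ < 1) (hK : 0 ≤ K) :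
    ∃ γ N : ℝ, 0 < γ ∧ γ ≤ 1 ∧ 0 < N ∧ ∀ (J : Jet d) (a : ℝ × Sp d → Matrix (Fin d) (Fin d) ℝ)
      (b : ℝ × Sp d → Sp d) (c f : ℝ × Sp d → ℝ) (T0 T1 R : ℝ), J.Ok → (∀ z, Ell δ (a z)) →
      (∀ z, ‖b z‖ ≤ K) → (∀ z, 0 ≤ c z) → (∀ z, c z ≤ K) → (∀ z, 0 ≤ f z) →
      1 / 2 ≤ R → R ≤ 1 → T1 - T0 ≤ 2 → 
      (∀ z ∈ Zc T0 T1 0 R,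
        |J.t z + ip (a z) (J.H z) + inner ℝ (b z) (J.g z) - c z * J.v z| ≤ f z) →
      (∫⁻ z in Zc T0 T1 (0 : Sp d) R, ENNReal.ofReal (f z) ^ (d + 1) ≤ 1) →
      (∀ z ∈ Zc T0 T1 0 R, (z.1 = T1 ∨ ‖z.2‖ = R) → |J.v z| ≤ 1) →
      ∫⁻ z in Ioo (T0 + 1 / 2) T1 ×ˢ Metric.ball (0 : Sp d) R, ENNReal.ofReal ‖J.g z‖ ^ γ
        ≤ ENNReal.ofReal N := by
  obtain ⟨γ, N, hγ0, hγ1, hN, hmain⟩ := Dat.grad_int (d := d) hδ0 hδ1 hK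
  have hN0 := N0_ge (d := d) (K := K) hδ0
  have hcd := cd_pos d
  set n0 := N0 d δ K with hn0
  set V : ℝ := 2 * (4 ^ (d + 1) * cd d) with hV
  set X : ℝ := 2 ^ (d + 1) * (1 + (K * n0) ^ (d + 1) * V) with hX
  have hV0 : 0 < V := by positivity
  have hn00 : 0 < n0 := by linarith
  have hX0 : 0 ≤ X := by positivity
  set A := n0 + X with hA
  have hA0 : 0 < A := by positivity
  have hA1 : 1 ≤ A := by linarith
  refine ⟨γ, A ^ γ * N, hγ0, hγ1, by positivity, ?_⟩
  intro J a b c f T0 T1 R hJ ha hb hc hcK hf hR0 hR1 hT hL hF hbd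
  have hlow : ∀ z ∈ Zc T0 T1 (0 : Sp d) R, -n0 ≤ J.v z := fun z hz =>
    global_abp hδ0 hδ1 hK hJ hR0 hR1 ha hb hc hf (fun w hw => (abs_le.1 (hL w hw)).2) hF hT
      (fun w hw h => (abs_le.1 (hbd w hw (by simpa using h))).1) hz
  have hup : ∀ z ∈ Zc T0 T1 (0 : Sp d) R, J.v z ≤ n0 := by
    intro z hz
    have := global_abp (J := J.smul (-1)) hδ0 hδ1 hK (hJ.smul (-1)) hR0 hR1 ha hb hc hf
      (fun w hw => by
        rw [smul_op]
        have h1 := (abs_le.1 (hL w hw)).1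
        have h2 : (J.smul (-1)).v w = -1 * J.v w := rfl
        rw [h2]
        linarith) hF hT
      (fun w hw h => by
        have h1 := (abs_le.1 (hbd w hw (by simpa using h))).2
        have h2 : (J.smul (-1)).v w = -1 * J.v w := rfl
        rw [h2]; linarith) hz
    have h2 : (J.smul (-1)).v z = -1 * J.v z := rfl
    rw [h2] at this
    linarith
  have hvol : volume (Zc T0 T1 (0 : Sp d) R) ≤ ENNReal.ofReal V := by
    rcases le_or_gt T0 T1 with h | h
    · rw [Zc_vol h (by linarith)]
      refine ENNReal.ofReal_le_ofReal ?_
      have h3 : R ^ d ≤ 1 := pow_le_one₀ (by linarith) hR1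
      have h4 : 0 ≤ R ^ d := pow_nonneg (by linarith) _
      calc (T1 - T0) * (4 ^ (d + 1) * cd d * R ^ d) ≤ 2 * (4 ^ (d + 1) * cd d * 1) := by gcongr
        _ = V := by rw [hV]; ring
    · have : Zc T0 T1 (0 : Sp d) R = ∅ := by simp [Zc, Icc_eq_empty (not_le.2 h)]
      rw [this]; simp
  let D : Dat d := ⟨δ, K, J.smul A⁻¹, a, b, fun z => A⁻¹ * (f z + K * n0), T0, T1, R⟩
  have hD : D.Ok := by
    refine ⟨hδ0, hδ1, hK, hJ.smul _, ha, hb, fun z => ?_, ?_, ?_, ?_, hR0, hR1, hT⟩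
    · have := hf z
      change 0 ≤ A⁻¹ * (f z + K * n0)
      positivity
    · intro z hz
      change (J.smul A⁻¹).t z + ip (a z) ((J.smul A⁻¹).H z) + inner ℝ (b z) ((J.smul A⁻¹).g z)
        ≤ A⁻¹ * (f z + K * n0)
      rw [smul_op]
      refine mul_le_mul_of_nonneg_left ?_ (by positivity)
      have h1 := (abs_le.1 (hL z hz)).2
      have h2 : c z * J.v z ≤ K * n0 :=
        (mul_le_mul_of_nonneg_left (hup z hz) (hc z)).trans
          (mul_le_mul_of_nonneg_right (hcK z) hn00.le)
      linarith
    · intro z hz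
      change |A⁻¹ * J.v z| ≤ 1
      rw [abs_mul, abs_of_pos (by positivity), inv_mul_le_one₀ hA0]
      exact abs_le.2 ⟨by linarith [hlow z hz], by linarith [hup z hz]⟩
    · change ∫⁻ z in Zc T0 T1 (0 : Sp d) R, ENNReal.ofReal (A⁻¹ * (f z + K * n0)) ^ (d + 1) ≤ 1
      have hpt : ∀ z, ENNReal.ofReal (A⁻¹ * (f z + K * n0)) ^ (d + 1) ≤
          ENNReal.ofReal (A⁻¹ ^ (d + 1) * 2 ^ (d + 1)) * (ENNReal.ofReal (f z) ^ (d + 1) +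
            ENNReal.ofReal ((K * n0) ^ (d + 1))) := by
        intro z
        have h0 := hf z
        rw [← ENNReal.ofReal_pow h0, ← ENNReal.ofReal_add (by positivity) (by positivity),
          ← ENNReal.ofReal_mul (by positivity), ← ENNReal.ofReal_pow (by positivity)]
        refine ENNReal.ofReal_le_ofReal ?_
        rw [mul_pow, mul_assoc]
        exact mul_le_mul_of_nonneg_left (add_pow_le2 h0 (by positivity) _) (by positivity)
      refine (lintegral_mono hpt).trans ?_
      rw [lintegral_const_mul' _ _ ENNReal.ofReal_ne_top, lintegral_add_right _ measurable_const,
        lintegral_const, Measure.restrict_apply_univ]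
      calc _ ≤ ENNReal.ofReal (A⁻¹ ^ (d + 1) * 2 ^ (d + 1)) *
            (ENNReal.ofReal 1 + ENNReal.ofReal ((K * n0) ^ (d + 1)) * ENNReal.ofReal V) := by
            rw [ENNReal.ofReal_one]; gcongr
        _ = ENNReal.ofReal (A⁻¹ ^ (d + 1) * X) := by
            rw [← ENNReal.ofReal_mul (by positivity), ← ENNReal.ofReal_add (by positivity)
              (by positivity), ← ENNReal.ofReal_mul (by positivity), hX]
            congr 1; ring
        _ ≤ 1 := by
            rw [← ENNReal.ofReal_one]
            refine ENNReal.ofReal_le_ofReal ?_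
            rw [inv_pow, inv_mul_le_one₀ (by positivity)]
            calc X ≤ A := by linarith
              _ ≤ A ^ (d + 1) := le_self_pow₀ hA1 (by omega)
  have h := hmain D hD rfl rfl
  rw [grad_scale _ _ hA0 hγ0, ENNReal.ofReal_mul (by positivity)]
  exact mul_le_mul_right h _

theorem smoothA {δ K : ℝ} (hδ0 : 0 < δ) (hδ1 : δ < 1) (hK : 0 ≤ K) :
    ∃ γ N : ℝ, 0 < γ ∧ γ ≤ 1 ∧ 0 < N ∧ ∀ (J : Jet d) (a : ℝ × Sp d → Matrix (Fin d) (Fin d) ℝ)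
      (b : ℝ × Sp d → Sp d) (c : ℝ × Sp d → ℝ) (T0 T1 R A : ℝ), J.Ok → (∀ z, Ell δ (a z)) →
      (∀ z, ‖b z‖ ≤ K) → (∀ z, 0 ≤ c z) → (∀ z, c z ≤ K) → 0 < A →
      1 / 2 ≤ R → R ≤ 1 → T1 - T0 ≤ 2 → 
      (∫⁻ z in Zc T0 T1 (0 : Sp d) R, ENNReal.ofReal
        |J.t z + ip (a z) (J.H z) + inner ℝ (b z) (J.g z) - c z * J.v z| ^ (d + 1)
          ≤ ENNReal.ofReal A ^ (d + 1)) →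
      (∀ z ∈ Zc T0 T1 0 R, (z.1 = T1 ∨ ‖z.2‖ = R) → |J.v z| ≤ A) →
      ∫⁻ z in Ioo (T0 + 1 / 2) T1 ×ˢ Metric.ball (0 : Sp d) R, ENNReal.ofReal ‖J.g z‖ ^ γ
        ≤ ENNReal.ofReal (N * A ^ γ) := by
  obtain ⟨γ, N, hγ0, hγ1, hN, hmain⟩ := smooth1 (d := d) hδ0 hδ1 hK
  refine ⟨γ, N, hγ0, hγ1, hN, ?_⟩
  intro J a b c T0 T1 R A hJ ha hb hc hcK hA hR0 hR1 hT hF hbd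
  have h := hmain (J.smul A⁻¹) a b c (fun z => A⁻¹ *
    |J.t z + ip (a z) (J.H z) + inner ℝ (b z) (J.g z) - c z * J.v z|) T0 T1 R (hJ.smul _) ha hb hc hcK
    (fun z => by positivity) hR0 hR1 hT
    (fun z hz => by
      rw [smul_op]
      have h2 : (J.smul A⁻¹).v z = A⁻¹ * J.v z := rfl
      rw [h2, ← abs_of_pos (inv_pos.2 hA), ← abs_mul, abs_of_pos (inv_pos.2 hA)]
      apply le_of_eq
      congr 1
      ring)
    (by
      have hi : ∀ x : ℝ, ENNReal.ofReal (A⁻¹ * x) ^ (d + 1) =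
          ENNReal.ofReal A⁻¹ ^ (d + 1) * ENNReal.ofReal x ^ (d + 1) := by
        intro x
        rw [ENNReal.ofReal_mul (by positivity), mul_pow]
      simp only [hi]
      rw [lintegral_const_mul' _ _ (by finiteness)]
      refine (mul_le_mul_right hF _).trans ?_
      rw [← mul_pow, ← ENNReal.ofReal_mul (by positivity), inv_mul_cancel₀ hA.ne']
      simp)
    (fun z hz h => by
      have h2 : (J.smul A⁻¹).v z = A⁻¹ * J.v z := rfl
      rw [h2, abs_mul, abs_of_pos (by positivity), inv_mul_le_one₀ hA]
      exact hbd z hz h)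
  rw [grad_scale _ _ hA hγ0, mul_comm N, ENNReal.ofReal_mul (by positivity)]
  exact mul_le_mul_right h _

end PGE

namespace PGE

variable {d : ℕ}

open scoped Convolution

/-- mollification -/
def mol (φ : ContDiffBump (0 : ℝ × Sp d)) (g : ℝ × Sp d → ℝ) : ℝ × Sp d → ℝ :=
  φ.normed volume ⋆[ContinuousLinearMap.lsmul ℝ ℝ, volume] g

theorem mol_eq (φ : ContDiffBump (0 : ℝ × Sp d)) (g : ℝ × Sp d → ℝ) (z : ℝ × Sp d) :
    mol φ g z = ∫ y, φ.normed volume (z - y) * g y := by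
  rw [mol, convolution_lsmul_swap]
  rfl

theorem mol_integrable (φ : ContDiffBump (0 : ℝ × Sp d)) {g : ℝ × Sp d → ℝ}
    (hg : LocallyIntegrable g) (z : ℝ × Sp d) :
    Integrable fun y => φ.normed volume (z - y) * g y :=
  (φ.hasCompactSupport_normed.convolutionExists_left (ContinuousLinearMap.lsmul ℝ ℝ)
    φ.continuous_normed hg z).integrable_swap

theorem mol_contDiff (φ : ContDiffBump (0 : ℝ × Sp d)) {g : ℝ × Sp d → ℝ}
    (hg : LocallyIntegrable g) (n : ℕ∞) : ContDiff ℝ n (mol φ g) :=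
  φ.hasCompactSupport_normed.contDiff_convolution_left _ φ.contDiff_normed hg

theorem mol_mono (φ : ContDiffBump (0 : ℝ × Sp d)) {g h : ℝ × Sp d → ℝ}
    (hg : LocallyIntegrable g) (hh : LocallyIntegrable h) (hgh : ∀ z, g z ≤ h z) (z : ℝ × Sp d) :
    mol φ g z ≤ mol φ h z := by
  rw [mol_eq, mol_eq]
  refine integral_mono (mol_integrable φ hg z) (mol_integrable φ hh z) fun y => ?_
  exact mul_le_mul_of_nonneg_left (hgh y) (φ.nonneg_normed _)

theorem mol_nonneg (φ : ContDiffBump (0 : ℝ × Sp d)) {g : ℝ × Sp d → ℝ}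
    (hg : ∀ z, 0 ≤ g z) (z : ℝ × Sp d) : 0 ≤ mol φ g z := by
  rw [mol_eq]
  exact integral_nonneg fun y => mul_nonneg (φ.nonneg_normed _) (hg y)

theorem mol_integral_eq (φ : ContDiffBump (0 : ℝ × Sp d)) {g : ℝ × Sp d → ℝ}
    (hg : Integrable g) : ∫ z, mol φ g z = ∫ z, g z := by
  rw [mol, integral_convolution _ φ.integrable_normed hg, φ.integral_normed]
  simp

theorem mol_integrable' (φ : ContDiffBump (0 : ℝ × Sp d)) {g : ℝ × Sp d → ℝ}
    (hg : Integrable g) : Integrable (mol φ g) :=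
  φ.integrable_normed.integrable_convolution _ hg

theorem mol_lintegral (φ : ContDiffBump (0 : ℝ × Sp d)) {g : ℝ × Sp d → ℝ}
    (hg : Integrable g) (h0 : ∀ z, 0 ≤ g z) :
    ∫⁻ z, ENNReal.ofReal (mol φ g z) = ∫⁻ z, ENNReal.ofReal (g z) := by
  rw [← ofReal_integral_eq_lintegral_ofReal (mol_integrable' φ hg)
    (Filter.Eventually.of_forall (mol_nonneg φ h0)), mol_integral_eq φ hg,
    ofReal_integral_eq_lintegral_ofReal hg (Filter.Eventually.of_forall h0)]

theorem tangent_pow {x m : ℝ} (hx : 0 ≤ x) (hm : 0 ≤ m) (n : ℕ) :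
    m ^ (n + 1) + (n + 1) * m ^ n * (x - m) ≤ x ^ (n + 1) := by
  induction n with
  | zero => simp
  | succ n ih =>
    have h1 := mul_le_mul_of_nonneg_left ih hx
    have h2 : 0 ≤ (n + 1) * m ^ n * (x - m) ^ 2 := by positivity
    push_cast
    calc _ = x * (m ^ (n + 1) + (n + 1) * m ^ n * (x - m)) - (n + 1) * m ^ n * (x - m) ^ 2 := by ring
      _ ≤ x * (m ^ (n + 1) + (n + 1) * m ^ n * (x - m)) := by linarith
      _ ≤ x * x ^ (n + 1) := h1
      _ = _ := by ring

theorem mol_one (φ : ContDiffBump (0 : ℝ × Sp d)) (z : ℝ × Sp d) :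
    ∫ y, φ.normed volume (z - y) = 1 := by
  rw [integral_sub_left_eq_self (fun y => φ.normed volume y)]
  exact φ.integral_normed

/-- Jensen -/
theorem mol_jensen (φ : ContDiffBump (0 : ℝ × Sp d)) {g : ℝ × Sp d → ℝ}
    (hg : LocallyIntegrable g) (n : ℕ) (hgp : LocallyIntegrable fun z => |g z| ^ (n + 1)) (z : ℝ × Sp d) :
    |mol φ g z| ^ (n + 1) ≤ mol φ (fun z => |g z| ^ (n + 1)) z := by
  have hga : LocallyIntegrable fun z => |g z| := fun x => (hg x).norm
  set m := mol φ (fun z => |g z|) z with hm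
  have hm0 : 0 ≤ m := mol_nonneg φ (fun z => abs_nonneg _) z
  have h1 : |mol φ g z| ≤ m := by
    rw [hm, mol_eq, mol_eq]
    refine (abs_integral_le_integral_abs).trans (le_of_eq ?_)
    congr 1; ext y
    rw [abs_mul, abs_of_nonneg (φ.nonneg_normed _)]
  refine (pow_le_pow_left₀ (abs_nonneg _) h1 _).trans ?_
  have hi1 := mol_integrable φ hga z
  have hi2 := mol_integrable φ hgp z
  have hi0 : Integrable fun y => φ.normed volume (z - y) :=
    (φ.integrable_normed (μ := volume)).comp_sub_left z
  have h2 : ∫ y, (φ.normed volume (z - y) * m ^ (n + 1) + (n + 1) * m ^ n *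
      (φ.normed volume (z - y) * |g y| - φ.normed volume (z - y) * m)) ≤
      ∫ y, φ.normed volume (z - y) * |g y| ^ (n + 1) := by
    refine integral_mono ((hi0.mul_const _).add ((hi1.sub (hi0.mul_const _)).const_mul _)) hi2 fun y => ?_
    have h3 := mul_le_mul_of_nonneg_left (tangent_pow (abs_nonneg (g y)) hm0 n)
      (φ.nonneg_normed (μ := volume) (z - y))
    calc _ = φ.normed volume (z - y) * (m ^ (n + 1) + (n + 1) * m ^ n * (|g y| - m)) := by ring
      _ ≤ _ := h3
  have hi3 : Integrable fun y => (n + 1) * m ^ n *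
      (φ.normed volume (z - y) * |g y| - φ.normed volume (z - y) * m) :=
    (hi1.sub (hi0.mul_const _)).const_mul _
  rw [integral_add (hi0.mul_const _) hi3, integral_const_mul, integral_sub hi1 (hi0.mul_const _), integral_mul_const, integral_mul_const,
    mol_one, ← mol_eq φ (fun z => |g z|), ← hm] at h2
  rw [mol_eq]
  linarith

theorem mol_fderiv_apply (φ : ContDiffBump (0 : ℝ × Sp d)) {g : ℝ × Sp d → ℝ}
    (hg : LocallyIntegrable g) (z e : ℝ × Sp d) :
    fderiv ℝ (mol φ g) z e = ∫ y, fderiv ℝ (φ.normed volume) (z - y) e * g y := by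
  have h1 : ContDiff ℝ 1 (φ.normed (volume : Measure (ℝ × Sp d))) := φ.contDiff_normed (n := 1)
  have h := φ.hasCompactSupport_normed.hasFDerivAt_convolution_left
    (ContinuousLinearMap.lsmul ℝ ℝ) h1 hg z
  have h2 := ((φ.hasCompactSupport_normed (μ := volume)).fderiv (𝕜 := ℝ)).convolutionExists_left
    ((ContinuousLinearMap.lsmul ℝ ℝ).precompL (ℝ × Sp d)) (h1.continuous_fderiv (by simp)) hg z
  rw [mol, h.fderiv, convolution_eq_swap, ContinuousLinearMap.integral_apply h2.integrable_swap]
  rfl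

theorem mol_fderiv_integrable (φ : ContDiffBump (0 : ℝ × Sp d)) {g : ℝ × Sp d → ℝ}
    (hg : LocallyIntegrable g) (z e : ℝ × Sp d) :
    Integrable fun y => fderiv ℝ (φ.normed volume) (z - y) e * g y := by
  have h1 : ContDiff ℝ 1 (φ.normed (volume : Measure (ℝ × Sp d))) := φ.contDiff_normed (n := 1)
  have h2 := ((φ.hasCompactSupport_normed (μ := volume)).fderiv (𝕜 := ℝ)).convolutionExists_left
    ((ContinuousLinearMap.lsmul ℝ ℝ).precompL (ℝ × Sp d)) (h1.continuous_fderiv (by simp)) hg z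
  exact h2.integrable_swap.apply_continuousLinearMap e

theorem normed_zero (φ : ContDiffBump (0 : ℝ × Sp d)) {G : Set (ℝ × Sp d)} {z y : ℝ × Sp d}
    (hz : Metric.closedBall z φ.rOut ⊆ G) (hy : y ∉ G) : φ.normed volume (z - y) = 0 ∧
      fderiv ℝ (φ.normed volume) (z - y) = 0 := by
  have : z - y ∉ tsupport (φ.normed volume) := by
    rw [φ.tsupport_normed_eq]
    intro h
    apply hy
    apply hz
    rw [Metric.mem_closedBall, dist_eq_norm, norm_sub_rev]
    simpa using h
  refine ⟨image_eq_zero_of_notMem_tsupport this, ?_⟩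
  by_contra hc
  exact this (tsupport_fderiv_subset ℝ (subset_tsupport _ hc))

/-- derivative of a mollification -/
theorem mol_deriv (φ : ContDiffBump (0 : ℝ × Sp d)) {G : Set (ℝ × Sp d)} (hGm : MeasurableSet G)
    {v v' : ℝ × Sp d → ℝ} {e z : ℝ × Sp d} (hv : IntegrableOn v G) (hv' : IntegrableOn v' G)
    (hl : ∀ y ∈ G, HasLineDerivAt ℝ v (v' y) y e) (hz : Metric.closedBall z φ.rOut ⊆ G) :
    fderiv ℝ (mol φ (G.indicator v)) z e = mol φ (G.indicator v') z := by
  have i1 : LocallyIntegrable (G.indicator v) := ((integrable_indicator_iff hGm).2 hv).locallyIntegrable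
  have i2 : LocallyIntegrable (G.indicator v') := ((integrable_indicator_iff hGm).2 hv').locallyIntegrable
  have key1 : ∀ w : ℝ × Sp d → ℝ, (fun y => φ.normed volume (z - y) * G.indicator w y) =
      fun y => φ.normed volume (z - y) * w y := by
    intro w; ext y
    by_cases hy : y ∈ G
    · simp [hy]
    · simp [hy, (normed_zero φ hz hy).1]
  have key2 : (fun y => fderiv ℝ (φ.normed volume) (z - y) e * G.indicator v y) =
      fun y => fderiv ℝ (φ.normed volume) (z - y) e * v y := by
    ext y
    by_cases hy : y ∈ G
    · simp [hy]
    · simp [hy, (normed_zero φ hz hy).2]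
  have j1 := mol_integrable φ i1 z
  have j2 := mol_integrable φ i2 z
  have j3 := mol_fderiv_integrable φ i1 z e
  rw [key1] at j1 j2
  rw [key2] at j3
  rw [mol_fderiv_apply φ i1, mol_eq, key1, key2]
  have h := integral_bilinear_hasLineDerivAt_right_eq_neg_left_of_integrable
    (f := fun y => φ.normed volume (z - y)) (f' := fun y => - fderiv ℝ (φ.normed volume) (z - y) e)
    (g := v) (g' := v') (v := e) (B := ContinuousLinearMap.mul ℝ ℝ) (μ := (volume : Measure (ℝ × Sp d)))
    (by simpa using j3) (by simpa using j2) (by simpa using j1)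
    (fun y _ => by
      have h1 : ContDiff ℝ 1 (φ.normed (volume : Measure (ℝ × Sp d))) := φ.contDiff_normed (n := 1)
      have h2 : HasFDerivAt (φ.normed volume) (fderiv ℝ (φ.normed volume) (z - y)) (z - y) :=
        ((h1.differentiable (by simp)) _).hasFDerivAt
      have h3 : HasFDerivAt (fun y => z - y) (-ContinuousLinearMap.id ℝ (ℝ × Sp d)) y :=
        (hasFDerivAt_id y).const_sub z
      have h4 := (h2.comp y h3).hasLineDerivAt e
      have h5 : (fderiv ℝ (φ.normed volume) (z - y) ∘SL (-ContinuousLinearMap.id ℝ (ℝ × Sp d))) e =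
          - fderiv ℝ (φ.normed volume) (z - y) e := by simp
      rw [h5] at h4
      exact h4)
    (fun y hy => by
      apply hl
      by_contra hyG
      have hcl : tsupport (fun y => φ.normed volume (z - y)) ⊆ Metric.closedBall z φ.rOut := by
        refine closure_minimal ?_ Metric.isClosed_closedBall
        intro x hx
        by_contra hc
        exact hx (normed_zero φ subset_rfl hc).1
      exact hyG (hz (hcl hy)))
  simp only [ContinuousLinearMap.mul_apply'] at h
  rw [h, ← integral_neg]
  congr 1; ext y; ring

end PGE

namespace PGE

variable {d : ℕ}

/-- spatial coordinate directions in space-time -/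
def ee (i : Fin d) : ℝ × Sp d := ((0 : ℝ), EuclideanSpace.single i (1 : ℝ))

theorem clm_decomp (L : ℝ × Sp d →L[ℝ] ℝ) (w : ℝ × Sp d) :
    L w = w.1 * L ((1 : ℝ), (0 : Sp d)) + ∑ i, w.2 i * L (ee i) := by
  have h : w = w.1 • ((1 : ℝ), (0 : Sp d)) + ∑ i, w.2 i • ee i := by
    refine Prod.ext ?_ ?_
    · simp [ee, Prod.fst_sum]
    · simp only [Prod.snd_add, Prod.smul_snd, smul_zero, zero_add, Prod.snd_sum, ee]
      ext j
      simp [Pi.single_apply]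
  conv_lhs => rw [h]
  rw [map_add, map_sum, map_smul, smul_eq_mul]
  simp

/-- the jet of a smooth function. -/
def jetOf (v : ℝ × Sp d → ℝ) : Jet d :=
  ⟨v, fun z => fderiv ℝ v z ((1 : ℝ), (0 : Sp d)),
    fun z => WithLp.toLp 2 fun i => fderiv ℝ v z (ee i),
    fun z => WithLp.toLp 2 fun i => fderiv ℝ (fun w => fderiv ℝ v w (ee i)) z ((1 : ℝ), (0 : Sp d)),
    fun z => Matrix.of fun i j => fderiv ℝ (fun w => fderiv ℝ v w (ee i)) z (ee j)⟩

theorem jetOf_ok {v : ℝ × Sp d → ℝ} (hv : ContDiff ℝ 2 v) : (jetOf v).Ok where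
  hv z := by
    have h : HasFDerivAt v (fderiv ℝ v z) z := (hv.differentiable (by simp) z).hasFDerivAt
    refine h.congr_fderiv (ContinuousLinearMap.ext fun w => ?_)
    rw [clm_decomp, Jet.dv_apply]
    simp only [jetOf, PiLp.inner_apply]
    rw [mul_comm]
    congr 1
  hg z := by
    rw [← hasFDerivWithinAt_univ, hasFDerivWithinAt_euclidean]
    intro i
    rw [hasFDerivWithinAt_univ]
    have h1 : ContDiff ℝ 1 (fun w => fderiv ℝ v w (ee i)) :=
      (hv.fderiv_right (m := 1) (by norm_num)).clm_apply contDiff_const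
    have h2 := (h1.differentiable (by simp) z).hasFDerivAt
    refine h2.congr_fderiv (ContinuousLinearMap.ext fun w => ?_)
    rw [clm_decomp]
    simp [jetOf, Jet.dg_apply, Matrix.mulVec, dotProduct, mul_comm]
  hs z := by
    ext i j
    have h1 : Differentiable ℝ (fderiv ℝ v) :=
      (hv.fderiv_right (m := 1) (by norm_num)).differentiable (by simp)
    have h3 : ∀ k l, fderiv ℝ (fun w => fderiv ℝ v w (ee k)) z (ee l) =
        fderiv ℝ (fderiv ℝ v) z (ee l) (ee k) := by
      intro k l
      have := ((h1 z).hasFDerivAt.clm_apply (hasFDerivAt_const (ee k) z)).fderiv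
      rw [this]; simp
    have h4 := (hv.contDiffAt (x := z)).isSymmSndFDerivAt (by simp)
    simp only [jetOf, Matrix.transpose_apply, Matrix.of_apply]
    rw [h3, h3]
    exact h4.eq _ _

/-- generalized dominated convergence, upper bound. -/
theorem gdct {α : Type*} [MeasurableSpace α] {μ : Measure α} {F h : ℕ → α → ℝ≥0∞} {F' h' : α → ℝ≥0∞}
    (hFm : ∀ n, Measurable (F n)) (hhm : ∀ n, Measurable (h n)) (hF'm : Measurable F')
    (hle : ∀ n z, F n z ≤ h n z)
    (hF : ∀ᵐ z ∂μ, Filter.Tendsto (fun n => F n z) Filter.atTop (nhds (F' z)))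
    (hh : ∀ᵐ z ∂μ, Filter.Tendsto (fun n => h n z) Filter.atTop (nhds (h' z)))
    (hI : ∀ n, ∫⁻ z, h n z ∂μ = ∫⁻ z, h' z ∂μ) (hh'm : Measurable h') (hfin : ∫⁻ z, h' z ∂μ ≠ ⊤)
    {B : ℝ≥0∞} (hB : ∫⁻ z, F' z ∂μ < B) : ∀ᶠ n in Filter.atTop, ∫⁻ z, F n z ∂μ ≤ B := by
  set I := ∫⁻ z, h' z ∂μ with hIdef
  have hFI : ∀ n, ∫⁻ z, F n z ∂μ ≤ I := fun n => (lintegral_mono (hle n)).trans (hI n).le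
  rcases lt_or_ge I B with hIB | hIB
  · exact Filter.Eventually.of_forall fun n => (hFI n).trans hIB.le
  have hfa : ∀ᵐ z ∂μ, h' z < ⊤ := ae_lt_top hh'm hfin
  have hFleh : F' ≤ᵐ[μ] h' := by
    filter_upwards [hF, hh] with z h1 h2
    exact le_of_tendsto_of_tendsto' h1 h2 fun n => hle n z
  have h1 : ∫⁻ z, (h' z - F' z) ∂μ ≤ Filter.liminf (fun n => ∫⁻ z, (h n z - F n z) ∂μ) Filter.atTop := by
    refine le_trans (le_of_eq ?_) (lintegral_liminf_le fun n => (hhm n).sub (hFm n))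
    refine lintegral_congr_ae ?_
    filter_upwards [hF, hh, hfa] with z h1 h2 h3
    exact (ENNReal.Tendsto.sub h2 h1 (Or.inl h3.ne)).liminf_eq.symm
  have h2 : ∫⁻ z, (h' z - F' z) ∂μ = I - ∫⁻ z, F' z ∂μ :=
    lintegral_sub hF'm (((lintegral_mono_ae hFleh).trans_lt (lt_top_iff_ne_top.2 hfin)).ne) hFleh
  have h3 : ∀ n, ∫⁻ z, (h n z - F n z) ∂μ = I - ∫⁻ z, F n z ∂μ := fun n => by
    rw [lintegral_sub (hFm n) (((hFI n).trans_lt (lt_top_iff_ne_top.2 hfin)).ne)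
      (Filter.Eventually.of_forall (hle n)), hI n]
  rw [h2] at h1
  simp only [h3] at h1
  have h4 : I - B < I - ∫⁻ z, F' z ∂μ := by
    have hBt : B ≠ ⊤ := (hIB.trans_lt (lt_top_iff_ne_top.2 hfin)).ne
    rw [ENNReal.sub_lt_iff_lt_left hBt hIB]
    calc I = (∫⁻ z, F' z ∂μ) + (I - ∫⁻ z, F' z ∂μ) := (add_tsub_cancel_of_le (hB.le.trans hIB)).symm
      _ < _ := ENNReal.add_lt_add_right (ENNReal.sub_ne_top hfin) hB
  filter_upwards [Filter.eventually_lt_of_lt_liminf (h4.trans_le h1)] with n hn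
  by_contra hc
  push Not at hc
  exact absurd hn (not_lt.2 (tsub_le_tsub_left hc.le I))

/-- A function dominated in the `L_{d+1}` sense. -/
structure Good (G : Set (ℝ × Sp d)) (W g : ℝ × Sp d → ℝ) : Prop where
  meas : Measurable g
  le : ∀ z ∈ G, |g z| ^ (d + 1) ≤ W z

theorem Good.intOn {G : Set (ℝ × Sp d)} {W g : ℝ × Sp d → ℝ} (h : Good G W g) (hG : IsCompact G)
    (hW : IntegrableOn W G) : IntegrableOn g G := by
  have h1 : IntegrableOn (fun z => 1 + W z) G :=
    (integrableOn_const hG.measure_lt_top.ne).add hW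
  refine Integrable.mono' h1 h.meas.aestronglyMeasurable ?_
  refine (ae_restrict_iff' hG.measurableSet).2 (Filter.Eventually.of_forall fun z hz => ?_)
  have h2 := h.le z hz
  rw [Real.norm_eq_abs]
  rcases le_or_gt |g z| 1 with h3 | h3
  · have : 0 ≤ |g z| ^ (d + 1) := by positivity
    linarith
  · have := le_self_pow₀ h3.le (by omega : d + 1 ≠ 0)
    linarith

theorem Good.loc {G : Set (ℝ × Sp d)} {W g : ℝ × Sp d → ℝ} (h : Good G W g) (hG : IsCompact G)
    (hW : IntegrableOn W G) : LocallyIntegrable (G.indicator g) :=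
  ((integrable_indicator_iff hG.measurableSet).2 (h.intOn hG hW)).locallyIntegrable

theorem Good.mol_le {G : Set (ℝ × Sp d)} {W g : ℝ × Sp d → ℝ} (h : Good G W g) (hG : IsCompact G)
    (hW : IntegrableOn W G) (φ : ContDiffBump (0 : ℝ × Sp d)) (z : ℝ × Sp d) :
    |mol φ (G.indicator g) z| ^ (d + 1) ≤ mol φ (G.indicator W) z := by
  have hWi : LocallyIntegrable (G.indicator W) :=
    ((integrable_indicator_iff hG.measurableSet).2 hW).locallyIntegrable
  have hle : ∀ z, |G.indicator g z| ^ (d + 1) ≤ G.indicator W z := by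
    intro z
    by_cases hz : z ∈ G
    · simpa [hz] using h.le z hz
    · simp [hz]
  have hp : LocallyIntegrable fun z => |G.indicator g z| ^ (d + 1) := by
    refine hWi.mono ?_ ?_
    · have := h.meas.indicator hG.measurableSet
      exact (((continuous_abs.measurable.comp this)).pow_const _).aestronglyMeasurable
    · refine Filter.Eventually.of_forall fun z => ?_
      rw [Real.norm_of_nonneg (by positivity)]
      exact (hle z).trans (le_abs_self _)
  exact (mol_jensen φ (h.loc hG hW) d hp z).trans (mol_mono φ hp hWi hle z)

end PGE

namespace PGE

variable {d : ℕ}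

theorem Ell.entry_le {δ : ℝ} (hδ : 0 < δ) {a : Matrix (Fin d) (Fin d) ℝ} (h : Ell δ a) (hs : a.IsSymm)
    (i j : Fin d) : |a i j| ≤ 2 / δ := by
  have hd : ∀ k, 0 ≤ a k k ∧ a k k ≤ δ⁻¹ := fun k => by
    refine ⟨?_, h.diag_le k⟩
    have := (h (EuclideanSpace.single k 1)).1
    simp at this
    linarith
  have h2 := h (EuclideanSpace.single i 1 + EuclideanSpace.single j 1)
  have e : ∑ k, ∑ l, a k l * (EuclideanSpace.single i (1 : ℝ) + EuclideanSpace.single j 1 : Sp d) k *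
      (EuclideanSpace.single i (1 : ℝ) + EuclideanSpace.single j 1 : Sp d) l =
      a i i + a i j + a j i + a j j := by
    simp [mul_add, add_mul, Finset.sum_add_distrib, Pi.single_apply]
    ring
  rw [e] at h2
  have h3 : ‖(EuclideanSpace.single i (1 : ℝ) + EuclideanSpace.single j 1 : Sp d)‖ ≤ 2 := by
    refine (norm_add_le _ _).trans ?_
    simp; norm_num
  have h4 : ‖(EuclideanSpace.single i (1 : ℝ) + EuclideanSpace.single j 1 : Sp d)‖ ^ 2 ≤ 4 := by
    have := norm_nonneg (EuclideanSpace.single i (1 : ℝ) + EuclideanSpace.single j 1 : Sp d)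
    nlinarith
  have h5 : a j i = a i j := hs.apply i j
  have h6 : 0 < δ⁻¹ := by positivity
  have h7 : δ⁻¹ * ‖(EuclideanSpace.single i (1 : ℝ) + EuclideanSpace.single j 1 : Sp d)‖ ^ 2 ≤ δ⁻¹ * 4 :=
    mul_le_mul_of_nonneg_left h4 h6.le
  have h8 : 0 ≤ δ * ‖(EuclideanSpace.single i (1 : ℝ) + EuclideanSpace.single j 1 : Sp d)‖ ^ 2 := by
    positivity
  have hi := hd i
  have hj := hd j
  rw [div_eq_mul_inv]
  refine abs_le.2 ⟨?_, ?_⟩ <;> linarith [h2.1, h2.2, hi.1, hi.2, hj.1, hj.2]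

/-- the cylinder -/
def Qc (d : ℕ) : Set (ℝ × Sp d) := Ioo (0 : ℝ) 2 ×ˢ Metric.ball (0 : Sp d) 1

/-- The hypotheses of the theorem. -/
structure Sol (δ K : ℝ) (a : ℝ × Sp d → Matrix (Fin d) (Fin d) ℝ) (b : ℝ × Sp d → Sp d)
    (c u ut : ℝ × Sp d → ℝ) (du : ℝ × Sp d → Sp d) (d2u : ℝ × Sp d → Matrix (Fin d) (Fin d) ℝ) :
    Prop where
  ma : ∀ i j, Measurable fun z => a z i j
  mb : ∀ i, Measurable fun z => b z i
  mc : Measurable c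
  sa : ∀ z, (a z).IsSymm
  ea : ∀ z, Ell δ (a z)
  bK : ∀ z, ‖b z‖ + c z ≤ K
  c0 : ∀ z, 0 ≤ c z
  mu : Measurable u
  mt : Measurable ut
  mdu : ∀ i, Measurable fun z => du z i
  md2u : ∀ i j, Measurable fun z => d2u z i j
  cu : ContinuousOn u (closure (Qc d))
  ht : ∀ z ∈ Qc d, HasDerivAt (fun s => u (s, z.2)) (ut z) z.1
  hx : ∀ z ∈ Qc d, ∀ i,
    HasDerivAt (fun s : ℝ => u (z.1, z.2 + s • EuclideanSpace.single i (1 : ℝ))) (du z i) 0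
  hxx : ∀ z ∈ Qc d, ∀ i j,
    HasDerivAt (fun s : ℝ => du (z.1, z.2 + s • EuclideanSpace.single j (1 : ℝ)) i) (d2u z i j) 0
  hi : ∀ G : Set (ℝ × Sp d), IsCompact G → G ⊆ Qc d →
    IntegrableOn (fun z => |ut z| ^ ((d : ℝ) + 1) + ‖du z‖ ^ ((d : ℝ) + 1) +
            frobNorm (d2u z) ^ ((d : ℝ) + 1)) G volume

theorem line_t {u ut : ℝ × Sp d → ℝ} {z : ℝ × Sp d}
    (h : HasDerivAt (fun s => u (s, z.2)) (ut z) z.1) :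
    HasLineDerivAt ℝ u (ut z) z ((1 : ℝ), (0 : Sp d)) := by
  have h2 : HasDerivAt (fun s : ℝ => z.1 + s) 1 0 := (hasDerivAt_id (0 : ℝ)).const_add z.1
  have h3 : HasDerivAt (fun s => u (s, z.2)) (ut z) (z.1 + 0) := by simpa using h
  have h4 := HasDerivAt.comp (0 : ℝ) h3 h2
  rw [HasLineDerivAt]
  have e : (fun t : ℝ => u (z + t • ((1 : ℝ), (0 : Sp d)))) = (fun s => u (s, z.2)) ∘ fun s => z.1 + s := by
    ext t
    simp only [Function.comp]
    congr 1
    ext <;> simp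
  rw [e]
  simpa using h4

theorem line_x {u : ℝ × Sp d → ℝ} {p : ℝ} {z : ℝ × Sp d} {i : Fin d}
    (h : HasDerivAt (fun s : ℝ => u (z.1, z.2 + s • EuclideanSpace.single i (1 : ℝ))) p 0) :
    HasLineDerivAt ℝ u p z (ee i) := by
  rw [HasLineDerivAt]
  have e : (fun t : ℝ => u (z + t • ee i)) =
      fun s : ℝ => u (z.1, z.2 + s • EuclideanSpace.single i (1 : ℝ)) := by
    ext t
    congr 1
    refine Prod.ext ?_ ?_ <;> simp [ee]
  rw [e]
  exact h

theorem frob_ge (m : Matrix (Fin d) (Fin d) ℝ) (i j : Fin d) : |m i j| ≤ frobNorm m := by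
  rw [frobNorm]
  refine Real.le_sqrt_of_sq_le ?_
  rw [sq_abs]
  calc m i j ^ 2 ≤ ∑ j, m i j ^ 2 :=
        Finset.single_le_sum (f := fun j => m i j ^ 2) (fun _ _ => by positivity) (Finset.mem_univ j)
    _ ≤ _ := Finset.single_le_sum (f := fun i => ∑ j, m i j ^ 2)
        (fun _ _ => Finset.sum_nonneg fun _ _ => by positivity) (Finset.mem_univ i)

/-- the operator applied to pointwise derivatives -/
def Lop (a : ℝ × Sp d → Matrix (Fin d) (Fin d) ℝ) (b : ℝ × Sp d → Sp d)
    (c u ut : ℝ × Sp d → ℝ) (du : ℝ × Sp d → Sp d) (d2u : ℝ × Sp d → Matrix (Fin d) (Fin d) ℝ)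
    (z : ℝ × Sp d) : ℝ :=
  ut z + ip (a z) (d2u z) + (∑ i, b z i * du z i) - c z * u z

/-- constant in the crude bound on the operator -/
def CL (d : ℕ) (δ K : ℝ) : ℝ := 1 + d * (d * (2 / δ)) + d * K + K

theorem Lop_le {δ K : ℝ} (hδ : 0 < δ) {a : ℝ × Sp d → Matrix (Fin d) (Fin d) ℝ} {b : ℝ × Sp d → Sp d}
    {c u ut : ℝ × Sp d → ℝ} {du : ℝ × Sp d → Sp d} {d2u : ℝ × Sp d → Matrix (Fin d) (Fin d) ℝ}
    {z : ℝ × Sp d} (ha : Ell δ (a z)) (hs : (a z).IsSymm) (hb : ‖b z‖ ≤ K) (hc : |c z| ≤ K)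
    {m : ℝ} (hm : 0 ≤ m) (h1 : |u z| ≤ m) (h2 : |ut z| ≤ m) (h3 : ∀ i, |du z i| ≤ m)
    (h4 : ∀ i j, |d2u z i j| ≤ m) : |Lop a b c u ut du d2u z| ≤ CL d δ K * m := by
  have hK : 0 ≤ K := (abs_nonneg _).trans hc
  have e1 : |ip (a z) (d2u z)| ≤ d * (d * (2 / δ)) * m := by
    rw [ip]
    calc _ ≤ ∑ i, |∑ j, a z i j * d2u z i j| := Finset.abs_sum_le_sum_abs _ _
      _ ≤ ∑ i : Fin d, ∑ j : Fin d, 2 / δ * m := by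
          refine Finset.sum_le_sum fun i _ => (Finset.abs_sum_le_sum_abs _ _).trans ?_
          refine Finset.sum_le_sum fun j _ => ?_
          rw [abs_mul]
          exact mul_le_mul (ha.entry_le hδ hs i j) (h4 i j) (abs_nonneg _) (by positivity)
      _ = _ := by simp; ring
  have e2 : |∑ i, b z i * du z i| ≤ d * K * m := by
    calc _ ≤ ∑ i, |b z i * du z i| := Finset.abs_sum_le_sum_abs _ _
      _ ≤ ∑ i : Fin d, K * m := by
          refine Finset.sum_le_sum fun j _ => ?_
          rw [abs_mul]
          refine mul_le_mul ?_ (h3 j) (abs_nonneg _) hK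
          have := PiLp.norm_apply_le (b z) j
          rw [Real.norm_eq_abs] at this
          exact this.trans hb
      _ = _ := by simp; ring
  have e3 : |c z * u z| ≤ K * m := by
    rw [abs_mul]; exact mul_le_mul hc h1 (abs_nonneg _) hK
  rw [Lop, CL]
  calc _ ≤ |ut z + ip (a z) (d2u z) + ∑ i, b z i * du z i| + |c z * u z| := abs_sub _ _
    _ ≤ |ut z| + |ip (a z) (d2u z)| + |∑ i, b z i * du z i| + |c z * u z| := by
        gcongr; exact abs_add_three _ _ _
    _ ≤ _ := by linarith

theorem Lop_meas {a : ℝ × Sp d → Matrix (Fin d) (Fin d) ℝ} {b : ℝ × Sp d → Sp d}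
    {c u ut : ℝ × Sp d → ℝ} {du : ℝ × Sp d → Sp d} {d2u : ℝ × Sp d → Matrix (Fin d) (Fin d) ℝ}
    (ma : ∀ i j, Measurable fun z => a z i j) (mb : ∀ i, Measurable fun z => b z i)
    (mc : Measurable c) (mu : Measurable u) (mt : Measurable ut)
    (mdu : ∀ i, Measurable fun z => du z i) (md2u : ∀ i j, Measurable fun z => d2u z i j) :
    Measurable (Lop a b c u ut du d2u) := by
  unfold Lop ip
  refine ((mt.add ?_).add ?_).sub (mc.mul mu)
  · exact Finset.measurable_sum _ fun i _ => Finset.measurable_sum _ fun j _ => (ma i j).mul (md2u i j)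
  · exact Finset.measurable_sum _ fun i _ => (mb i).mul (mdu i)

theorem Lop_tendsto {a : ℝ × Sp d → Matrix (Fin d) (Fin d) ℝ} {b : ℝ × Sp d → Sp d}
    {c : ℝ × Sp d → ℝ} {u ut : ℕ → ℝ × Sp d → ℝ} {du : ℕ → ℝ × Sp d → Sp d}
    {d2u : ℕ → ℝ × Sp d → Matrix (Fin d) (Fin d) ℝ} {u' ut' : ℝ × Sp d → ℝ} {du' : ℝ × Sp d → Sp d}
    {d2u' : ℝ × Sp d → Matrix (Fin d) (Fin d) ℝ} {z : ℝ × Sp d}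
    (h1 : Filter.Tendsto (fun n => u n z) Filter.atTop (nhds (u' z)))
    (h2 : Filter.Tendsto (fun n => ut n z) Filter.atTop (nhds (ut' z)))
    (h3 : ∀ i, Filter.Tendsto (fun n => du n z i) Filter.atTop (nhds (du' z i)))
    (h4 : ∀ i j, Filter.Tendsto (fun n => d2u n z i j) Filter.atTop (nhds (d2u' z i j))) :
    Filter.Tendsto (fun n => Lop a b c (u n) (ut n) (du n) (d2u n) z) Filter.atTop
      (nhds (Lop a b c u' ut' du' d2u' z)) := by
  unfold Lop ip
  refine ((h2.add ?_).add ?_).sub (h1.const_mul _)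
  · exact tendsto_finset_sum _ fun i _ => tendsto_finset_sum _ fun j _ => (h4 i j).const_mul _
  · exact tendsto_finset_sum _ fun i _ => (h3 i).const_mul _

end PGE

namespace PGE

variable {d : ℕ}

/-- the estimate for smooth functions -/
def SmoothEst (d : ℕ) (δ K γ N : ℝ) : Prop :=
  ∀ (J : Jet d) (a : ℝ × Sp d → Matrix (Fin d) (Fin d) ℝ)
      (b : ℝ × Sp d → Sp d) (c : ℝ × Sp d → ℝ) (T0 T1 R A : ℝ), J.Ok → (∀ z, Ell δ (a z)) →
      (∀ z, ‖b z‖ ≤ K) → (∀ z, 0 ≤ c z) → (∀ z, c z ≤ K) → 0 < A →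
      1 / 2 ≤ R → R ≤ 1 → T1 - T0 ≤ 2 → 
      (∫⁻ z in Zc T0 T1 (0 : Sp d) R, ENNReal.ofReal
        |J.t z + ip (a z) (J.H z) + inner ℝ (b z) (J.g z) - c z * J.v z| ^ (d + 1)
          ≤ ENNReal.ofReal A ^ (d + 1)) →
      (∀ z ∈ Zc T0 T1 0 R, (z.1 = T1 ∨ ‖z.2‖ = R) → |J.v z| ≤ A) →
      ∫⁻ z in Ioo (T0 + 1 / 2) T1 ×ˢ Metric.ball (0 : Sp d) R, ENNReal.ofReal ‖J.g z‖ ^ γ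
        ≤ ENNReal.ofReal (N * A ^ γ)

theorem Zc_subset_Qc {ε : ℝ} (h0 : 0 < ε) : Zc ε (2 - ε) (0 : Sp d) (1 - ε) ⊆ Qc d := by
  rintro z ⟨h1, h2⟩
  refine ⟨⟨by linarith [h1.1], by linarith [h1.2]⟩, ?_⟩
  have := mem_closedBall_iff_norm.1 h2
  rw [mem_ball_iff_norm]
  linarith

theorem Qc_open : IsOpen (Qc d) := isOpen_Ioo.prod Metric.isOpen_ball

/-- a sequence of bump functions -/
def bump {r : ℝ} (hr : 0 < r) (n : ℕ) : ContDiffBump (0 : ℝ × Sp d) where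
  rIn := r / (n + 1) / 2
  rOut := r / (n + 1)
  rIn_pos := by positivity
  rIn_lt_rOut := half_lt_self (by positivity)

theorem bump_rOut {r : ℝ} (hr : 0 < r) (n : ℕ) : (bump (d := d) hr n).rOut = r / (n + 1) := rfl

theorem bump_le {r : ℝ} (hr : 0 < r) (n : ℕ) : (bump (d := d) hr n).rOut ≤ r := by
  rw [bump_rOut]
  exact div_le_self hr.le (by linarith [Nat.cast_nonneg (α := ℝ) n])

theorem bump_ae {r : ℝ} (hr : 0 < r) {g : ℝ × Sp d → ℝ} (hg : LocallyIntegrable g) :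
    ∀ᵐ z, Filter.Tendsto (fun n => mol (bump hr n) g z) Filter.atTop (nhds (g z)) := by
  refine ContDiffBump.ae_convolution_tendsto_right_of_locallyIntegrable (K := 2) ?_ ?_ hg
  · simp only [bump_rOut]
    have := tendsto_one_div_add_atTop_nhds_zero_nat (𝕜 := ℝ)
    have h2 := this.const_mul r
    simpa [div_eq_mul_inv] using h2
  · refine Filter.Eventually.of_forall fun n => le_of_eq ?_
    simp only [bump]
    ring

theorem ofReal_abs_tendsto {x : ℕ → ℝ} {y : ℝ} (h : Filter.Tendsto x Filter.atTop (nhds y)) (k : ℕ) :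
    Filter.Tendsto (fun n => ENNReal.ofReal |x n| ^ k) Filter.atTop (nhds (ENNReal.ofReal |y| ^ k)) :=
  ENNReal.Tendsto.pow (ENNReal.tendsto_ofReal h.abs)

theorem local_est {δ K γ N : ℝ} (hδ0 : 0 < δ) (hγ : 0 < γ) (hS : SmoothEst d δ K γ N)
    {a : ℝ × Sp d → Matrix (Fin d) (Fin d) ℝ} {b : ℝ × Sp d → Sp d}
    {c u ut : ℝ × Sp d → ℝ} {du : ℝ × Sp d → Sp d} {d2u : ℝ × Sp d → Matrix (Fin d) (Fin d) ℝ}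
    (h : Sol δ K a b c u ut du d2u) {ε A r1 : ℝ} (hε0 : 0 < ε) (hε1 : ε ≤ 1 / 2) (hA : 0 < A)
    (hr1 : 0 < r1)
    (hF : ∫⁻ z in Zc ε (2 - ε) (0 : Sp d) (1 - ε), ENNReal.ofReal |Lop a b c u ut du d2u z| ^ (d + 1) <
      ENNReal.ofReal A ^ (d + 1))
    (hb : ∀ z ∈ Zc ε (2 - ε) (0 : Sp d) (1 - ε), (z.1 = 2 - ε ∨ ‖z.2‖ = 1 - ε) →
      ∀ y ∈ Qc d, dist y z < r1 → |u y| ≤ A) :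
    ∫⁻ z in Ioo (ε + 1 / 2) (2 - ε) ×ˢ Metric.ball (0 : Sp d) (1 - ε), ENNReal.ofReal ‖du z‖ ^ γ
        ≤ ENNReal.ofReal (N * A ^ γ) := by
  set Ω := Zc ε (2 - ε) (0 : Sp d) (1 - ε) with hΩ
  have hΩc : IsCompact Ω := Zc_compact
  obtain ⟨r0, hr0, hr0Q⟩ := hΩc.exists_cthickening_subset_open Qc_open (Zc_subset_Qc hε0)
  set G := Metric.cthickening r0 Ω with hG
  have hGc : IsCompact G := hΩc.cthickening
  have hGm : MeasurableSet G := hGc.measurableSet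
  have hΩm : MeasurableSet Ω := hΩc.measurableSet
  have hΩG : Ω ⊆ G := Metric.self_subset_cthickening _
  set r := min r0 r1 / 2 with hr
  have hrp : 0 < r := by have := lt_min hr0 hr1; positivity
  have hrr0 : r ≤ r0 / 2 := by have := min_le_left r0 r1; linarith
  have hrr1 : r < r1 := by
    have := min_le_right r0 r1
    have := lt_min hr0 hr1
    linarith
  set T := Metric.thickening (r0 / 2) Ω with hT
  have hTo : IsOpen T := Metric.isOpen_thickening
  have hΩT : Ω ⊆ T := Metric.self_subset_thickening (by linarith) _
  have hTG : ∀ z ∈ T, ∀ n, Metric.closedBall z (bump (d := d) hrp n).rOut ⊆ G := by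
    intro z hz n y hy
    obtain ⟨w, hw, hzw⟩ := Metric.mem_thickening_iff.1 hz
    refine Metric.mem_cthickening_of_dist_le y w r0 Ω hw ?_
    have h1 := bump_le (d := d) hrp n
    have h2 := Metric.mem_closedBall.1 hy
    linarith [dist_triangle y z w]
  -- domination
  set W : ℝ × Sp d → ℝ := fun z => |u z| ^ (d + 1) +
    (|ut z| ^ (d + 1) + ‖du z‖ ^ (d + 1) + frobNorm (d2u z) ^ (d + 1)) with hW
  have hfr : ∀ m : Matrix (Fin d) (Fin d) ℝ, 0 ≤ frobNorm m := fun m => Real.sqrt_nonneg _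
  have hW0 : ∀ z, 0 ≤ W z := fun z => by have := hfr (d2u z); simp only [hW]; positivity
  have huG : ContinuousOn u G := h.cu.mono (hr0Q.trans subset_closure)
  have hWi : IntegrableOn W G := by
    have h1 := h.hi G hGc hr0Q
    have h2 : IntegrableOn (fun z => |u z| ^ (d + 1)) G := (huG.abs.pow _).integrableOn_compact hGc
    refine h2.add ?_
    refine h1.congr (Filter.Eventually.of_forall fun z => ?_)
    have e : ((d : ℝ) + 1) = ((d + 1 : ℕ) : ℝ) := by push_cast; ring
    simp only [e, Real.rpow_natCast]
  have gu : Good G W u := ⟨h.mu, fun z _ => by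
    have := hfr (d2u z); simp only [hW]; exact le_add_of_nonneg_right (by positivity)⟩
  have gt : Good G W ut := ⟨h.mt, fun z _ => by
    have := hfr (d2u z)
    have h1 : 0 ≤ |u z| ^ (d + 1) := by positivity
    have h2 : 0 ≤ ‖du z‖ ^ (d + 1) := by positivity
    have h3 : 0 ≤ frobNorm (d2u z) ^ (d + 1) := by positivity
    simp only [hW]; linarith⟩
  have gx : ∀ i, Good G W fun z => du z i := fun i => ⟨h.mdu i, fun z _ => by
    have := hfr (d2u z)
    have h1 : 0 ≤ |u z| ^ (d + 1) := by positivity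
    have h2 : 0 ≤ |ut z| ^ (d + 1) := by positivity
    have h3 : 0 ≤ frobNorm (d2u z) ^ (d + 1) := by positivity
    have h4 : |du z i| ^ (d + 1) ≤ ‖du z‖ ^ (d + 1) := by
      have := PiLp.norm_apply_le (du z) i
      rw [Real.norm_eq_abs] at this
      gcongr
    simp only [hW]; linarith⟩
  have gxx : ∀ i j, Good G W fun z => d2u z i j := fun i j => ⟨h.md2u i j, fun z _ => by
    have h1 : 0 ≤ |u z| ^ (d + 1) := by positivity
    have h2 : 0 ≤ |ut z| ^ (d + 1) := by positivity
    have h3 : 0 ≤ ‖du z‖ ^ (d + 1) := by positivity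
    have h4 : |d2u z i j| ^ (d + 1) ≤ frobNorm (d2u z) ^ (d + 1) := by
      have := frob_ge (d2u z) i j
      gcongr
    simp only [hW]; linarith⟩
  -- the mollified function
  let J : ℕ → Jet d := fun n => jetOf (mol (bump hrp n) (G.indicator u))
  have hJ : ∀ n, (J n).Ok := fun n => jetOf_ok (mol_contDiff _ (gu.loc hGc hWi) 2)
  have hJv : ∀ n z, (J n).v z = mol (bump hrp n) (G.indicator u) z := fun n z => rfl
  have hJt : ∀ n, ∀ z ∈ T, (J n).t z = mol (bump hrp n) (G.indicator ut) z := fun n z hz =>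
    mol_deriv _ hGm (gu.intOn hGc hWi) (gt.intOn hGc hWi) (fun y hy => line_t (h.ht y (hr0Q hy)))
      (hTG z hz n)
  have hJg' : ∀ n, ∀ z ∈ T, ∀ i, fderiv ℝ (mol (bump hrp n) (G.indicator u)) z (ee i) =
      mol (bump hrp n) (G.indicator fun y => du y i) z := fun n z hz i =>
    mol_deriv _ hGm (gu.intOn hGc hWi) ((gx i).intOn hGc hWi) (fun y hy => line_x (h.hx y (hr0Q hy) i))
      (hTG z hz n)
  have hJg : ∀ n, ∀ z ∈ T, ∀ i, (J n).g z i = mol (bump hrp n) (G.indicator fun y => du y i) z := hJg'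
  have hJH : ∀ n, ∀ z ∈ T, ∀ i j, (J n).H z i j =
      mol (bump hrp n) (G.indicator fun y => d2u y i j) z := by
    intro n z hz i j
    have e1 : (J n).H z i j = fderiv ℝ (fun w => fderiv ℝ (mol (bump hrp n) (G.indicator u)) w (ee i)) z
      (ee j) := rfl
    have e2 : (fun w => fderiv ℝ (mol (bump hrp n) (G.indicator u)) w (ee i)) =ᶠ[nhds z]
        mol (bump hrp n) (G.indicator fun y => du y i) := by
      filter_upwards [hTo.mem_nhds hz] with w hw
      exact hJg' n w hw i
    rw [e1, e2.fderiv_eq]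
    exact mol_deriv _ hGm ((gx i).intOn hGc hWi) ((gxx i j).intOn hGc hWi)
      (fun y hy => line_x (u := fun y => du y i) (h.hxx y (hr0Q hy) i j)) (hTG z hz n)
  have hmJt : ∀ n, Measurable (J n).t := fun n => by
    have := (mol_contDiff (bump hrp n) (gu.loc hGc hWi) 2).continuous_fderiv (by simp)
    exact (this.clm_apply continuous_const).measurable
  have hmJg : ∀ n i, Measurable fun z => (J n).g z i := fun n i => by
    have := (mol_contDiff (bump hrp n) (gu.loc hGc hWi) 2).continuous_fderiv (by simp)
    exact (this.clm_apply continuous_const).measurable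
  have hmJH : ∀ n i j, Measurable fun z => (J n).H z i j := fun n i j => by
    have h1 : ContDiff ℝ 1 (fun w => fderiv ℝ (mol (bump hrp n) (G.indicator u)) w (ee i)) :=
      ((mol_contDiff (bump hrp n) (gu.loc hGc hWi) 2).fderiv_right (m := 1) (by norm_num)).clm_apply
        contDiff_const
    exact ((h1.continuous_fderiv (by simp)).clm_apply continuous_const).measurable
  have hdun : Measurable fun z => ‖du z‖ := by
    simp only [EuclideanSpace.norm_eq]
    refine Real.continuous_sqrt.measurable.comp (Finset.measurable_sum _ fun i _ => ?_)
    exact ((h.mdu i).norm).pow_const 2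
  have hfrm : Measurable fun z => frobNorm (d2u z) := by
    unfold frobNorm
    refine Real.continuous_sqrt.measurable.comp (Finset.measurable_sum _ fun i _ =>
      Finset.measurable_sum _ fun j _ => ?_)
    exact (h.md2u i j).pow_const 2
  have hWm : Measurable W :=
    ((continuous_abs.measurable.comp h.mu).pow_const _).add
      ((((continuous_abs.measurable.comp h.mt).pow_const _).add (hdun.pow_const _)).add
        (hfrm.pow_const _))
  have hK : 0 ≤ K := (norm_nonneg (b 0)).trans (by linarith [h.bK 0, h.c0 0])
  have hCL : 0 ≤ CL d δ K := by unfold CL; positivity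
  have hWloc : LocallyIntegrable (G.indicator W) :=
    ((integrable_indicator_iff hGm).2 hWi).locallyIntegrable
  have hWind0 : ∀ z, 0 ≤ G.indicator W z := fun z => indicator_nonneg (fun z _ => hW0 z) z
  -- almost everywhere convergence
  have au := bump_ae hrp (gu.loc hGc hWi)
  have at' := bump_ae hrp (gt.loc hGc hWi)
  have ax : ∀ᵐ z, ∀ i, Filter.Tendsto (fun n => mol (bump hrp n) (G.indicator fun y => du y i) z)
      Filter.atTop (nhds (G.indicator (fun y => du y i) z)) :=
    ae_all_iff.2 fun i => bump_ae hrp ((gx i).loc hGc hWi)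
  have axx : ∀ᵐ z, ∀ i j, Filter.Tendsto (fun n => mol (bump hrp n) (G.indicator fun y => d2u y i j) z)
      Filter.atTop (nhds (G.indicator (fun y => d2u y i j) z)) :=
    ae_all_iff.2 fun i => ae_all_iff.2 fun j => bump_ae hrp ((gxx i j).loc hGc hWi)
  have aW := bump_ae hrp hWloc
  have hbK : ∀ z, ‖b z‖ ≤ K := fun z => by linarith [h.bK z, h.c0 z]
  have hcK : ∀ z, c z ≤ K := fun z => by linarith [h.bK z, norm_nonneg (b z)]
  -- convergence of the right-hand sides
  have hev : ∀ᶠ n in Filter.atTop, ∫⁻ z, Ω.indicator (fun z => ENNReal.ofReal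
      |Lop a b c (J n).v (J n).t (J n).g (J n).H z| ^ (d + 1)) z ≤ ENNReal.ofReal A ^ (d + 1) := by
    have mL : ∀ n, Measurable (Lop a b c (J n).v (J n).t (J n).g (J n).H) := fun n =>
      Lop_meas h.ma h.mb h.mc (hJ n).cv.measurable (hmJt n) (hmJg n) (hmJH n)
    refine gdct (F' := Ω.indicator (fun z => ENNReal.ofReal |Lop a b c u ut du d2u z| ^ (d + 1)))
      (h := fun n z => ENNReal.ofReal (CL d δ K ^ (d + 1)) *
        ENNReal.ofReal (mol (bump hrp n) (G.indicator W) z))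
      (h' := fun z => ENNReal.ofReal (CL d δ K ^ (d + 1)) * ENNReal.ofReal (G.indicator W z))
      ?_ ?_ ?_ ?_ ?_ ?_ ?_ ?_ ?_ ?_
    · intro n
      exact ((ENNReal.measurable_ofReal.comp (continuous_abs.measurable.comp (mL n))).pow_const
        (d + 1)).indicator hΩm
    · intro n
      exact measurable_const.mul (ENNReal.measurable_ofReal.comp
        (mol_contDiff (bump hrp n) hWloc 0).continuous.measurable)
    · exact ((ENNReal.measurable_ofReal.comp (continuous_abs.measurable.comp
        (Lop_meas h.ma h.mb h.mc h.mu h.mt h.mdu h.md2u))).pow_const (d + 1)).indicator hΩm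
    · intro n z
      by_cases hz : z ∈ Ω
      · rw [indicator_of_mem hz]
        set Y := mol (bump hrp n) (G.indicator W) z with hY
        have hY0 : 0 ≤ Y := mol_nonneg _ hWind0 z
        set m := Y ^ (((d + 1 : ℕ) : ℝ)⁻¹) with hm
        have hm0 : 0 ≤ m := Real.rpow_nonneg hY0 _
        have hmY : m ^ (d + 1) = Y := Real.rpow_inv_natCast_pow hY0 (by omega)
        have hgd : ∀ g, Good G W g → |mol (bump hrp n) (G.indicator g) z| ≤ m := by
          intro g hg
          have := hg.mol_le hGc hWi (bump hrp n) z
          rw [← hY, ← hmY] at this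
          exact le_of_pow_le_pow_left₀ (by omega) hm0 this
        have hzT := hΩT hz
        have hl := Lop_le (u := (J n).v) (ut := (J n).t) (du := (J n).g) (d2u := (J n).H) hδ0 (h.ea z)
          (h.sa z) (hbK z) (c := c) (by rw [abs_of_nonneg (h.c0 z)]; exact hcK z) hm0
          (hgd u gu) (by rw [hJt n z hzT]; exact hgd _ gt)
          (fun i => by rw [hJg n z hzT]; exact hgd _ (gx i))
          (fun i j => by rw [hJH n z hzT]; exact hgd _ (gxx i j))
        rw [← ENNReal.ofReal_pow (abs_nonneg _), ← ENNReal.ofReal_mul (pow_nonneg hCL _)]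
        refine ENNReal.ofReal_le_ofReal ?_
        rw [← hmY, ← mul_pow]
        exact pow_le_pow_left₀ (abs_nonneg _) hl _
      · rw [indicator_of_notMem hz]; exact zero_le
    · filter_upwards [au, at', ax, axx] with z h1 h2 h3 h4
      by_cases hz : z ∈ Ω
      · simp only [indicator_of_mem hz]
        have hzG := hΩG hz
        have hzT := hΩT hz
        simp only [indicator_of_mem hzG] at h1 h2 h3 h4
        refine ofReal_abs_tendsto (Lop_tendsto h1 ?_ ?_ ?_) _
        · simpa only [hJt _ z hzT] using h2
        · intro i; simpa only [hJg _ z hzT] using h3 i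
        · intro i j; simpa only [hJH _ z hzT] using h4 i j
      · simp only [indicator_of_notMem hz]
        exact tendsto_const_nhds
    · filter_upwards [aW] with z h1
      exact ENNReal.Tendsto.const_mul (ENNReal.tendsto_ofReal h1) (Or.inr ENNReal.ofReal_ne_top)
    · intro n
      rw [lintegral_const_mul' _ _ ENNReal.ofReal_ne_top, lintegral_const_mul' _ _ ENNReal.ofReal_ne_top,
        mol_lintegral _ ((integrable_indicator_iff hGm).2 hWi) hWind0]
    · exact measurable_const.mul (ENNReal.measurable_ofReal.comp (hWm.indicator hGm))
    · rw [lintegral_const_mul' _ _ ENNReal.ofReal_ne_top]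
      refine ENNReal.mul_ne_top ENNReal.ofReal_ne_top ?_
      rw [← ofReal_integral_eq_lintegral_ofReal ((integrable_indicator_iff hGm).2 hWi)
        (Filter.Eventually.of_forall hWind0)]
      exact ENNReal.ofReal_ne_top
    · rw [lintegral_indicator hΩm]; exact hF
  have hfin : ∀ᶠ n in Filter.atTop, ∫⁻ z in Ioo (ε + 1 / 2) (2 - ε) ×ˢ Metric.ball (0 : Sp d) (1 - ε),
      ENNReal.ofReal ‖(J n).g z‖ ^ γ ≤ ENNReal.ofReal (N * A ^ γ) := by
    filter_upwards [hev] with n hn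
    have hin : ∀ z, inner ℝ (b z) ((J n).g z) = ∑ i, b z i * (J n).g z i := fun z => by
      rw [PiLp.inner_apply]
      exact Finset.sum_congr rfl fun i _ => mul_comm _ _
    refine hS (J n) a b c ε (2 - ε) (1 - ε) A (hJ n) h.ea hbK h.c0 hcK hA (by linarith) (by linarith)
      (by linarith) ?_ ?_
    · rw [lintegral_indicator hΩm] at hn
      simp only [hin]
      exact hn
    · intro z hz hbz
      rw [hJv, mol_eq]
      have hzT := hΩT hz
      have hpt : ∀ y, |(bump (d := d) hrp n).normed volume (z - y) * G.indicator u y| ≤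
          (bump (d := d) hrp n).normed volume (z - y) * A := by
        intro y
        have h0 := (bump (d := d) hrp n).nonneg_normed (μ := volume) (z - y)
        rw [abs_mul, abs_of_nonneg h0]
        by_cases hy : y ∈ Metric.closedBall z (bump (d := d) hrp n).rOut
        · refine mul_le_mul_of_nonneg_left ?_ h0
          have hyG := hTG z hzT n hy
          rw [indicator_of_mem hyG]
          refine hb z hz hbz y (hr0Q hyG) ?_
          have := bump_le (d := d) hrp n
          linarith [Metric.mem_closedBall.1 hy]
        · rw [(normed_zero _ subset_rfl hy).1]; simp
      have hi0 : Integrable fun y => (bump (d := d) hrp n).normed volume (z - y) :=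
        ((bump (d := d) hrp n).integrable_normed (μ := volume)).comp_sub_left z
      calc _ ≤ ∫ y, |(bump (d := d) hrp n).normed volume (z - y) * G.indicator u y| :=
            abs_integral_le_integral_abs
        _ ≤ ∫ y, (bump (d := d) hrp n).normed volume (z - y) * A :=
            integral_mono (mol_integrable _ (gu.loc hGc hWi) z).abs (hi0.mul_const _) hpt
        _ = A := by rw [integral_mul_const, mol_one, one_mul]
  -- Fatou
  set P := Ioo (ε + 1 / 2) (2 - ε) ×ˢ Metric.ball (0 : Sp d) (1 - ε) with hP
  have hPm : MeasurableSet P := measurableSet_Ioo.prod measurableSet_ball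
  have hPΩ : P ⊆ Ω := by
    rintro z ⟨h1, h2⟩
    exact ⟨⟨by linarith [h1.1], h1.2.le⟩, Metric.ball_subset_closedBall h2⟩
  have hlim : ∀ᵐ z ∂(volume.restrict P), Filter.Tendsto (fun n => ENNReal.ofReal ‖(J n).g z‖ ^ γ)
      Filter.atTop (nhds (ENNReal.ofReal ‖du z‖ ^ γ)) := by
    refine (ae_restrict_iff' hPm).2 ?_
    filter_upwards [ax] with z h3 hz
    have hzT := hΩT (hPΩ hz)
    have hzG := hΩG (hPΩ hz)
    simp only [indicator_of_mem hzG] at h3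
    have h4 : Filter.Tendsto (fun n => ‖(J n).g z‖) Filter.atTop (nhds ‖du z‖) := by
      simp only [EuclideanSpace.norm_eq, hJg _ z hzT]
      refine (Real.continuous_sqrt.tendsto _).comp (tendsto_finset_sum _ fun i _ => ?_)
      exact ((h3 i).norm).pow 2
    exact (ENNReal.continuous_rpow_const.tendsto _).comp (ENNReal.tendsto_ofReal h4)
  calc ∫⁻ z in P, ENNReal.ofReal ‖du z‖ ^ γ
      = ∫⁻ z in P, Filter.liminf (fun n => ENNReal.ofReal ‖(J n).g z‖ ^ γ) Filter.atTop := by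
        refine lintegral_congr_ae ?_
        filter_upwards [hlim] with z hz
        exact hz.liminf_eq.symm
    _ ≤ Filter.liminf (fun n => ∫⁻ z in P, ENNReal.ofReal ‖(J n).g z‖ ^ γ) Filter.atTop :=
        lintegral_liminf_le fun n =>
          (ENNReal.measurable_ofReal.comp (hJ n).cg.norm.measurable).pow_const γ
    _ ≤ ENNReal.ofReal (N * A ^ γ) := Filter.liminf_le_of_frequently_le' hfin.frequently

end PGE

namespace PGE

variable {d : ℕ}

/-- parabolic boundary of the cylinder -/
def Bd (d : ℕ) : Set (ℝ × Sp d) := Set.Icc (0 : ℝ) 2 ×ˢ Metric.sphere (0 : Sp d) 1 ∪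
                    {(2 : ℝ)} ×ˢ Metric.ball (0 : Sp d) 1

theorem Qc_closure : closure (Qc d) = Icc (0 : ℝ) 2 ×ˢ Metric.closedBall (0 : Sp d) 1 := by
  rw [Qc, closure_prod_eq, closure_Ioo (by norm_num), closure_ball _ (by norm_num)]

theorem Bd_subset : Bd d ⊆ closure (Qc d) := by
  rw [Qc_closure]
  rintro z (⟨h1, h2⟩ | ⟨h1, h2⟩)
  · exact ⟨h1, Metric.sphere_subset_closedBall h2⟩
  · refine ⟨?_, Metric.ball_subset_closedBall h2⟩
    rw [mem_singleton_iff] at h1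
    rw [h1]; constructor <;> norm_num

theorem Bd_near {ε : ℝ} (hε0 : 0 < ε) (hε1 : ε ≤ 1 / 2) {z : ℝ × Sp d}
    (hz : z ∈ Zc ε (2 - ε) (0 : Sp d) (1 - ε)) (h : z.1 = 2 - ε ∨ ‖z.2‖ = 1 - ε) :
    ∃ p ∈ Bd d, dist z p ≤ ε := by
  rcases h with h | h
  · refine ⟨((2 : ℝ), z.2), Or.inr ⟨rfl, ?_⟩, ?_⟩
    · have := mem_closedBall_iff_norm.1 hz.2
      rw [mem_ball_iff_norm]
      change ‖z.2 - 0‖ < 1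
      linarith
    · rw [Prod.dist_eq]
      refine max_le ?_ ?_
      · change dist z.1 2 ≤ ε
        rw [h, Real.dist_eq, show 2 - ε - 2 = -ε by ring, abs_neg, abs_of_pos hε0]
      · change dist z.2 z.2 ≤ ε
        simp [hε0.le]
  · have h1 : 0 < 1 - ε := by linarith
    refine ⟨(z.1, (1 - ε)⁻¹ • z.2), Or.inl ⟨⟨by linarith [hz.1.1], by linarith [hz.1.2]⟩, ?_⟩, ?_⟩
    · rw [mem_sphere_iff_norm]
      change ‖(1 - ε)⁻¹ • z.2 - 0‖ = 1
      rw [sub_zero, norm_smul, Real.norm_of_nonneg (by positivity), h, inv_mul_cancel₀ h1.ne']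
    · rw [Prod.dist_eq]
      refine max_le ?_ ?_
      · change dist z.1 z.1 ≤ ε
        simp [hε0.le]
      · change dist z.2 ((1 - ε)⁻¹ • z.2) ≤ ε
        have e : z.2 - (1 - ε)⁻¹ • z.2 = (1 - (1 - ε)⁻¹) • z.2 := by rw [sub_smul, one_smul]
        rw [dist_eq_norm, e, norm_smul, h, Real.norm_eq_abs]
        have e2 : 1 - (1 - ε)⁻¹ = -(ε * (1 - ε)⁻¹) := by field_simp; ring
        rw [e2, abs_neg, abs_of_pos (by positivity), mul_assoc, inv_mul_cancel₀ h1.ne', mul_one]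

theorem final_est {δ K γ N : ℝ} (hδ0 : 0 < δ) (hγ : 0 < γ) (hS : SmoothEst d δ K γ N)
    {a : ℝ × Sp d → Matrix (Fin d) (Fin d) ℝ} {b : ℝ × Sp d → Sp d}
    {c u ut : ℝ × Sp d → ℝ} {du : ℝ × Sp d → Sp d} {d2u : ℝ × Sp d → Matrix (Fin d) (Fin d) ℝ}
    (h : Sol δ K a b c u ut du d2u) {A S : ℝ} (hS0 : 0 ≤ S) (hA : S < A)
    (hu : ∀ z ∈ Bd d, |u z| ≤ S)
    (hF : ∫⁻ z in Qc d, ENNReal.ofReal |Lop a b c u ut du d2u z| ^ (d + 1) <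
      ENNReal.ofReal A ^ (d + 1)) :
    ∫⁻ z in Ioo (1 : ℝ) 2 ×ˢ Metric.ball (0 : Sp d) 1, ENNReal.ofReal ‖du z‖ ^ γ
        ≤ ENNReal.ofReal (N * A ^ γ) := by
  have hcc : IsCompact (closure (Qc d)) := by
    rw [Qc_closure]; exact isCompact_Icc.prod (isCompact_closedBall _ _)
  have huc := hcc.uniformContinuousOn_of_continuous h.cu
  obtain ⟨w, hw, hwu⟩ := Metric.uniformContinuousOn_iff.1 huc (A - S) (by linarith)
  set ε0 := min (1 / 2) (w / 3) with hε0
  have hε0p : 0 < ε0 := lt_min (by norm_num) (by positivity)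
  let ε : ℕ → ℝ := fun n => ε0 / (n + 1)
  have hεp : ∀ n, 0 < ε n := fun n => by positivity
  have hεle : ∀ n, ε n ≤ ε0 := fun n => div_le_self hε0p.le (by linarith [Nat.cast_nonneg (α := ℝ) n])
  have hεanti : ∀ m n, m ≤ n → ε n ≤ ε m := fun m n hmn => by
    have : (m : ℝ) ≤ n := by exact_mod_cast hmn
    change ε0 / (n + 1) ≤ ε0 / (m + 1)
    gcongr
  have hεlim : Filter.Tendsto ε Filter.atTop (nhds 0) := by
    have h2 := (tendsto_one_div_add_atTop_nhds_zero_nat (𝕜 := ℝ)).const_mul ε0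
    simpa [div_eq_mul_inv, ε] using h2
  let P : ℕ → Set (ℝ × Sp d) := fun n => Ioo (1 : ℝ) (2 - ε n) ×ˢ Metric.ball (0 : Sp d) (1 - ε n)
  have hPn : ∀ n, ∫⁻ z in P n, ENNReal.ofReal ‖du z‖ ^ γ ≤ ENNReal.ofReal (N * A ^ γ) := by
    intro n
    have h1 : ε n ≤ 1 / 2 := (hεle n).trans (min_le_left _ _)
    have h2 : ε n ≤ w / 3 := (hεle n).trans (min_le_right _ _)
    refine le_trans (lintegral_mono_set ?_) (local_est hδ0 hγ hS h (hεp n) h1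
      (lt_of_le_of_lt hS0 hA) (r1 := w / 3) (by positivity)
      (lt_of_le_of_lt (lintegral_mono_set (Zc_subset_Qc (hεp n))) hF) ?_)
    · refine prod_mono (Ioo_subset_Ioo (by linarith) le_rfl) subset_rfl
    · intro z hz hb y hy hyz
      obtain ⟨p, hp, hzp⟩ := Bd_near (hεp n) h1 hz hb
      have h3 := hwu y (subset_closure hy) p (Bd_subset hp) (by
        have := dist_triangle y z p
        linarith)
      rw [Real.dist_eq] at h3
      have h4 := hu p hp
      have h5 := abs_sub_abs_le_abs_sub (u y) (u p)
      linarith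
  have hmono : Monotone P := fun m n hmn => by
    have := hεanti m n hmn
    exact prod_mono (Ioo_subset_Ioo le_rfl (by linarith)) (Metric.ball_subset_ball (by linarith))
  have hU : Ioo (1 : ℝ) 2 ×ˢ Metric.ball (0 : Sp d) 1 ⊆ ⋃ n, P n := by
    rintro z ⟨h1, h2⟩
    rw [mem_ball_iff_norm] at h2
    have h3 : 0 < min (2 - z.1) (1 - ‖z.2 - 0‖) := lt_min (by linarith [h1.2]) (by linarith)
    obtain ⟨n, hn⟩ := (hεlim.eventually (gt_mem_nhds h3)).exists
    refine mem_iUnion.2 ⟨n, ⟨h1.1, ?_⟩, ?_⟩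
    · linarith [min_le_left (2 - z.1) (1 - ‖z.2 - 0‖)]
    · rw [mem_ball_iff_norm]
      linarith [min_le_right (2 - z.1) (1 - ‖z.2 - 0‖)]
  refine (lintegral_mono_set hU).trans ?_
  rw [setLIntegral_iUnion_of_directed _ hmono.directed_le]
  exact iSup_le hPn

end PGE

namespace PGE

variable {d : ℕ}

theorem sup_props {u : ℝ × Sp d → ℝ} (hc : ContinuousOn u (closure (Qc d))) :
    0 ≤ (⨆ z ∈ Bd d, |u z|) ∧ ∀ z ∈ Bd d, |u z| ≤ ⨆ z ∈ Bd d, |u z| := by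
  have hcc : IsCompact (closure (Qc d)) := by
    rw [Qc_closure]; exact isCompact_Icc.prod (isCompact_closedBall _ _)
  obtain ⟨C, hC⟩ := hcc.exists_bound_of_continuousOn hc
  refine ⟨Real.iSup_nonneg fun z => Real.iSup_nonneg fun _ => abs_nonneg _, fun z hz => ?_⟩
  have hb : BddAbove (range fun z => ⨆ (_ : z ∈ Bd d), |u z|) := by
    refine ⟨max C 0, ?_⟩
    rintro _ ⟨y, rfl⟩
    exact Real.iSup_le (fun hy => le_max_of_le_left (hC y (Bd_subset hy))) (le_max_right _ _)
  have h1 := le_ciSup hb z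
  have h2 : (⨆ (_ : z ∈ Bd d), |u z|) = |u z| := ciSup_pos hz
  simp only [h2] at h1
  exact h1

theorem combine {δ K γ N : ℝ} (hδ0 : 0 < δ) (hγ : 0 < γ) (hγ1 : γ ≤ 1) (hN : 0 < N)
    (hS : SmoothEst d δ K γ N)
    {a : ℝ × Sp d → Matrix (Fin d) (Fin d) ℝ} {b : ℝ × Sp d → Sp d}
    {c u ut : ℝ × Sp d → ℝ} {du : ℝ × Sp d → Sp d} {d2u : ℝ × Sp d → Matrix (Fin d) (Fin d) ℝ}
    (h : Sol δ K a b c u ut du d2u) :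
    ∫⁻ z in Ioo (1 : ℝ) 2 ×ˢ Metric.ball (0 : Sp d) 1, ENNReal.ofReal ‖du z‖ ^ γ
      ≤ ENNReal.ofReal N * (∫⁻ z in Qc d, ENNReal.ofReal |Lop a b c u ut du d2u z| ^ ((d : ℝ) + 1))
          ^ (γ / ((d : ℝ) + 1))
        + ENNReal.ofReal N * ENNReal.ofReal ((⨆ z ∈ Bd d, |u z|) ^ γ) := by
  obtain ⟨hS0, hSu⟩ := sup_props h.cu
  set S := ⨆ z ∈ Bd d, |u z| with hSdef
  set F := ∫⁻ z in Qc d, ENNReal.ofReal |Lop a b c u ut du d2u z| ^ ((d : ℝ) + 1) with hFdef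
  have hd1 : (0 : ℝ) < (d : ℝ) + 1 := by positivity
  by_cases hF : F = ⊤
  · rw [hF, ENNReal.top_rpow_of_pos (by positivity), ENNReal.mul_top (by simpa using hN), top_add]
    exact le_top
  set G := F ^ (1 / ((d : ℝ) + 1)) with hG
  have hGt : G ≠ ⊤ := ENNReal.rpow_ne_top_of_nonneg (by positivity) hF
  have hGF : G ^ (d + 1) = F := by
    rw [hG, ← ENNReal.rpow_natCast, ← ENNReal.rpow_mul]
    push_cast
    rw [one_div, inv_mul_cancel₀ hd1.ne', ENNReal.rpow_one]
  have hF2 : ∫⁻ z in Qc d, ENNReal.ofReal |Lop a b c u ut du d2u z| ^ (d + 1) = F := by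
    rw [hFdef]
    refine lintegral_congr fun z => ?_
    rw [← ENNReal.rpow_natCast]; push_cast; rfl
  set f := G.toReal with hf
  have hf0 : 0 ≤ f := ENNReal.toReal_nonneg
  have hGf : G = ENNReal.ofReal f := (ENNReal.ofReal_toReal hGt).symm
  have hη : ∀ η : ℝ, 0 < η → 
      ∫⁻ z in Ioo (1 : ℝ) 2 ×ˢ Metric.ball (0 : Sp d) 1, ENNReal.ofReal ‖du z‖ ^ γ
        ≤ ENNReal.ofReal (N * (f + S + η) ^ γ) := by
    intro η hη
    refine final_est hδ0 hγ hS h hS0 (by linarith) hSu ?_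
    rw [hF2, ← hGF, hGf]
    have hlt : ENNReal.ofReal f < ENNReal.ofReal (f + S + η) :=
      (ENNReal.ofReal_lt_ofReal_iff (by linarith)).2 (by linarith)
    exact ENNReal.pow_right_strictMono (Nat.succ_ne_zero d) hlt
  have hlim : Filter.Tendsto (fun η : ℝ => ENNReal.ofReal (N * (f + S + η) ^ γ))
      (nhdsWithin 0 (Ioi 0)) (nhds (ENNReal.ofReal (N * (f + S) ^ γ))) := by
    refine ENNReal.tendsto_ofReal ?_
    have hcont : Continuous fun η : ℝ => N * (f + S + η) ^ γ :=
      continuous_const.mul ((continuous_const.add continuous_id).rpow_const fun _ => Or.inr hγ.le)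
    have := hcont.tendsto 0
    simp only [add_zero] at this
    exact this.mono_left nhdsWithin_le_nhds
  have hI := ge_of_tendsto hlim (by
    filter_upwards [self_mem_nhdsWithin] with η h' using hη η h')
  refine hI.trans ?_
  rw [ENNReal.ofReal_mul hN.le, ← mul_add]
  gcongr
  rw [← ENNReal.ofReal_rpow_of_nonneg (by positivity) hγ.le, ENNReal.ofReal_add hf0 hS0]
  refine (ENNReal.rpow_add_le_add_rpow _ _ hγ.le hγ1).trans ?_
  rw [← hGf, ← ENNReal.ofReal_rpow_of_nonneg hS0 hγ.le, hG, ← ENNReal.rpow_mul]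
  rw [one_div, inv_mul_eq_div]

end PGE

/-- **Lemma 2.1.** There are constants `γ ∈ (0,1]` and `N`, depending only on `δ`, `K`, `d`,
such that for any operator `L ∈ 𝔏_{δ,K}` and any
`u ∈ W^{1,2}_{d+1,loc}(C_{2,1}) ∩ C(C̄_{2,1})` one has
`∫_{C_{1,1}(1,0)} |Du|^γ ≤ N (∫_{C_{2,1}} |Lu|^{d+1})^{γ/(d+1)} + N sup_{∂'C_{2,1}} |u|^γ`.
Here `C_{2,1} = (0,2) × B₁`, `C_{1,1}(1,0) = (1,2) × B₁`,
`∂'C_{2,1} = ([0,2] × ∂B₁) ∪ ({2} × B₁)`, and the Sobolev membership is expressed through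
the pointwise time derivative `ut`, spatial gradient `du` and spatial Hessian `d2u` of `u`,
together with their measurability and local `L_{d+1}`-integrability. -/
theorem parabolic_gradient_estimate
    (d : ℕ) (hd : 1 ≤ d) (δ K : ℝ) (hδ0 : 0 < δ) (hδ1 : δ < 1) (hK : 0 ≤ K) :
    ∃ γ N : ℝ, γ ∈ Set.Ioc (0 : ℝ) 1 ∧ 0 < N ∧
      ∀ (a : ℝ × EuclideanSpace ℝ (Fin d) → Matrix (Fin d) (Fin d) ℝ)
        (b : ℝ × EuclideanSpace ℝ (Fin d) → EuclideanSpace ℝ (Fin d))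
        (c : ℝ × EuclideanSpace ℝ (Fin d) → ℝ)
        (u ut : ℝ × EuclideanSpace ℝ (Fin d) → ℝ)
        (du : ℝ × EuclideanSpace ℝ (Fin d) → EuclideanSpace ℝ (Fin d))
        (d2u : ℝ × EuclideanSpace ℝ (Fin d) → Matrix (Fin d) (Fin d) ℝ),
        -- measurability of the coefficients of `L`
        (∀ i j, Measurable fun z => a z i j) →
        (∀ i, Measurable fun z => b z i) →
        Measurable c →
        -- `a` is `S_δ`-valued
        (∀ z, (a z).IsSymm) →
        (∀ z (ξ : EuclideanSpace ℝ (Fin d)),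
          δ * ‖ξ‖ ^ 2 ≤ ∑ i, ∑ j, a z i j * ξ i * ξ j ∧
          ∑ i, ∑ j, a z i j * ξ i * ξ j ≤ δ⁻¹ * ‖ξ‖ ^ 2) →
        -- `|b| + c ≤ K`, `c ≥ 0`
        (∀ z, ‖b z‖ + c z ≤ K) →
        (∀ z, 0 ≤ c z) →
        -- measurability of `u` and its derivatives
        Measurable u → Measurable ut →
        (∀ i, Measurable fun z => du z i) →
        (∀ i j, Measurable fun z => d2u z i j) →
        -- `u ∈ C(C̄_{2,1})`
        ContinuousOn u (closure (Set.Ioo (0 : ℝ) 2 ×ˢ Metric.ball (0 : EuclideanSpace ℝ (Fin d)) 1)) →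
        -- `ut = ∂ₜu`, `du = Du`, `d2u = D²u` pointwise in `C_{2,1}`
        (∀ z ∈ Set.Ioo (0 : ℝ) 2 ×ˢ Metric.ball (0 : EuclideanSpace ℝ (Fin d)) 1,
          HasDerivAt (fun s => u (s, z.2)) (ut z) z.1) →
        (∀ z ∈ Set.Ioo (0 : ℝ) 2 ×ˢ Metric.ball (0 : EuclideanSpace ℝ (Fin d)) 1, ∀ i,
          HasDerivAt (fun s : ℝ => u (z.1, z.2 + s • EuclideanSpace.single i (1 : ℝ))) (du z i) 0) →
        (∀ z ∈ Set.Ioo (0 : ℝ) 2 ×ˢ Metric.ball (0 : EuclideanSpace ℝ (Fin d)) 1, ∀ i j,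
          HasDerivAt (fun s : ℝ => du (z.1, z.2 + s • EuclideanSpace.single j (1 : ℝ)) i)
            (d2u z i j) 0) →
        -- local `L_{d+1}` integrability of the derivatives (`u ∈ W^{1,2}_{d+1,loc}`)
        (∀ G : Set (ℝ × EuclideanSpace ℝ (Fin d)), IsCompact G →
          G ⊆ Set.Ioo (0 : ℝ) 2 ×ˢ Metric.ball (0 : EuclideanSpace ℝ (Fin d)) 1 →
          IntegrableOn (fun z => |ut z| ^ ((d : ℝ) + 1) + ‖du z‖ ^ ((d : ℝ) + 1) +
            frobNorm (d2u z) ^ ((d : ℝ) + 1)) G volume) →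
        (∫⁻ z in Set.Ioo (1 : ℝ) 2 ×ˢ Metric.ball (0 : EuclideanSpace ℝ (Fin d)) 1,
            ENNReal.ofReal (‖du z‖) ^ γ ∂volume)
          ≤ ENNReal.ofReal N *
              (∫⁻ z in Set.Ioo (0 : ℝ) 2 ×ˢ Metric.ball (0 : EuclideanSpace ℝ (Fin d)) 1,
                ENNReal.ofReal
                  |ut z + (∑ i, ∑ j, a z i j * d2u z i j) + (∑ i, b z i * du z i) - c z * u z|
                  ^ ((d : ℝ) + 1) ∂volume) ^ (γ / ((d : ℝ) + 1))
            + ENNReal.ofReal N *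
              ENNReal.ofReal
                ((⨆ z ∈ (Set.Icc (0 : ℝ) 2 ×ˢ Metric.sphere (0 : EuclideanSpace ℝ (Fin d)) 1 ∪
                    {(2 : ℝ)} ×ˢ Metric.ball (0 : EuclideanSpace ℝ (Fin d)) 1), |u z|) ^ γ) := by

  obtain ⟨γ, N, hγ0, hγ1, hN, hS⟩ := PGE.smoothA (d := d) hδ0 hδ1 hK
  refine ⟨γ, N, ⟨hγ0, hγ1⟩, hN, ?_⟩
  intro a b c u ut du d2u ma mb mc sa ea bK c0 mu mt mdu md2u cu ht hx hxx hi
  exact PGE.combine hδ0 hγ0 hγ1 hN hS (a := a) (b := b) (c := c) (u := u) (ut := ut) (du := du)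
    (d2u := d2u) ⟨ma, mb, mc, sa, ea, bK, c0, mu, mt, mdu, md2u, cu, ht, hx, hxx, hi⟩
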